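/- arXiv:1611.01735 — 3 statements merged into one kernel-verified Lean document; each statement's English description precedes it below -/
import Mathlib

section
/- Let k, r, n, t be positive integers with 2 ≤ r ≤ k and n ≥ 3(k-1)(t-1), and let U_1, ..., U_k be pairwise disjoint sets each of size n. For each i in [t], let i_1, ..., i_r be pairwise distinct indices in [k] and let F_i ⊆ U_{i_1} × ··· × U_{i_r} be an r-partite r-graph with |F_i| > (t-1)n^{r-1}. Then {F_1, ..., F_t} admits a rainbow matching. -/
/-- The edges of `F` that agree with `g` on the coordinates in `P`. -/
def agreeingEdges {V : Type*} [DecidableEq V] {r : ℕ} (F : Finset (Fin r → V))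
    (P : Finset (Fin r)) (g : Fin r → V) : Finset (Fin r → V) :=
  F.filter fun f => ∀ p ∈ P, f p = g p

section

open Finset

variable {V : Type*} [DecidableEq V] {r : ℕ}

lemma mem_agreeingEdges {F : Finset (Fin r → V)} {P : Finset (Fin r)} {g f : Fin r → V} :
    f ∈ agreeingEdges F P g ↔ f ∈ F ∧ ∀ p ∈ P, f p = g p := by
  simp [agreeingEdges]

lemma card_agreeingEdges_le {n : ℕ} {F : Finset (Fin r → V)} {W : Fin r → Finset V}
    (hW : ∀ p, (W p).card = n) (hF : ∀ f ∈ F, ∀ p, f p ∈ W p)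
    (P : Finset (Fin r)) (g : Fin r → V) :
    (agreeingEdges F P g).card ≤ n ^ (r - P.card) := by
  have hsub : agreeingEdges F P g ⊆ Fintype.piFinset fun p => if p ∈ P then {g p} else W p := by
    intro f hf
    rw [mem_agreeingEdges] at hf
    rw [Fintype.mem_piFinset]
    intro p
    split_ifs with hp
    · simpa using hf.2 p hp
    · exact hF f hf.1 p
  refine (card_le_card hsub).trans (le_of_eq ?_)
  have hcard : ∀ p, (if p ∈ P then {g p} else W p).card = if p ∈ P then 1 else n := by
    intro p
    split_ifs <;> simp [hW]
  rw [Fintype.card_piFinset, prod_congr rfl fun p _ => hcard p, prod_ite, prod_const_one,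
    one_mul, prod_const, filter_not, card_sdiff_of_subset (filter_subset _ _)]
  simp

/-- Fixing further coordinates as long as the number of edges drops by a factor of at most `n / 3`
leads to a set of edges in which no further vertex is heavy. -/
lemma exists_agreeingEdges_no_heavy_vertex (n : ℕ) {F : Finset (Fin r → V)}
    {g₀ : Fin r → V} (hg₀ : g₀ ∈ F) (p₀ : Fin r) :
    ∃ P : Finset (Fin r), ∃ g ∈ F, p₀ ∈ P ∧
      (agreeingEdges F {p₀} g₀).card * 3 ^ (P.card - 1) ≤
        (agreeingEdges F P g).card * n ^ (P.card - 1) ∧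
      ∀ q ∉ P, ∀ f ∈ agreeingEdges F P g,
        n * (agreeingEdges F (insert q P) f).card < 3 * (agreeingEdges F P g).card := by
  set Δ := (agreeingEdges F {p₀} g₀).card with hΔ
  let C : Finset (Finset (Fin r) × (Fin r → V)) :=
    (univ ×ˢ F).filter fun x => p₀ ∈ x.1 ∧
      Δ * 3 ^ (x.1.card - 1) ≤ (agreeingEdges F x.1 x.2).card * n ^ (x.1.card - 1)
  have hC : C.Nonempty := ⟨({p₀}, g₀), by simp [C, hg₀, hΔ]⟩
  obtain ⟨⟨P, g⟩, hPg, hmax⟩ := exists_max_image C (fun x => x.1.card) hC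
  simp only [C, mem_filter, mem_product, mem_univ, true_and] at hPg
  refine ⟨P, g, hPg.1, hPg.2.1, hPg.2.2, fun q hq f hf => ?_⟩
  by_contra! hcon
  have hpos : 0 < P.card := card_pos.2 ⟨p₀, hPg.2.1⟩
  have hins : (insert q P).card = P.card + 1 := card_insert_of_notMem hq
  have hmem : (insert q P, f) ∈ C := by
    simp only [C, mem_filter, mem_product, mem_univ, true_and, hins, Nat.add_sub_cancel]
    refine ⟨(mem_agreeingEdges.1 hf).1, mem_insert_of_mem hPg.2.1, ?_⟩
    obtain ⟨m, hm⟩ : ∃ m, P.card = m + 1 := ⟨P.card - 1, by omega⟩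
    have h := hPg.2.2
    simp only [hm, Nat.add_sub_cancel] at h ⊢
    calc Δ * 3 ^ (m + 1) = 3 * (Δ * 3 ^ m) := by ring
      _ ≤ 3 * ((agreeingEdges F P g).card * n ^ m) := by gcongr
      _ = (3 * (agreeingEdges F P g).card) * n ^ m := by ring
      _ ≤ (n * (agreeingEdges F (insert q P) f).card) * n ^ m := by gcongr
      _ = _ := by ring
  have := hmax _ hmem
  simp only [hins] at this
  omega

lemma exists_rainbow_matching_on [Nonempty V] {ι κ : Type*} [DecidableEq ι] {n s : ℕ}
    (hr : 0 < r) (hn : 0 < n) (hbound : 3 * (r - 1) * s ≤ n)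
    (U : κ → Finset V) (hUcard : ∀ c, (U c).card = n)
    (hUdisj : ∀ a b, a ≠ b → Disjoint (U a) (U b))
    (idx : ι → Fin r → κ) (hidx : ∀ i, Function.Injective (idx i))
    (S : Finset ι) (hS : S.card ≤ s + 1) (F : ι → Finset (Fin r → V))
    (hFmem : ∀ i ∈ S, ∀ f ∈ F i, ∀ p, f p ∈ U (idx i p))
    (hFcard : ∀ i ∈ S, (S.card - 1) * n ^ (r - 1) < (F i).card) :
    ∃ e : ι → Fin r → V, (∀ i ∈ S, e i ∈ F i) ∧
      ∀ i ∈ S, ∀ j ∈ S, i ≠ j → ∀ p q, e i p ≠ e j q := by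
  induction hm : S.card generalizing S F with
  | zero =>
    rw [card_eq_zero] at hm
    subst hm
    exact ⟨fun _ _ => Classical.arbitrary V, by simp, by simp⟩
  | succ m ih =>
    have hclass : ∀ {v a b}, v ∈ U a → v ∈ U b → a = b := by
      intro v a b ha hb
      by_contra hab
      exact disjoint_left.1 (hUdisj a b hab) ha hb
    -- A vertex of maximum degree among all the families.
    let C : Finset ((_ : ι) × (Fin r → V) × Fin r) := S.sigma fun i => F i ×ˢ univ
    have hC : C.Nonempty := by
      obtain ⟨i, hi⟩ := card_pos.1 (by omega : 0 < S.card)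
      obtain ⟨f, hf⟩ := card_pos.1 ((Nat.zero_le _).trans_lt (hFcard i hi))
      exact ⟨⟨i, f, ⟨0, hr⟩⟩, by simp [C, hi, hf]⟩
    obtain ⟨⟨i, g₀, p₀⟩, hmem, hmax⟩ :=
      exists_max_image C (fun x => (agreeingEdges (F x.1) {x.2.2} x.2.1).card) hC
    simp only [C, mem_sigma, mem_product, mem_univ, and_true] at hmem
    obtain ⟨hi, hg₀⟩ := hmem
    obtain ⟨P, g, hg, hp₀, hΔ, hlight⟩ := exists_agreeingEdges_no_heavy_vertex n hg₀ p₀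
    set Δ := (agreeingEdges (F i) {p₀} g₀).card
    have hdeg : ∀ j ∈ S, ∀ c, ∀ v ∈ U c, ((F j).filter fun f => ∃ q, f q = v).card ≤ Δ := by
      intro j hj c v hv
      rcases ((F j).filter fun f => ∃ q, f q = v).eq_empty_or_nonempty with h | ⟨f₁, h₁⟩
      · simp [h]
      · obtain ⟨hf₁, q₁, rfl⟩ := mem_filter.1 h₁
        refine (card_le_card ?_).trans (hmax ⟨j, f₁, q₁⟩ (by simp [C, hj, hf₁]))
        intro f h
        obtain ⟨hf, q, hq⟩ := mem_filter.1 h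
        have hqq : q = q₁ := hidx j
          (hclass (hFmem j hj f hf q) (hq ▸ hFmem j hj f₁ hf₁ q₁))
        subst hqq
        simp [mem_agreeingEdges, hf, hq]
    have hPpos : 0 < P.card := card_pos.2 ⟨p₀, hp₀⟩
    have hPr : P.card ≤ r := by simpa using card_le_univ P
    have hloss : P.card * Δ ≤ n ^ (r - 1) := by
      have h3 : P.card ≤ 3 ^ (P.card - 1) := by
        have := Nat.lt_pow_self (n := P.card - 1) (show 1 < 3 by norm_num)
        omega
      calc P.card * Δ ≤ 3 ^ (P.card - 1) * Δ := by gcongr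
        _ = Δ * 3 ^ (P.card - 1) := mul_comm _ _
        _ ≤ (agreeingEdges (F i) P g).card * n ^ (P.card - 1) := hΔ
        _ ≤ n ^ (r - P.card) * n ^ (P.card - 1) := by
          gcongr
          exact card_agreeingEdges_le (fun p => hUcard (idx i p)) (hFmem i hi) P g
        _ = n ^ (r - 1) := by rw [← pow_add]; congr 1; omega
    -- The other families, with the vertices `g p`, `p ∈ P`, deleted.
    let F' : ι → Finset (Fin r → V) := fun j => (F j).filter fun f => ∀ p ∈ P, ∀ q, f q ≠ g p
    have hF' : ∀ j ∈ S, (F j).card ≤ (F' j).card + n ^ (r - 1) := by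
      intro j hj
      have hsub : F j ⊆ F' j ∪ P.biUnion fun p => (F j).filter fun f => ∃ q, f q = g p := by
        intro f hf
        by_cases h : f ∈ F' j
        · exact mem_union_left _ h
        · refine mem_union_right _ ?_
          simp only [F', mem_filter, hf, true_and, not_forall, not_not] at h
          obtain ⟨p, hp, q, hq⟩ := h
          exact mem_biUnion.2 ⟨p, hp, mem_filter.2 ⟨hf, q, hq⟩⟩
      refine (card_le_card hsub).trans ((card_union_le _ _).trans ?_)
      gcongr
      exact (card_biUnion_le_card_mul _ _ _ fun p _ =>
        hdeg j hj _ _ (hFmem i hi g hg p)).trans hloss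
    have herase : (S.erase i).card = m := by rw [card_erase_of_mem hi]; omega
    obtain ⟨e, he, hdisj⟩ := ih (S.erase i) (by omega) F'
      (fun j hj f hf => hFmem j (mem_of_mem_erase hj) f (mem_filter.1 hf).1)
      (fun j hj => by
        have hmpos : 0 < m := herase ▸ card_pos.2 ⟨j, hj⟩
        have h1 := hFcard j (mem_of_mem_erase hj)
        have h2 := hF' j (mem_of_mem_erase hj)
        obtain ⟨l, rfl⟩ : ∃ l, m = l + 1 := ⟨m - 1, by omega⟩
        rw [hm] at h1
        rw [herase]
        simp only [Nat.add_sub_cancel, add_mul, one_mul] at h1 ⊢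
        omega) herase
    -- An edge of `F i` through all `g p`, `p ∈ P`, that avoids the matching found so far.
    set D := agreeingEdges (F i) P g with hD
    have hDpos : 0 < D.card := card_pos.2 ⟨g, by simp [hD, mem_agreeingEdges, hg]⟩
    let K : Finset (Fin r → V) := ((S.erase i) ×ˢ Pᶜ).biUnion fun x =>
      D.filter fun f => ∃ q, f x.2 = e x.1 q
    have hKone : ∀ x ∈ (S.erase i) ×ˢ Pᶜ,
        n * (D.filter fun f => ∃ q, f x.2 = e x.1 q).card ≤ 3 * D.card - 1 := by
      rintro ⟨j, p⟩ hx
      obtain ⟨hj, hp⟩ := mem_product.1 hx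
      rw [mem_compl] at hp
      rcases (D.filter fun f => ∃ q, f p = e j q).eq_empty_or_nonempty with h | ⟨f₁, hf₁⟩
      · simp [h]
      · obtain ⟨hf₁, q₁, hq₁⟩ := mem_filter.1 hf₁
        have hlt := hlight p hp f₁ hf₁
        refine le_trans (Nat.mul_le_mul_left n (card_le_card ?_)) (Nat.le_sub_one_of_lt hlt)
        intro f hf
        obtain ⟨hf, q, hq⟩ := mem_filter.1 hf
        have hjS := mem_of_mem_erase hj
        have hej := (mem_filter.1 (he j hj)).1
        obtain ⟨hfF, hfP⟩ := mem_agreeingEdges.1 hf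
        obtain ⟨hf₁F, hf₁P⟩ := mem_agreeingEdges.1 hf₁
        have h1 : idx j q = idx i p :=
          hclass (hFmem j hjS _ hej q) (hq ▸ hFmem i hi f hfF p)
        have h2 : idx j q₁ = idx i p :=
          hclass (hFmem j hjS _ hej q₁) (hq₁ ▸ hFmem i hi f₁ hf₁F p)
        have hqq : q = q₁ := hidx j (h1.trans h2.symm)
        subst hqq
        refine mem_agreeingEdges.2 ⟨hfF, fun a ha => ?_⟩
        rcases mem_insert.1 ha with rfl | ha
        · rw [hq, hq₁]
        · rw [hfP a ha, hf₁P a ha]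
    have hK : K.card < D.card := by
      have hcount : ((S.erase i) ×ˢ Pᶜ).card ≤ (r - 1) * s := by
        rw [card_product, herase, card_compl, Fintype.card_fin, mul_comm]
        gcongr <;> omega
      have hle : n * K.card ≤ (r - 1) * s * (3 * D.card - 1) := by
        calc n * K.card
            ≤ n * ∑ x ∈ (S.erase i) ×ˢ Pᶜ, (D.filter fun f => ∃ q, f x.2 = e x.1 q).card := by
              gcongr
              exact card_biUnion_le
          _ = ∑ x ∈ (S.erase i) ×ˢ Pᶜ, n * (D.filter fun f => ∃ q, f x.2 = e x.1 q).card :=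
              mul_sum _ _ _
          _ ≤ ((S.erase i) ×ˢ Pᶜ).card * (3 * D.card - 1) := by
              simpa using sum_le_card_nsmul _ _ _ hKone
          _ ≤ _ := by gcongr
      refine lt_of_mul_lt_mul_left (hle.trans_lt ?_) (Nat.zero_le n)
      rcases Nat.eq_zero_or_pos ((r - 1) * s) with h0 | h0
      · rw [h0, zero_mul]
        positivity
      · calc (r - 1) * s * (3 * D.card - 1) < (r - 1) * s * (3 * D.card) := by
              gcongr
              omega
          _ = 3 * (r - 1) * s * D.card := by ring
          _ ≤ n * D.card := by gcongr
    obtain ⟨f, hfD, hfK⟩ := exists_mem_notMem_of_card_lt_card hK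
    obtain ⟨hfF, hfP⟩ := mem_agreeingEdges.1 hfD
    have havoid : ∀ j ∈ S.erase i, ∀ p q, f p ≠ e j q := by
      intro j hj p q hpq
      by_cases hp : p ∈ P
      · exact (mem_filter.1 (he j hj)).2 p hp q (hpq.symm.trans (hfP p hp))
      · exact hfK (mem_biUnion.2 ⟨(j, p), mem_product.2 ⟨hj, mem_compl.2 hp⟩,
          mem_filter.2 ⟨hfD, q, hpq⟩⟩)
    refine ⟨Function.update e i f, fun j hj => ?_, fun a ha b hb hab p q => ?_⟩
    · by_cases hji : j = i
      · subst hji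
        simpa using hfF
      · rw [Function.update_of_ne hji]
        exact (mem_filter.1 (he j (mem_erase.2 ⟨hji, hj⟩))).1
    · by_cases hai : a = i
      · subst hai
        rw [Function.update_self, Function.update_of_ne hab.symm]
        exact havoid b (mem_erase.2 ⟨hab.symm, hb⟩) p q
      · by_cases hbi : b = i
        · subst hbi
          rw [Function.update_self, Function.update_of_ne hab]
          exact (havoid a (mem_erase.2 ⟨hab, ha⟩) q p).symm
        · rw [Function.update_of_ne hai, Function.update_of_ne hbi]
          exact hdisj a (mem_erase.2 ⟨hai, ha⟩) b (mem_erase.2 ⟨hbi, hb⟩) hab p q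

end

/-- Theorem 1.2: rainbow matchings for `r`-partite `r`-graphs on disjoint `n`-sets
`U 1, …, U k`, when `n ≥ 3(k-1)(t-1)` and each `|F i| > (t-1) n^(r-1)`. -/
theorem rainbow_matching_r_partite
    {V : Type*} [DecidableEq V] (k r n t : ℕ)
    (hk : 0 < k) (hr : 2 ≤ r) (hrk : r ≤ k) (hn : 0 < n) (ht : 0 < t)
    (hbound : n ≥ 3 * (k - 1) * (t - 1))
    (U : Fin k → Finset V)
    (hUcard : ∀ i, (U i).card = n)
    (hUdisj : ∀ i j, i ≠ j → Disjoint (U i) (U j))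
    (idx : Fin t → Fin r → Fin k)
    (hidx : ∀ i, Function.Injective (idx i))
    (F : Fin t → Finset (Fin r → V))
    (hFmem : ∀ i, ∀ f ∈ F i, ∀ j, f j ∈ U (idx i j))
    (hFcard : ∀ i, (F i).card > (t - 1) * n ^ (r - 1)) :
    ∃ e : Fin t → (Fin r → V), (∀ i, e i ∈ F i) ∧
      ∀ i j, i ≠ j → ∀ p q, e i p ≠ e j q := by
  obtain ⟨v, -⟩ := Finset.card_pos.1 ((hUcard ⟨0, hk⟩).symm ▸ hn)
  have : Nonempty V := ⟨v⟩
  have hle : 3 * (r - 1) * (t - 1) ≤ n := by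
    refine le_trans ?_ hbound
    gcongr
  obtain ⟨e, he, hdisj⟩ := exists_rainbow_matching_on (by omega) hn hle U hUcard hUdisj idx hidx
    Finset.univ (by rw [Finset.card_fin]; omega) F (fun i _ => hFmem i)
    (fun i _ => by simpa using hFcard i)
  exact ⟨e, fun i => he i (Finset.mem_univ i),
    fun i j => hdisj i (Finset.mem_univ i) j (Finset.mem_univ j)⟩
end

section
/- Let k, t, n be integers with t ≥ 2, k_1 ≥ k_2 ≥ ... ≥ k_t ≥ 2, and n ≥ 9·k_1^5·t/k_2. For i in [t], let F_i ⊆ C([n], k_i) be families of k_i-subsets of [n] such that |F_1|·|F_2| > C(n-1, k_1-1)·C(n-1, k_2-1) when t = 2, and such that ∏_{i=1}^t |F_i| > C(n-1, k_1-1)·C(n-1, k_2-1)·∏_{i=3}^t C(n, k_i) when t ≥ 3. Then {F_1, ..., F_t} admits a rainbow matching. -/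
open Finset

section UniformFamilies

variable {α : Type*} [Fintype α] [DecidableEq α]

/-- A `k`-uniform family all of whose members contain `T` has at most
`C(n - |T|, k - |T|)` members. -/
lemma card_le_choose_of_forall_superset {k : ℕ} (F : Finset (Finset α)) (T : Finset α)
    (hF : ∀ e ∈ F, e.card = k) (hT : ∀ e ∈ F, T ⊆ e) :
    F.card ≤ (Fintype.card α - T.card).choose (k - T.card) := by
  have h : F.card ≤ (powersetCard (k - T.card) Tᶜ).card := by
    refine card_le_card_of_injOn (fun e => e \ T) ?_ ?_
    · intro e he
      rw [mem_coe] at he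
      rw [mem_coe, mem_powersetCard, card_sdiff_of_subset (hT e he), hF e he]
      refine ⟨fun x hx => ?_, rfl⟩
      rw [mem_compl]
      exact (mem_sdiff.1 hx).2
    · intro e he f hf hef
      rw [← sdiff_union_of_subset (hT e he), ← sdiff_union_of_subset (hT f hf)]
      exact congrArg (· ∪ T) hef
  rwa [card_powersetCard, card_compl] at h

/-- A `k`-uniform family all of whose members contain `T` and meet `R` (disjoint from `T`) has
at most `|R| * C(n - |T| - 1, k - |T| - 1)` members. -/
lemma card_le_mul_choose_of_forall_superset_of_inter {k : ℕ} (F : Finset (Finset α))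
    (T R : Finset α) (hTR : Disjoint T R) (hF : ∀ e ∈ F, e.card = k) (hT : ∀ e ∈ F, T ⊆ e)
    (hR : ∀ e ∈ F, ¬ Disjoint e R) :
    F.card ≤ R.card * (Fintype.card α - (T.card + 1)).choose (k - (T.card + 1)) := by
  have hsub : F ⊆ R.biUnion fun r => F.filter fun e => r ∈ e := by
    intro e he
    obtain ⟨r, hre, hrR⟩ := not_disjoint_iff.1 (hR e he)
    exact mem_biUnion.2 ⟨r, hrR, mem_filter.2 ⟨he, hre⟩⟩
  refine (card_le_card hsub).trans (card_biUnion_le_card_mul _ _ _ fun r hr => ?_)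
  have hrT : r ∉ T := disjoint_right.1 hTR hr
  rw [← card_insert_of_notMem hrT]
  refine card_le_choose_of_forall_superset _ _ (fun e he => hF e (mem_filter.1 he).1) ?_
  intro e he
  rw [mem_filter] at he
  exact insert_subset he.2 (hT e he.1)

/-- A `k`-uniform family all of whose members meet `R` has at most `|R| * C(n - 1, k - 1)`
members. -/
lemma card_le_mul_choose_of_forall_inter {k : ℕ} (F : Finset (Finset α)) (R : Finset α)
    (hF : ∀ e ∈ F, e.card = k) (hR : ∀ e ∈ F, ¬ Disjoint e R) :
    F.card ≤ R.card * (Fintype.card α - 1).choose (k - 1) := by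
  simpa using card_le_mul_choose_of_forall_superset_of_inter F ∅ R (disjoint_empty_left R) hF
    (fun e _ => empty_subset e) hR

/-- A `k`-uniform family all of whose members contain `x` and meet `R`, where `x ∉ R`, has at most
`|R| * C(n - 2, k - 2)` members. -/
lemma card_le_mul_choose_of_forall_mem_of_inter {k : ℕ} (F : Finset (Finset α)) (x : α)
    (R : Finset α) (hx : x ∉ R) (hF : ∀ e ∈ F, e.card = k) (hxF : ∀ e ∈ F, x ∈ e)
    (hR : ∀ e ∈ F, ¬ Disjoint e R) :
    F.card ≤ R.card * (Fintype.card α - 2).choose (k - 2) := by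
  simpa using card_le_mul_choose_of_forall_superset_of_inter F {x} R
    (disjoint_singleton_left.2 hx) hF (fun e he => singleton_subset_iff.2 (hxF e he)) hR

/-- If no point is common to all members of `B`, then a family `A` cross-intersecting with `B` has
at most `b ^ 2 * C(n - 2, a - 2)` members. -/
lemma card_le_sq_mul_choose_of_cross_intersecting {a b : ℕ} (A B : Finset (Finset α))
    (hA : ∀ e ∈ A, e.card = a) (hB : ∀ e ∈ B, e.card = b) (hBne : B.Nonempty)
    (hAB : ∀ e ∈ A, ∀ f ∈ B, ¬ Disjoint e f) (hstar : ∀ x, ∃ f ∈ B, x ∉ f) :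
    A.card ≤ b ^ 2 * (Fintype.card α - 2).choose (a - 2) := by
  obtain ⟨f₀, hf₀⟩ := hBne
  have hsub : A ⊆ f₀.biUnion fun r => A.filter fun e => r ∈ e := by
    intro e he
    obtain ⟨r, hre, hr⟩ := not_disjoint_iff.1 (hAB e he f₀ hf₀)
    exact mem_biUnion.2 ⟨r, hr, mem_filter.2 ⟨he, hre⟩⟩
  rw [sq, mul_assoc]
  nth_rewrite 1 [← hB f₀ hf₀]
  refine (card_le_card hsub).trans (card_biUnion_le_card_mul _ _ _ fun r _ => ?_)
  obtain ⟨f, hf, hrf⟩ := hstar r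
  rw [← hB f hf]
  exact card_le_mul_choose_of_forall_mem_of_inter _ r f hrf
    (fun e he => hA e (mem_filter.1 he).1) (fun e he => (mem_filter.1 he).2)
    (fun e he => hAB e (mem_filter.1 he).1 f hf)

/-- The Matsumoto–Tokushige bound for cross-intersecting families, for a large ground set. -/
lemma card_mul_card_le_of_cross_intersecting {a b : ℕ} (ha : 2 ≤ a) (hb : 2 ≤ b)
    (hn : a ^ 2 * b ^ 2 < Fintype.card α) (A B : Finset (Finset α))
    (hA : ∀ e ∈ A, e.card = a) (hB : ∀ e ∈ B, e.card = b)
    (hAB : ∀ e ∈ A, ∀ f ∈ B, ¬ Disjoint e f) :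
    A.card * B.card ≤
      (Fintype.card α - 1).choose (a - 1) * (Fintype.card α - 1).choose (b - 1) := by
  rcases A.eq_empty_or_nonempty with rfl | ⟨e₀, he₀⟩
  · simp
  rcases B.eq_empty_or_nonempty with rfl | ⟨f₀, hf₀⟩
  · simp
  obtain ⟨N, hN⟩ : ∃ N, Fintype.card α = N + 2 := ⟨Fintype.card α - 2, by
    have : 2 ^ 2 * 2 ^ 2 ≤ a ^ 2 * b ^ 2 := by gcongr
    omega⟩
  obtain ⟨p, rfl⟩ : ∃ p, a = p + 2 := ⟨a - 2, by omega⟩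
  obtain ⟨q, rfl⟩ : ∃ q, b = q + 2 := ⟨b - 2, by omega⟩
  have hA1 : A.card ≤ (q + 2) * (N + 1).choose (p + 1) := by
    have h := card_le_mul_choose_of_forall_inter A f₀ hA fun e he => hAB e he f₀ hf₀
    rwa [hB f₀ hf₀, hN] at h
  have hB1 : B.card ≤ (p + 2) * (N + 1).choose (q + 1) := by
    have h := card_le_mul_choose_of_forall_inter B e₀ hB fun f hf h => hAB e₀ he₀ f hf h.symm
    rwa [hA e₀ he₀, hN] at h
  have hp := Nat.add_one_mul_choose_eq N p
  have hq := Nat.add_one_mul_choose_eq N q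
  rw [hN] at hn
  simp only [hN, show N + 2 - 1 = N + 1 from rfl,
    show p + 2 - 1 = p + 1 from rfl, show q + 2 - 1 = q + 1 from rfl]
  by_cases hstar : ∃ x, ∀ f ∈ B, x ∈ f
  · obtain ⟨x, hx⟩ := hstar
    by_cases hxA : ∀ e ∈ A, x ∈ e
    · have h1 := card_le_choose_of_forall_superset A {x} hA
        fun e he => singleton_subset_iff.2 (hxA e he)
      have h2 := card_le_choose_of_forall_superset B {x} hB
        fun e he => singleton_subset_iff.2 (hx e he)
      rw [card_singleton, hN] at h1 h2
      exact Nat.mul_le_mul h1 h2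
    · push Not at hxA
      obtain ⟨e, he, hxe⟩ := hxA
      have hB2 := card_le_mul_choose_of_forall_mem_of_inter B x e hxe hB hx
        fun f hf h => hAB e he f hf h.symm
      rw [hA e he, hN, Nat.add_sub_cancel, Nat.add_sub_cancel] at hB2
      refine Nat.le_of_mul_le_mul_left ?_ (Nat.succ_pos N)
      calc (N + 1) * (A.card * B.card)
          ≤ (N + 1) * (((q + 2) * (N + 1).choose (p + 1)) * ((p + 2) * N.choose q)) := by gcongr
        _ = ((q + 2) * (p + 2) * (N + 1).choose (p + 1)) * ((N + 1) * N.choose q) := by ring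
        _ = ((q + 2) * (p + 2) * (q + 1)) *
              ((N + 1).choose (p + 1) * (N + 1).choose (q + 1)) := by rw [hq]; ring
        _ ≤ (N + 1) * ((N + 1).choose (p + 1) * (N + 1).choose (q + 1)) := by
            gcongr
            nlinarith [Nat.zero_le (p * q), Nat.zero_le (p ^ 2 * q ^ 2), Nat.zero_le (p * q ^ 2),
              Nat.zero_le (p ^ 2 * q), Nat.zero_le (p ^ 2), Nat.zero_le (q ^ 2)]
  · push Not at hstar
    have hA2 := card_le_sq_mul_choose_of_cross_intersecting A B hA hB ⟨f₀, hf₀⟩ hAB hstar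
    rw [hN, Nat.add_sub_cancel, Nat.add_sub_cancel] at hA2
    refine Nat.le_of_mul_le_mul_left ?_ (Nat.succ_pos N)
    calc (N + 1) * (A.card * B.card)
        ≤ (N + 1) * (((q + 2) ^ 2 * N.choose p) * ((p + 2) * (N + 1).choose (q + 1))) := by gcongr
      _ = ((q + 2) ^ 2 * (p + 2) * (N + 1).choose (q + 1)) * ((N + 1) * N.choose p) := by ring
      _ = ((q + 2) ^ 2 * (p + 2) * (p + 1)) *
            ((N + 1).choose (p + 1) * (N + 1).choose (q + 1)) := by rw [hp]; ring
      _ ≤ (N + 1) * ((N + 1).choose (p + 1) * (N + 1).choose (q + 1)) := by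
          gcongr
          nlinarith [Nat.zero_le ((q + 2) ^ 2 * (p + 2))]

/-- Greedy extension of a rainbow matching of the first two families, each later family `F m`
being too large to be covered by `m * K` points. -/
lemma exists_rainbow_matching_of_two {t : ℕ} (k : Fin t → ℕ) (K : ℕ) (hK : ∀ i, k i ≤ K)
    (F : Fin t → Finset (Finset α)) (hF : ∀ i, ∀ e ∈ F i, e.card = k i)
    (hlarge : ∀ i : Fin t, 2 ≤ i.val →
      i.val * K * (Fintype.card α - 1).choose (k i - 1) < (F i).card)
    (i₀ i₁ : Fin t) (hi₀ : i₀.val = 0) (hi₁ : i₁.val = 1)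
    (hpair : ∃ e ∈ F i₀, ∃ f ∈ F i₁, Disjoint e f) :
    ∃ e : Fin t → Finset α, (∀ i, e i ∈ F i) ∧ ∀ i j, i ≠ j → Disjoint (e i) (e j) := by
  suffices h : ∀ m, 2 ≤ m → m ≤ t → ∃ e : Fin t → Finset α, (∀ i, i.val < m → e i ∈ F i) ∧
      ∀ i j, i.val < m → j.val < m → i ≠ j → Disjoint (e i) (e j) by
    obtain ⟨e, he, hd⟩ := h t (by omega) le_rfl
    exact ⟨e, fun i => he i i.2, fun i j => hd i j i.2 j.2⟩
  intro m hm
  induction m, hm using Nat.le_induction with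
  | base =>
    intro _
    obtain ⟨e, he, f, hf, hef⟩ := hpair
    have hcases : ∀ i : Fin t, i.val < 2 → i = i₀ ∨ i = i₁ := by
      intro i hi
      simp only [Fin.ext_iff]
      omega
    have hne : i₁ ≠ i₀ := by
      intro h
      rw [h] at hi₁
      omega
    refine ⟨fun i => if i = i₀ then e else f, fun i hi => ?_, fun i j hi hj hij => ?_⟩
    · rcases hcases i hi with rfl | rfl <;> simp [he, hf, hne]
    · rcases hcases i hi with rfl | rfl <;> rcases hcases j hj with rfl | rfl
      · exact absurd rfl hij
      · simpa [hne] using hef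
      · simpa [hne] using hef.symm
      · exact absurd rfl hij
  | succ m hm ih =>
    intro hmt
    obtain ⟨e, he, hd⟩ := ih (by omega)
    let l : Fin t := ⟨m, hmt⟩
    let S : Finset α := (univ.filter fun i : Fin t => i.val < m).biUnion e
    have hS : S.card ≤ m * K := by
      have hc : (univ.filter fun i : Fin t => i.val < m).card ≤ m := by
        rw [← card_range m]
        exact card_le_card_of_injOn Fin.val (by intro i; simp) (Fin.val_injective.injOn)
      refine (card_biUnion_le_card_mul _ _ K fun i hi => ?_).trans (Nat.mul_le_mul_right K hc)
      rw [hF i _ (he i (mem_filter.1 hi).2)]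
      exact hK i
    obtain ⟨f, hf, hfS⟩ : ∃ f ∈ F l, Disjoint f S := by
      by_contra! hcon
      have h := card_le_mul_choose_of_forall_inter (F l) S (hF l) hcon
      exact absurd (h.trans (Nat.mul_le_mul_right _ hS)) (not_le.2 (hlarge l hm))
    have hfe : ∀ i : Fin t, i.val < m → Disjoint f (e i) := fun i hi =>
      hfS.mono_right (subset_biUnion_of_mem e (mem_filter.2 ⟨mem_univ i, hi⟩))
    have hcases : ∀ i : Fin t, i.val < m + 1 → i = l ∨ i ≠ l ∧ i.val < m := by
      intro i hi
      simp only [ne_eq, Fin.ext_iff, l]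
      omega
    refine ⟨fun i => if i = l then f else e i, fun i hi => ?_, fun i j hi hj hij => ?_⟩
    · rcases hcases i hi with rfl | ⟨h, h'⟩
      · simpa using hf
      · simpa [h] using he i h'
    · rcases hcases i hi with rfl | ⟨h, h'⟩ <;> rcases hcases j hj with rfl | ⟨g, g'⟩
      · exact absurd rfl hij
      · simpa [g] using hfe j g'
      · simpa [h] using (hfe i h').symm
      · simpa [h, g] using hd i j h' g' hij

end UniformFamilies

lemma sq_le_four_mul_four_pow (m : ℕ) (hm : 2 ≤ m) : m ^ 2 ≤ 4 * 4 ^ (m - 2) := by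
  induction m, hm using Nat.le_induction with
  | base => norm_num
  | succ m hm ih =>
    rw [show m + 1 - 2 = (m - 2) + 1 by omega, pow_succ 4]
    nlinarith

lemma pow_succ_le_of_large {K L n : ℝ} {t m : ℕ} (hL : 2 ≤ L) (hLK : L ≤ K) (hm : 2 ≤ m)
    (hmt : m ≤ t) (hn : 9 * K ^ 5 * t / L ≤ n) :
    (m * K ^ 2 / n) ^ (m + 1) ≤ K * L / n ^ 2 := by
  have hL0 : 0 < L := by linarith
  have hK0 : 0 < K := by linarith
  have hmR : (2 : ℝ) ≤ m := by exact_mod_cast hm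
  have hmtR : (m : ℝ) ≤ t := by exact_mod_cast hmt
  have ht0 : (0 : ℝ) < t := by linarith
  have hn0 : 0 < n := lt_of_lt_of_le (by positivity) hn
  have hn' : 9 * K ^ 5 * m ≤ n * L := by
    rw [div_le_iff₀ hL0] at hn
    exact le_trans (by gcongr) hn
  set y : ℝ := m * K ^ 2 / n with hy
  have hy0 : 0 ≤ y := by positivity
  have hyK : 9 * K ^ 3 * y ≤ L := by
    rw [hy, ← mul_div_assoc, div_le_iff₀ hn0]
    linarith
  have hy4 : y ≤ 1 / 4 := by
    have h : K * 4 ≤ K ^ 3 := by nlinarith [mul_pos hK0 hK0]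
    have h4 : K * 4 * y ≤ K ^ 3 * y := by gcongr
    have h5 : K * (36 * y) ≤ K * 1 := by linarith
    have h6 := le_of_mul_le_mul_left h5 hK0
    linarith
  have hmy : (m : ℝ) ^ 2 * y ^ (m - 2) ≤ 4 := by
    have h1 : (m : ℝ) ^ 2 ≤ 4 * 4 ^ (m - 2) := by exact_mod_cast sq_le_four_mul_four_pow m hm
    calc (m : ℝ) ^ 2 * y ^ (m - 2) ≤ (4 * 4 ^ (m - 2)) * (1 / 4) ^ (m - 2) := by gcongr
      _ = 4 := by rw [mul_assoc, ← mul_pow]; norm_num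
  have hsplit : y ^ (m + 1) = y ^ 2 * y * y ^ (m - 2) := by
    rw [← pow_succ, ← pow_add]
    congr 1
    omega
  calc y ^ (m + 1) = (K / n ^ 2) * (K ^ 3 * y) * ((m : ℝ) ^ 2 * y ^ (m - 2)) := by
        rw [hsplit]
        nth_rewrite 1 [hy]
        field_simp
    _ ≤ (K / n ^ 2) * (L / 9) * 4 := by gcongr; linarith
    _ ≤ K * L / n ^ 2 := by
        have : 0 < K * L / n ^ 2 := by positivity
        calc (K / n ^ 2) * (L / 9) * 4 = (4 / 9) * (K * L / n ^ 2) := by ring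
          _ ≤ K * L / n ^ 2 := by linarith

/-- In a monotone sequence in `[0, 1]`, the full product is at most a power of any term. -/
lemma prod_le_pow_succ_of_monotone {t : ℕ} (g : Fin t → ℝ) (hg : Monotone g) (h0 : ∀ i, 0 ≤ g i)
    (h1 : ∀ i, g i ≤ 1) (m : Fin t) : ∏ i, g i ≤ g m ^ (m.val + 1) := by
  calc ∏ i, g i ≤ ∏ i ∈ Iic m, g i :=
        prod_le_prod_of_subset_of_le_one (subset_univ _) (fun i _ => h0 i) fun i _ _ => h1 i
    _ ≤ ∏ _i ∈ Iic m, g m :=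
        prod_le_prod (fun i _ => h0 i) fun i hi => hg (mem_Iic.1 hi)
    _ = g m ^ (m.val + 1) := by rw [prod_const, Fin.card_Iic]

lemma prod_le_mul_of_ne {ι : Type*} [Fintype ι] [DecidableEq ι] (g : ι → ℝ) (h0 : ∀ i, 0 ≤ g i)
    (h1 : ∀ i, g i ≤ 1) {i j : ι} (hij : i ≠ j) : ∏ i, g i ≤ g i * g j := by
  rw [← prod_pair hij]
  exact prod_le_prod_of_subset_of_le_one (subset_univ _) (fun i _ => h0 i) fun i _ _ => h1 i

lemma cast_choose_pred_eq {n k : ℕ} (hn : 1 ≤ n) (hk : 1 ≤ k) :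
    ((n - 1).choose (k - 1) : ℝ) = (k / n : ℝ) * n.choose k := by
  obtain ⟨N, rfl⟩ : ∃ N, n = N + 1 := ⟨n - 1, by omega⟩
  obtain ⟨q, rfl⟩ : ∃ q, k = q + 1 := ⟨k - 1, by omega⟩
  have h := Nat.add_one_mul_choose_eq N q
  have hR : ((N + 1 : ℕ) : ℝ) * N.choose q = (N + 1).choose (q + 1) * ((q + 1 : ℕ) : ℝ) := by
    exact_mod_cast h
  have hN : ((N + 1 : ℕ) : ℝ) ≠ 0 := by positivity
  rw [Nat.add_sub_cancel, Nat.add_sub_cancel, div_mul_eq_mul_div, eq_div_iff hN]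
  linarith

/-- If `k` is antitone, the product of two of its values is at most that of the first two. -/
lemma mul_le_mul_first_two {t : ℕ} (k : Fin t → ℕ) (hmono : ∀ i j : Fin t, i ≤ j → k j ≤ k i)
    {a b : Fin t} (ha : a.val = 0) (hb : b.val = 1) {i j : Fin t} (hij : i ≠ j) :
    k i * k j ≤ k a * k b := by
  have hij' : i.val ≠ j.val := fun h => hij (Fin.ext h)
  have ha_le : ∀ l : Fin t, k l ≤ k a := fun l => hmono _ _ (Fin.le_def.2 (by omega))
  rcases Nat.lt_or_ge i.val 1 with h | h
  · exact Nat.mul_le_mul (ha_le i) (hmono _ _ (Fin.le_def.2 (by omega)))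
  · rw [mul_comm]
    exact Nat.mul_le_mul (ha_le j) (hmono _ _ (Fin.le_def.2 (by omega)))

/-- Lemma 3.2: product-type condition for rainbow matchings when `n ≥ 9 k₁⁵ t / k₂`. -/
theorem rainbow_matching_product_small_t
    (n t : ℕ) (ht : 2 ≤ t) (k : Fin t → ℕ)
    (hmono : ∀ i j : Fin t, i ≤ j → k j ≤ k i)
    (hk2 : ∀ i, 2 ≤ k i)
    (hn : (n : ℝ) ≥ 9 * (k ⟨0, by omega⟩ : ℝ) ^ 5 * t / (k ⟨1, by omega⟩ : ℝ))
    (F : Fin t → Finset (Finset (Fin n)))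
    (hFuniform : ∀ i, ∀ e ∈ F i, e.card = k i)
    (hprod2 : t = 2 →
      (F ⟨0, by omega⟩).card * (F ⟨1, by omega⟩).card >
        (n - 1).choose (k ⟨0, by omega⟩ - 1) * (n - 1).choose (k ⟨1, by omega⟩ - 1))
    (hprod3 : 3 ≤ t →
      ∏ i : Fin t, (F i).card >
        (n - 1).choose (k ⟨0, by omega⟩ - 1) * (n - 1).choose (k ⟨1, by omega⟩ - 1) *
          ∏ i ∈ Finset.univ.filter (fun i : Fin t => 2 ≤ i.val), n.choose (k i)) :
    ∃ e : Fin t → Finset (Fin n), (∀ i, e i ∈ F i) ∧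
      ∀ i j, i ≠ j → Disjoint (e i) (e j) := by
  set a : Fin t := ⟨0, by omega⟩ with ha
  set b : Fin t := ⟨1, by omega⟩ with hb
  have hab : a ≠ b := by simp [ha, hb]
  have hka : ∀ i, k i ≤ k a := fun i => hmono _ _ (Fin.mk_le_of_le_val (Nat.zero_le _))
  have hLR : (2 : ℝ) ≤ k b := by exact_mod_cast hk2 b
  have hLK : (k b : ℝ) ≤ k a := by exact_mod_cast hka b
  have htR : (2 : ℝ) ≤ t := by exact_mod_cast ht
  have hn4 : k a ^ 4 < n := by
    have h : (k a : ℝ) ^ 4 < n := by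
      refine lt_of_lt_of_le ?_ hn
      rw [lt_div_iff₀ (by linarith)]
      have h4 : (k a : ℝ) ^ 4 * k b ≤ (k a : ℝ) ^ 4 * k a := by gcongr
      have h5 : 0 < (k a : ℝ) ^ 5 := pow_pos (by linarith) 5
      nlinarith
    exact_mod_cast h
  have hkn : ∀ i, k i ≤ n := fun i =>
    (hka i).trans ((Nat.le_self_pow (by norm_num) _).trans hn4.le)
  have hn1 : 1 ≤ n := by omega
  have hnR : (0 : ℝ) < n := by exact_mod_cast hn1
  have hC : ∀ i, (0 : ℝ) < n.choose (k i) := fun i => by exact_mod_cast Nat.choose_pos (hkn i)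
  let d : Fin t → ℝ := fun i => (F i).card / n.choose (k i)
  have hFd : ∀ i, ((F i).card : ℝ) = d i * n.choose (k i) := fun i =>
    (div_mul_cancel₀ _ (hC i).ne').symm
  have hd0 : ∀ i, 0 ≤ d i := fun i => by positivity
  have hd1 : ∀ i, d i ≤ 1 := fun i => by
    have h := card_le_choose_of_forall_superset (F i) ∅ (hFuniform i) fun e _ => empty_subset e
    rw [card_empty, Fintype.card_fin, Nat.sub_zero, Nat.sub_zero] at h
    rw [div_le_one (hC i)]
    exact_mod_cast h
  have hsplit : ∀ f : Fin t → ℕ,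
      ∏ i, f i = f a * f b * ∏ i ∈ univ.filter (fun i : Fin t => 2 ≤ i.val), f i := by
    intro f
    have hcompl : univ.filter (fun i : Fin t => ¬ 2 ≤ i.val) = {a, b} := by
      ext i
      simp only [mem_filter, mem_univ, true_and, mem_insert, mem_singleton, ha, hb, Fin.ext_iff]
      omega
    rw [← prod_filter_mul_prod_filter_not univ (fun i : Fin t => 2 ≤ i.val), hcompl,
      prod_pair hab, mul_comm]
  have hprod : (n - 1).choose (k a - 1) * (n - 1).choose (k b - 1) *
      ∏ i ∈ univ.filter (fun i : Fin t => 2 ≤ i.val), n.choose (k i) < ∏ i, (F i).card := by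
    rcases Nat.lt_or_ge t 3 with h | h
    · have hempty : univ.filter (fun i : Fin t => 2 ≤ i.val) = ∅ :=
        filter_eq_empty_iff.2 fun i _ => by omega
      rw [hsplit fun i => (F i).card, hempty, prod_empty, prod_empty, mul_one, mul_one]
      exact hprod2 (by omega)
    · exact hprod3 h
  have hdprod : (k a * k b / n ^ 2 : ℝ) < ∏ i, d i := by
    have hCprod : (0 : ℝ) < ∏ i, (n.choose (k i) : ℝ) := prod_pos fun i _ => hC i
    have hsC := congrArg (Nat.cast : ℕ → ℝ) (hsplit fun i => n.choose (k i))
    have hR := (Nat.cast_lt (α := ℝ)).2 hprod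
    push_cast at hR hsC
    rw [cast_choose_pred_eq hn1 (by have := hk2 a; omega),
      cast_choose_pred_eq hn1 (by have := hk2 b; omega)] at hR
    rw [prod_div_distrib, lt_div_iff₀ hCprod, hsC]
    refine lt_of_eq_of_lt ?_ hR
    field_simp
  have hpair : ∀ i j, i ≠ j → ∃ e ∈ F i, ∃ f ∈ F j, Disjoint e f := by
    intro i j hij
    by_contra! hcon
    have hbig : k i ^ 2 * k j ^ 2 < Fintype.card (Fin n) := by
      rw [Fintype.card_fin]
      refine lt_of_le_of_lt ?_ hn4
      rw [show k a ^ 4 = k a ^ 2 * k a ^ 2 by ring]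
      have := hka i
      have := hka j
      gcongr
    have h := card_mul_card_le_of_cross_intersecting (hk2 i) (hk2 j) hbig (F i) (F j)
      (hFuniform i) (hFuniform j) hcon
    rw [Fintype.card_fin] at h
    have hR := (Nat.cast_le (α := ℝ)).2 h
    push_cast at hR
    rw [cast_choose_pred_eq hn1 (by have := hk2 i; omega),
      cast_choose_pred_eq hn1 (by have := hk2 j; omega), hFd i, hFd j] at hR
    have hle : d i * d j ≤ k i * k j / n ^ 2 := by
      refine le_of_mul_le_mul_right ?_ (mul_pos (hC i) (hC j))
      calc d i * d j * (n.choose (k i) * n.choose (k j))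
          = d i * n.choose (k i) * (d j * n.choose (k j)) := by ring
        _ ≤ _ := hR
        _ = _ := by field_simp
    have hkk : (k i * k j : ℝ) ≤ k a * k b := by
      exact_mod_cast mul_le_mul_first_two k hmono (a := a) (b := b) rfl rfl hij
    have hkk' : (k i * k j / n ^ 2 : ℝ) ≤ k a * k b / n ^ 2 := by gcongr
    exact absurd (hdprod.trans_le (prod_le_mul_of_ne d hd0 hd1 hij)) (not_lt.2 (hle.trans hkk'))
  let σ := Tuple.sort d
  have hlarge : ∀ m : Fin t, 2 ≤ m.val →
      m.val * k a * (Fintype.card (Fin n) - 1).choose (k (σ m) - 1) < (F (σ m)).card := by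
    intro m hm
    have hpow := prod_le_pow_succ_of_monotone (d ∘ σ) (Tuple.monotone_sort d)
      (fun i => hd0 _) (fun i => hd1 _) m
    have hperm : ∏ i, (d ∘ σ) i = ∏ i, d i := Equiv.prod_comp σ d
    rw [hperm] at hpow
    have hnum := pow_succ_le_of_large hLR hLK hm m.2.le hn
    have hlt : (m.val * k a ^ 2 / n : ℝ) < d (σ m) :=
      lt_of_pow_lt_pow_left₀ _ (hd0 _) (hnum.trans_lt (hdprod.trans_le hpow))
    have hkm : (k (σ m) : ℝ) ≤ k a := by exact_mod_cast hka (σ m)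
    have hgoal : (m.val * k a * (n - 1).choose (k (σ m) - 1) : ℝ) < (F (σ m)).card := by
      rw [cast_choose_pred_eq hn1 (by have := hk2 (σ m); omega), hFd]
      calc (m.val * k a * (k (σ m) / n * n.choose (k (σ m))) : ℝ)
          ≤ m.val * k a * (k a / n * n.choose (k (σ m))) := by gcongr
        _ = (m.val * k a ^ 2 / n) * n.choose (k (σ m)) := by ring
        _ < d (σ m) * n.choose (k (σ m)) := mul_lt_mul_of_pos_right hlt (hC _)
    rw [Fintype.card_fin]
    exact_mod_cast hgoal
  obtain ⟨e, he, hdisj⟩ := exists_rainbow_matching_of_two (fun i => k (σ i)) (k a)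
    (fun i => hka _) (fun i => F (σ i)) (fun i => hFuniform _) hlarge a b rfl rfl
    (hpair _ _ (σ.injective.ne hab))
  refine ⟨fun i => e (σ.symm i), fun i => ?_, fun i j hij => hdisj _ _ (σ.symm.injective.ne hij)⟩
  have h := he (σ.symm i)
  rwa [σ.apply_symm_apply] at h
end

section
/- Let n, t, k_1, ..., k_t be positive integers with n sufficiently large, Σ_{i=1}^t k_i ≤ n·(1 - (8k·ln n/n)^{1/k}) where k = max_i k_i, and k_1, k_2 ≥ k_i for all i ≥ 3. Let F_i ⊆ C([n], k_i) for each i in [t]. If |F_1|·|F_2| > C(n-1, k_1-1)·C(n-1, k_2-1) when t = 2, or ∏_{i=1}^t |F_i| > C(n-1, k_1-1)·C(n-1, k_2-1)·∏_{i=3}^t C(n, k_i) when t ≥ 3, then {F_1, ..., F_t} admits a rainbow matching. -/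
open Finset Real

section Density

open scoped BigOperators

variable {α : Type*} [DecidableEq α]

/-- The proportion of the `k`-subsets of `Y` that belong to `F`. -/
noncomputable def density (k : ℕ) (F : Finset (Finset α)) (Y : Finset α) : ℝ :=
  𝔼 e ∈ Y.powersetCard k, if e ∈ F then (1 : ℝ) else 0

theorem density_nonneg (k : ℕ) (F : Finset (Finset α)) (Y : Finset α) : 0 ≤ density k F Y :=
  expect_nonneg fun e _ => by split_ifs <;> norm_num

theorem density_le_one (k : ℕ) (F : Finset (Finset α)) (Y : Finset α) : density k F Y ≤ 1 := by
  rcases (Y.powersetCard k).eq_empty_or_nonempty with h | h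
  · simp [density, h]
  · exact expect_le h fun e _ => by split_ifs <;> norm_num

theorem exists_mem_of_density_pos {k : ℕ} {F : Finset (Finset α)} {Y : Finset α}
    (h : 0 < density k F Y) : ∃ e ∈ F, e ⊆ Y ∧ #e = k := by
  obtain ⟨e, he, hne⟩ := exists_ne_zero_of_expect_ne_zero h.ne'
  refine ⟨e, by by_contra hF; simp [hF] at hne, mem_powersetCard.1 he⟩

theorem choose_mul_density (k : ℕ) (F : Finset (Finset α)) (Y : Finset α) :
    ((#Y).choose k : ℝ) * density k F Y = ∑ e ∈ Y.powersetCard k, if e ∈ F then (1 : ℝ) else 0 := by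
  rw [density, ← card_powersetCard, card_mul_expect]

theorem choose_mul_density_eq_card (k : ℕ) (F : Finset (Finset α)) (Y : Finset α) :
    ((#Y).choose k : ℝ) * density k F Y = #{e ∈ Y.powersetCard k | e ∈ F} := by
  rw [choose_mul_density, sum_boole]

/-- Averaging over a random `b`-subset of a random `c`-subset of `Y` is the same as averaging over
a random `b`-subset of `Y`. -/
theorem expect_powersetCard_expect_powersetCard (Y : Finset α) {b c : ℕ} (hbc : b ≤ c)
    (hc : c ≤ #Y) (φ : Finset α → ℝ) :
    𝔼 C ∈ Y.powersetCard c, 𝔼 B ∈ C.powersetCard b, φ B = 𝔼 B ∈ Y.powersetCard b, φ B := by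
  have hswap : ∑ C ∈ Y.powersetCard c, ∑ B ∈ C.powersetCard b, φ B =
      ∑ B ∈ Y.powersetCard b, ∑ C ∈ Y.powersetCard c with B ⊆ C, φ B := by
    refine sum_comm' fun C B => ?_
    simp only [mem_powersetCard, mem_filter]
    constructor
    · rintro ⟨⟨h1, h2⟩, h3, h4⟩
      exact ⟨⟨⟨h1, h2⟩, h3⟩, h3.trans h1, h4⟩
    · rintro ⟨⟨⟨h1, h2⟩, h3⟩, -, h4⟩
      exact ⟨⟨h1, h2⟩, h3, h4⟩
  have hcount : ∀ B ∈ Y.powersetCard b, ∑ C ∈ Y.powersetCard c with B ⊆ C, φ B =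
      ((#Y - b).choose (c - b) : ℝ) * φ B := by
    intro B hB
    rw [mem_powersetCard] at hB
    rw [sum_const, card_filter_powersetCard_subset B Y c hB.1 (hB.2.trans_le hbc), hB.2,
      nsmul_eq_mul]
  have hinner : ∀ C ∈ Y.powersetCard c, 𝔼 B ∈ C.powersetCard b, φ B =
      (∑ B ∈ C.powersetCard b, φ B) / c.choose b := by
    intro C hC
    rw [expect_eq_sum_div_card, card_powersetCard, (mem_powersetCard.1 hC).2]
  rw [expect_congr rfl hinner, expect_eq_sum_div_card, expect_eq_sum_div_card, ← sum_div, hswap,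
    sum_congr rfl hcount, ← mul_sum, card_powersetCard, card_powersetCard]
  have h1 : (0 : ℝ) < (#Y).choose c := by exact_mod_cast Nat.choose_pos hc
  have h2 : (0 : ℝ) < c.choose b := by exact_mod_cast Nat.choose_pos hbc
  have h3 : (0 : ℝ) < (#Y).choose b := by exact_mod_cast Nat.choose_pos (hbc.trans hc)
  have h4 : ((#Y).choose c : ℝ) * c.choose b = (#Y).choose b * (#Y - b).choose (c - b) := by
    exact_mod_cast Nat.choose_mul hbc
  rw [div_div, div_eq_div_iff (by positivity) (by positivity), mul_comm (c.choose b : ℝ), h4]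
  ring

theorem expect_sdiff_powersetCard (Y : Finset α) {s : ℕ} (hs : s ≤ #Y) (φ : Finset α → ℝ) :
    𝔼 e ∈ Y.powersetCard s, φ (Y \ e) = 𝔼 B ∈ Y.powersetCard (#Y - s), φ B := by
  refine expect_nbij' (Y \ ·) (Y \ ·) ?_ ?_ ?_ ?_ ?_
  · intro e he
    rw [mem_powersetCard] at he ⊢
    exact ⟨sdiff_subset, by rw [card_sdiff_of_subset he.1, he.2]⟩
  · intro e he
    rw [mem_powersetCard] at he ⊢
    exact ⟨sdiff_subset, by rw [card_sdiff_of_subset he.1, he.2]; omega⟩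
  · intro e he
    exact Finset.sdiff_sdiff_eq_self (mem_powersetCard.1 he).1
  · intro e he
    exact Finset.sdiff_sdiff_eq_self (mem_powersetCard.1 he).1
  · intro e _; rfl

theorem expect_density (Y : Finset α) {k b : ℕ} (F : Finset (Finset α)) (hkb : k ≤ b)
    (hb : b ≤ #Y) : 𝔼 B ∈ Y.powersetCard b, density k F B = density k F Y :=
  expect_powersetCard_expect_powersetCard Y hkb hb _

theorem choose_mul_density_erase (Y : Finset α) {v : α} (hv : v ∈ Y) (k : ℕ)
    (F : Finset (Finset α)) :
    ((#Y - 1).choose k : ℝ) * density k F (Y.erase v) =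
      ∑ e ∈ Y.powersetCard k, if v ∈ e then 0 else if e ∈ F then (1 : ℝ) else 0 := by
  rw [← card_erase_of_mem hv, choose_mul_density]
  have : (Y.erase v).powersetCard k = {e ∈ Y.powersetCard k | ¬ v ∈ e} := by
    ext e
    simp only [mem_powersetCard, mem_filter, subset_erase]
    tauto
  rw [this, sum_filter]
  refine sum_congr rfl fun e _ => ?_
  split_ifs <;> simp_all

theorem sum_powersetCard_sum_mem (Y : Finset α) (k : ℕ) (a : α → ℝ) (c : Finset α → ℝ) :
    ∑ e ∈ Y.powersetCard k, c e * ∑ v ∈ e, a v =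
      ∑ v ∈ Y, a v * ∑ e ∈ Y.powersetCard k, if v ∈ e then c e else 0 := by
  simp_rw [mul_sum]
  rw [sum_comm]
  refine sum_congr rfl fun e he => ?_
  rw [← sum_subset (mem_powersetCard.1 he).1]
  · refine sum_congr rfl fun v hv => ?_
    rw [if_pos hv, mul_comm]
  · intro v _ hv
    rw [if_neg hv, mul_zero]

theorem card_filter_mem_powersetCard (Y : Finset α) {k : ℕ} (hk : 1 ≤ k) {v : α} (hv : v ∈ Y) :
    #{e ∈ Y.powersetCard k | v ∈ e} = (#Y - 1).choose (k - 1) := by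
  have := card_filter_powersetCard_subset {v} Y k (by simpa using hv) (by simpa using hk)
  simpa using this

/-- The quadratic form `∑ₑ (∑_{v ∈ e} a v)²` for a vector `a` with zero sum. -/
theorem sum_powersetCard_sq_sum (Y : Finset α) {k : ℕ} (hk : 1 ≤ k) (hY : 2 ≤ #Y) (a : α → ℝ)
    (ha : ∑ v ∈ Y, a v = 0) :
    ∑ e ∈ Y.powersetCard k, (∑ v ∈ e, a v) ^ 2 =
      ((#Y - 2).choose (k - 1) : ℝ) * ∑ v ∈ Y, a v ^ 2 := by
  set c : ℝ := (((#Y - 1).choose (k - 1) : ℕ) : ℝ) with hc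
  set c' : ℝ := (((#Y - 2).choose (k - 1) : ℕ) : ℝ) with hc'
  have hpair : ∀ v ∈ Y, ∀ w ∈ Y,
      (∑ e ∈ Y.powersetCard k, if v ∈ e then if w ∈ e then (1 : ℝ) else 0 else 0) =
        if v = w then c else c - c' := by
    intro v hv w hw
    simp_rw [← ite_and]
    rw [sum_boole]
    split_ifs with hvw
    · subst hvw
      simp [hc, card_filter_mem_powersetCard Y hk hv]
    · rcases hk.eq_or_lt with rfl | hk2
      · simp only [hc, hc', Nat.sub_self, Nat.choose_zero_right, Nat.cast_one, sub_self,
          Nat.cast_eq_zero, card_eq_zero, filter_eq_empty_iff, mem_powersetCard, card_eq_one]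
        rintro e ⟨-, x, rfl⟩
        simp only [mem_singleton, not_and]
        rintro rfl rfl
        exact hvw rfl
      · have h2 : #({v, w} : Finset α) = 2 := card_pair hvw
        have := card_filter_powersetCard_subset {v, w} Y k
          (by simp [insert_subset_iff, hv, hw]) (by omega)
        rw [h2] at this
        simp only [insert_subset_iff, singleton_subset_iff] at this
        rw [this, hc, hc']
        obtain ⟨m, hm⟩ := Nat.exists_eq_add_of_le hY
        obtain ⟨j, hj⟩ := Nat.exists_eq_add_of_le (show 2 ≤ k from hk2)
        rw [hm, hj, show 2 + m - 2 = m by omega, show 2 + m - 1 = m + 1 by omega,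
          show 2 + j - 2 = j by omega, show 2 + j - 1 = j + 1 by omega, Nat.choose_succ_succ]
        push_cast
        ring
  have h1 : ∑ e ∈ Y.powersetCard k, (∑ v ∈ e, a v) ^ 2 =
      ∑ v ∈ Y, a v * ∑ w ∈ Y, a w * if v = w then c else c - c' := by
    simp_rw [sq]
    rw [sum_powersetCard_sum_mem]
    refine sum_congr rfl fun v hv => ?_
    have : ∀ e : Finset α, (if v ∈ e then ∑ w ∈ e, a w else 0) =
        (if v ∈ e then (1 : ℝ) else 0) * ∑ w ∈ e, a w := fun e => by split_ifs <;> simp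
    simp_rw [this]
    rw [sum_powersetCard_sum_mem]
    congr 1
    refine sum_congr rfl fun w hw => ?_
    rw [← hpair v hv w hw]
    congr 1
    refine sum_congr rfl fun e _ => ?_
    split_ifs <;> rfl
  have h2 : ∀ v ∈ Y, ∑ w ∈ Y, a w * (if v = w then c else c - c') = c' * a v := by
    intro v hv
    have : ∀ w, a w * (if v = w then c else c - c') =
        (c - c') * a w + if v = w then c' * a w else 0 := fun w => by split_ifs <;> ring
    simp_rw [this]
    rw [sum_add_distrib, ← mul_sum, ha, sum_ite_eq, if_pos hv]
    ring
  rw [h1, mul_sum]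
  refine sum_congr rfl fun v hv => ?_
  rw [h2 v hv]
  ring

theorem sum_sub_density (Y : Finset α) (k : ℕ) (F : Finset (Finset α)) :
    ∑ e ∈ Y.powersetCard k, ((if e ∈ F then (1 : ℝ) else 0) - density k F Y) = 0 := by
  rw [sum_sub_distrib, ← choose_mul_density, sum_const, card_powersetCard, nsmul_eq_mul, sub_self]

theorem sum_sub_density_sq (Y : Finset α) (k : ℕ) (F : Finset (Finset α)) :
    ∑ e ∈ Y.powersetCard k, ((if e ∈ F then (1 : ℝ) else 0) - density k F Y) ^ 2 =
      (#Y).choose k * (density k F Y * (1 - density k F Y)) := by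
  set f := density k F Y with hf
  have h : ∀ e, ((if e ∈ F then (1 : ℝ) else 0) - f) ^ 2 =
      (1 - 2 * f) * ((if e ∈ F then (1 : ℝ) else 0) - f) + f * (1 - f) := by
    intro e; split_ifs <;> ring
  simp_rw [h]
  rw [sum_add_distrib, ← mul_sum, sum_sub_density, sum_const, card_powersetCard, nsmul_eq_mul]
  ring

theorem sum_density_erase (Y : Finset α) {k : ℕ} (hkY : k + 1 ≤ #Y) (F : Finset (Finset α)) :
    ∑ v ∈ Y, density k F (Y.erase v) = #Y * density k F Y := by
  have hpos : (0 : ℝ) < (#Y - 1).choose k := by exact_mod_cast Nat.choose_pos (by omega)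
  have hch : ((#Y).choose k : ℝ) * (#Y - k) = #Y * (#Y - 1).choose k := by
    obtain ⟨m, hm⟩ := Nat.exists_eq_add_of_le' (show 1 ≤ #Y by omega)
    have := Nat.choose_mul_succ_eq m k
    rw [← hm] at this
    have h2 : ((#Y - k : ℕ) : ℝ) = #Y - k := by push_cast [show k ≤ #Y by omega]; rfl
    rw [← h2, show #Y - 1 = m by omega, mul_comm (#Y : ℝ)]
    exact_mod_cast this.symm
  refine mul_left_cancel₀ hpos.ne' ?_
  rw [mul_sum, sum_congr rfl fun v hv => choose_mul_density_erase Y hv k F]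
  have h2 : ∀ v ∈ Y, (∑ e ∈ Y.powersetCard k, if v ∈ e then 0 else if e ∈ F then (1 : ℝ) else 0) =
      (#Y).choose k * density k F Y -
        1 * ∑ e ∈ Y.powersetCard k, if v ∈ e then if e ∈ F then (1 : ℝ) else 0 else 0 := by
    intro v _
    rw [choose_mul_density, one_mul, ← sum_sub_distrib]
    refine sum_congr rfl fun e _ => ?_
    split_ifs <;> simp
  rw [sum_congr rfl h2, sum_sub_distrib, ← sum_powersetCard_sum_mem, sum_const, nsmul_eq_mul]
  have h3 : ∑ e ∈ Y.powersetCard k, ((if e ∈ F then (1 : ℝ) else 0) * ∑ v ∈ e, (1 : ℝ)) =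
      k * ((#Y).choose k * density k F Y) := by
    rw [choose_mul_density, mul_sum]
    refine sum_congr rfl fun e he => ?_
    rw [sum_const, (mem_powersetCard.1 he).2]
    simp [mul_comm]
  rw [h3]
  linear_combination density k F Y * hch

/-- Deleting a random point changes the density of a `k`-uniform family little in mean square. -/
theorem sum_density_erase_sub_sq_le (Y : Finset α) {k : ℕ} (hk : 1 ≤ k) (hkY : k + 1 ≤ #Y)
    (F : Finset (Finset α)) :
    ∑ v ∈ Y, (density k F (Y.erase v) - density k F Y) ^ 2 ≤
      #Y * (k / ((#Y - k) * (#Y - 1)) * (density k F Y * (1 - density k F Y))) := by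
  set f := density k F Y with hf
  set a : α → ℝ := fun v => density k F (Y.erase v) - f with ha
  set x := ∑ v ∈ Y, a v ^ 2 with hx
  have hN2 : 2 ≤ #Y := by omega
  have hsum : ∑ v ∈ Y, a v = 0 := by
    simp only [ha]
    rw [sum_sub_distrib, sum_density_erase Y hkY F, sum_const, nsmul_eq_mul, sub_self]
  have hx0 : 0 ≤ x := sum_nonneg fun v _ => sq_nonneg _
  set c : ℝ := (((#Y - 1).choose k : ℕ) : ℝ) with hc
  have hc0 : 0 < c := by rw [hc]; exact_mod_cast Nat.choose_pos (by omega)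
  have hψ0 : ∑ e ∈ Y.powersetCard k, 1 * ∑ v ∈ e, a v = 0 := by
    rw [sum_powersetCard_sum_mem]
    have : ∀ v ∈ Y, a v * (∑ e ∈ Y.powersetCard k, if v ∈ e then (1 : ℝ) else 0) =
        (#Y - 1).choose (k - 1) * a v := by
      intro v hv
      rw [sum_boole, card_filter_mem_powersetCard Y hk hv, mul_comm]
    rw [sum_congr rfl this, ← mul_sum, hsum, mul_zero]
  have hkey : c * x = -∑ e ∈ Y.powersetCard k,
      ((if e ∈ F then (1 : ℝ) else 0) - f) * ∑ v ∈ e, a v := by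
    have h1 : x = ∑ v ∈ Y, a v * density k F (Y.erase v) := by
      have : ∑ v ∈ Y, a v * f = 0 := by rw [← sum_mul, hsum, zero_mul]
      rw [hx, ← sub_zero (∑ v ∈ Y, a v * density k F (Y.erase v)), ← this, ← sum_sub_distrib]
      refine sum_congr rfl fun v _ => ?_
      simp only [ha]; ring
    have h2 : ∀ v ∈ Y, c * (a v * density k F (Y.erase v)) =
        a v * (c * f * (#Y).choose k / c) -
          a v * ∑ e ∈ Y.powersetCard k, if v ∈ e then if e ∈ F then (1 : ℝ) else 0 else 0 := by
      intro v hv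
      rw [mul_left_comm, hc, choose_mul_density_erase Y hv, ← mul_sub]
      congr 1
      rw [← hc, mul_assoc, mul_div_cancel_left₀ _ hc0.ne', mul_comm f, choose_mul_density,
        ← sum_sub_distrib]
      refine sum_congr rfl fun e _ => ?_
      split_ifs <;> simp
    have h3 : ∑ e ∈ Y.powersetCard k, f * ∑ v ∈ e, a v = 0 := by
      rw [← mul_sum]; simp only [one_mul] at hψ0; rw [hψ0, mul_zero]
    simp_rw [sub_mul]
    rw [sum_sub_distrib, h3, sum_powersetCard_sum_mem, h1, mul_sum, sum_congr rfl h2,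
      sum_sub_distrib, ← sum_mul, hsum]
    ring
  have hCS : (c * x) ^ 2 ≤ ((#Y).choose k * (f * (1 - f))) * ((#Y - 2).choose (k - 1) * x) := by
    rw [hkey, neg_sq, hf, ← sum_sub_density_sq, hx, ← sum_powersetCard_sq_sum Y hk hN2 a hsum]
    exact sum_mul_sq_le_sq_mul_sq _ _ _
  rcases hx0.eq_or_lt with h0 | hxpos
  · rw [← h0]
    have := density_nonneg k F Y
    have := density_le_one k F Y
    have h1 : (k : ℝ) + 1 ≤ #Y := by exact_mod_cast hkY
    have h2 : (0 : ℝ) ≤ k := by positivity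
    have h3 : 0 ≤ f * (1 - f) := mul_nonneg (by linarith) (by linarith)
    have h4 : (0 : ℝ) ≤ #Y - k := by linarith
    have h5 : (0 : ℝ) ≤ #Y - 1 := by linarith
    positivity
  · have hch1 : ((#Y).choose k : ℝ) * (#Y - k) = #Y * c := by
      obtain ⟨m, hm⟩ := Nat.exists_eq_add_of_le' (show 1 ≤ #Y by omega)
      have := Nat.choose_mul_succ_eq m k
      rw [← hm] at this
      have h2 : ((#Y - k : ℕ) : ℝ) = #Y - k := by push_cast [show k ≤ #Y by omega]; rfl
      rw [← h2, hc, show #Y - 1 = m by omega, mul_comm (#Y : ℝ)]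
      exact_mod_cast this.symm
    have hch2 : ((#Y : ℝ) - 1) * (#Y - 2).choose (k - 1) = k * c := by
      obtain ⟨m, hm⟩ := Nat.exists_eq_add_of_le' hN2
      obtain ⟨j, hj⟩ := Nat.exists_eq_add_of_le' hk
      have := Nat.add_one_mul_choose_eq m j
      rw [hc, show #Y - 2 = m by omega, show #Y - 1 = m + 1 by omega, hj, hm,
        show j + 1 - 1 = j by omega]
      have h : ((m : ℝ) + 1) * m.choose j = (m + 1).choose (j + 1) * (j + 1) := by
        exact_mod_cast this
      push_cast
      linear_combination h
    have hk1 : (k : ℝ) + 1 ≤ #Y := by exact_mod_cast hkY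
    have hk0 : (1 : ℝ) ≤ k := by exact_mod_cast hk
    have h4 : (0 : ℝ) < #Y - k := by linarith
    have h5 : (0 : ℝ) < #Y - 1 := by linarith
    have hle : c ^ 2 * x ≤ (#Y).choose k * (f * (1 - f)) * (#Y - 2).choose (k - 1) := by
      refine le_of_mul_le_mul_right ?_ hxpos
      linarith
    rw [← mul_assoc, mul_div_assoc', div_mul_eq_mul_div, le_div_iff₀ (by positivity)]
    refine le_of_mul_le_mul_left ?_ (pow_pos hc0 2)
    calc c ^ 2 * (x * ((#Y - k) * (#Y - 1))) = c ^ 2 * x * ((#Y - k) * (#Y - 1)) := by ring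
      _ ≤ (#Y).choose k * (f * (1 - f)) * (#Y - 2).choose (k - 1) * ((#Y - k) * (#Y - 1)) := by
          gcongr
      _ = (((#Y).choose k * (#Y - k)) * ((#Y - 1) * (#Y - 2).choose (k - 1))) * (f * (1 - f)) := by
          ring
      _ = c ^ 2 * (#Y * k * (f * (1 - f))) := by rw [hch1, hch2]; ring

theorem expect_density_sub_sq (Y : Finset α) {k b : ℕ} (F : Finset (Finset α)) (hkb : k ≤ b)
    (hb : b ≤ #Y) :
    𝔼 B ∈ Y.powersetCard b, (density k F B - density k F Y) ^ 2 =
      𝔼 B ∈ Y.powersetCard b, density k F B ^ 2 - density k F Y ^ 2 := by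
  have hne : (Y.powersetCard b).Nonempty := powersetCard_nonempty.2 hb
  have h : ∀ B, (density k F B - density k F Y) ^ 2 =
      density k F B ^ 2 - 2 * density k F Y * density k F B + density k F Y ^ 2 := fun B => by ring
  simp_rw [h]
  rw [expect_add_distrib, expect_sub_distrib, ← mul_expect, expect_density Y F hkb hb,
    expect_const hne]
  ring

theorem sq_density_le_expect_sq (Y : Finset α) {k b : ℕ} (F : Finset (Finset α)) (hkb : k ≤ b)
    (hb : b ≤ #Y) : density k F Y ^ 2 ≤ 𝔼 B ∈ Y.powersetCard b, density k F B ^ 2 := by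
  have := expect_density_sub_sq Y F hkb hb
  have h : 0 ≤ 𝔼 B ∈ Y.powersetCard b, (density k F B - density k F Y) ^ 2 :=
    expect_nonneg fun _ _ => sq_nonneg _
  linarith

theorem density_mul_one_sub_nonneg (k : ℕ) (F : Finset (Finset α)) (Y : Finset α) :
    0 ≤ density k F Y * (1 - density k F Y) :=
  mul_nonneg (density_nonneg _ _ _) (sub_nonneg.2 (density_le_one _ _ _))

theorem expect_density_mul_one_sub_le (Y : Finset α) {k b : ℕ} (F : Finset (Finset α))
    (hkb : k ≤ b) (hb : b ≤ #Y) :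
    𝔼 B ∈ Y.powersetCard b, density k F B * (1 - density k F B) ≤
      density k F Y * (1 - density k F Y) := by
  have h : ∀ B, density k F B * (1 - density k F B) = density k F B - density k F B ^ 2 :=
    fun B => by ring
  simp_rw [h]
  rw [expect_sub_distrib, expect_density Y F hkb hb]
  linarith [sq_density_le_expect_sq Y F hkb hb]

theorem expect_erase_density_sq_le (Y : Finset α) {k M : ℕ} (hk : 1 ≤ k) (hM : 0 < M)
    (hkY : M + k + 1 ≤ #Y) (F : Finset (Finset α)) :
    𝔼 B ∈ Y.powersetCard (#Y - 1), density k F B ^ 2 ≤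
      density k F Y ^ 2 + k / (M : ℝ) ^ 2 * (density k F Y * (1 - density k F Y)) := by
  have h1 := expect_density_sub_sq Y (b := #Y - 1) F (by omega) (by omega) (k := k)
  have h2 := sum_density_erase_sub_sq_le Y hk (by omega) F
  have h3 : 𝔼 B ∈ Y.powersetCard (#Y - 1), (density k F B - density k F Y) ^ 2 =
      (∑ v ∈ Y, (density k F (Y.erase v) - density k F Y) ^ 2) / #Y := by
    rw [← expect_sdiff_powersetCard Y (by omega) fun B => (density k F B - density k F Y) ^ 2,
      expect_eq_sum_div_card, powersetCard_one, sum_map, card_map]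
    congr 1
    refine sum_congr rfl fun v _ => ?_
    simp [sdiff_singleton_eq_erase]
  have hY0 : (0 : ℝ) < #Y := by exact_mod_cast (by omega : 0 < #Y)
  have hM0 : (0 : ℝ) < M := by exact_mod_cast hM
  have hYM : (M : ℝ) + k + 1 ≤ #Y := by exact_mod_cast hkY
  have hk0 : (0 : ℝ) ≤ k := by positivity
  have h4 : (∑ v ∈ Y, (density k F (Y.erase v) - density k F Y) ^ 2) / #Y ≤
      k / (M : ℝ) ^ 2 * (density k F Y * (1 - density k F Y)) := by
    rw [div_le_iff₀ hY0]
    refine h2.trans ?_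
    rw [mul_comm]
    have := density_mul_one_sub_nonneg k F Y
    gcongr
    nlinarith
  linarith

/-- Deleting a random `s`-set: the second moment of the density. -/
theorem expect_density_sq_le (Y : Finset α) {k M : ℕ} (hk : 1 ≤ k) (hM : 0 < M)
    (F : Finset (Finset α)) (s : ℕ) (hY : M + s + k ≤ #Y) :
    𝔼 B ∈ Y.powersetCard (#Y - s), density k F B ^ 2 ≤
      density k F Y ^ 2 + s * k / (M : ℝ) ^ 2 * (density k F Y * (1 - density k F Y)) := by
  induction s with
  | zero => simp
  | succ s ih =>
    have ih := ih (by omega)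
    have hlow := sq_density_le_expect_sq Y (b := #Y - s) F (by omega) (by omega) (k := k)
    set q := 𝔼 B ∈ Y.powersetCard (#Y - s), density k F B ^ 2 with hq
    set c : ℝ := k / (M : ℝ) ^ 2 with hc
    have hc0 : 0 ≤ c := by positivity
    have hstep : 𝔼 B ∈ Y.powersetCard (#Y - (s + 1)), density k F B ^ 2 ≤
        q + c * (density k F Y - q) := by
      rw [← expect_powersetCard_expect_powersetCard Y (c := #Y - s) (by omega) (by omega)]
      calc _ ≤ 𝔼 C ∈ Y.powersetCard (#Y - s),
            (density k F C ^ 2 + c * (density k F C * (1 - density k F C))) := by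
            refine expect_le_expect fun C hC => ?_
            have hC := (mem_powersetCard.1 hC).2
            rw [show #Y - (s + 1) = #C - 1 by omega]
            exact expect_erase_density_sq_le C hk hM (by omega) F
        _ = q + c * (density k F Y - q) := by
            have h : ∀ C, density k F C * (1 - density k F C) =
              density k F C - density k F C ^ 2 := fun C => by ring
            simp_rw [h]
            rw [expect_add_distrib, ← mul_expect, expect_sub_distrib,
              expect_density Y F (by omega) (by omega)]
    refine hstep.trans ?_
    rw [mul_div_assoc, ← hc] at ih ⊢
    push_cast
    nlinarith [mul_le_mul_of_nonneg_left hlow hc0]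

theorem expect_density_sdiff_sub_sq_le (Y : Finset α) {k M : ℕ} (hk : 1 ≤ k) (hM : 0 < M)
    (F : Finset (Finset α)) (s : ℕ) (hY : M + s + k ≤ #Y) :
    𝔼 e ∈ Y.powersetCard s, (density k F (Y \ e) - density k F Y) ^ 2 ≤
      s * k / (M : ℝ) ^ 2 * (density k F Y * (1 - density k F Y)) := by
  rw [expect_sdiff_powersetCard Y (by omega) fun B => (density k F B - density k F Y) ^ 2,
    expect_density_sub_sq Y F (by omega) (by omega)]
  linarith [expect_density_sq_le Y hk hM F s hY]

theorem exists_mem_density_mul_le_expect {k : ℕ} {F : Finset (Finset α)} {Y : Finset α}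
    (hF : 0 < density k F Y) (Φ : Finset α → ℝ) (hΦ : ∀ e, 0 ≤ Φ e) :
    ∃ e ∈ F, e ⊆ Y ∧ #e = k ∧ density k F Y * Φ e ≤ 𝔼 e ∈ Y.powersetCard k, Φ e := by
  by_contra! hcon
  set E := 𝔼 e ∈ Y.powersetCard k, Φ e with hE
  obtain ⟨e₀, he₀, he₀Y, he₀k⟩ := exists_mem_of_density_pos hF
  have hpos : 0 < 𝔼 e ∈ Y.powersetCard k,
      (if e ∈ F then (1 : ℝ) else 0) * (density k F Y * Φ e - E) := by
    refine expect_pos' (fun e he => ?_) ⟨e₀, mem_powersetCard.2 ⟨he₀Y, he₀k⟩, ?_⟩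
    · rw [mem_powersetCard] at he
      split_ifs with h
      · linarith [hcon e h he.1 he.2]
      · simp
    · rw [if_pos he₀]
      linarith [hcon e₀ he₀ he₀Y he₀k]
  have hle : 𝔼 e ∈ Y.powersetCard k, (if e ∈ F then (1 : ℝ) else 0) * (density k F Y * Φ e - E) ≤
      𝔼 e ∈ Y.powersetCard k, (density k F Y * Φ e - E * if e ∈ F then (1 : ℝ) else 0) := by
    refine expect_le_expect fun e _ => ?_
    have := mul_nonneg hF.le (hΦ e)
    split_ifs <;> linarith
  rw [expect_sub_distrib, ← mul_expect, ← mul_expect, ← hE] at hle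
  change _ ≤ density k F Y * E - E * density k F Y at hle
  linarith

/-- One can pick a member of a family of positive density such that deleting it changes the
densities of the other families little. -/
theorem exists_mem_sum_density_sdiff_sub_sq_le {ι : Type*} (S : Finset ι) (k : ι → ℕ)
    (F : ι → Finset (Finset α)) (w : ι → ℝ) (hw : ∀ i ∈ S, 0 ≤ w i) (hk : ∀ i ∈ S, 1 ≤ k i)
    {s M : ℕ} {G : Finset (Finset α)} {Y : Finset α} (hM : 0 < M)
    (hY : ∀ i ∈ S, M + s + k i ≤ #Y) (hG : 0 < density s G Y) :
    ∃ e ∈ G, e ⊆ Y ∧ #e = s ∧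
      density s G Y * ∑ i ∈ S, w i * (density (k i) (F i) (Y \ e) - density (k i) (F i) Y) ^ 2 ≤
      ∑ i ∈ S, w i * (s * k i / (M : ℝ) ^ 2 *
        (density (k i) (F i) Y * (1 - density (k i) (F i) Y))) := by
  obtain ⟨e, he, heY, hes, hle⟩ := exists_mem_density_mul_le_expect hG
    (fun e => ∑ i ∈ S, w i * (density (k i) (F i) (Y \ e) - density (k i) (F i) Y) ^ 2)
    (fun e => sum_nonneg fun i hi => mul_nonneg (hw i hi) (sq_nonneg _))
  refine ⟨e, he, heY, hes, hle.trans ?_⟩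
  rw [expect_sum_comm]
  refine sum_le_sum fun i hi => ?_
  rw [← mul_expect]
  exact mul_le_mul_of_nonneg_left
    (expect_density_sdiff_sub_sq_le Y (hk i hi) hM (F i) s (hY i hi)) (hw i hi)

theorem expect_block_sq_le (Y : Finset α) {k K M L : ℕ} (hk : 1 ≤ k) (hkK : k ≤ K)
    (F : Finset (Finset α)) (hM : 0 < M) (hLM : L * K ≤ M) (hY : M + 2 * K ≤ #Y) (c : ℝ) :
    𝔼 B ∈ Y.powersetCard K, ((L * density k F (Y \ B) + (c + density k F B)) ^ 2 +
        4 * L * (density k F (Y \ B) * (1 - density k F (Y \ B)))) ≤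
      ((L + 1) * density k F Y + c) ^ 2 + 4 * (L + 1) * (density k F Y * (1 - density k F Y)) := by
  set g := density k F Y with hg
  have hne : (Y.powersetCard K).Nonempty := powersetCard_nonempty.2 (by omega)
  have hδ := expect_density_sdiff_sub_sq_le Y hk hM F K (by omega)
  have hδ0 : 𝔼 B ∈ Y.powersetCard K, density k F (Y \ B) = g := by
    rw [expect_sdiff_powersetCard Y (by omega), expect_density Y F (by omega) (by omega)]
  have hβ := expect_density_sub_sq Y (b := K) F hkK (by omega)
  have hβ0 : 𝔼 B ∈ Y.powersetCard K, density k F B = g :=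
    expect_density Y F (by omega) (by omega)
  have hβ1 : 𝔼 B ∈ Y.powersetCard K, density k F B ^ 2 ≤ g := by
    rw [← hβ0]
    refine expect_le_expect fun B _ => ?_
    nlinarith [density_nonneg k F B, density_le_one k F B]
  have hv : 𝔼 B ∈ Y.powersetCard K, density k F (Y \ B) * (1 - density k F (Y \ B)) ≤
      g * (1 - g) := by
    rw [expect_sdiff_powersetCard Y (by omega) fun B => density k F B * (1 - density k F B)]
    exact expect_density_mul_one_sub_le Y F (by omega) (by omega)
  have hpt : ∀ B ∈ Y.powersetCard K, ((L * density k F (Y \ B) + (c + density k F B)) ^ 2 +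
        4 * L * (density k F (Y \ B) * (1 - density k F (Y \ B)))) ≤
      (2 * (L : ℝ) ^ 2 * (density k F (Y \ B) - g) ^ 2 + 2 * (density k F B - g) ^ 2) +
      (2 * ((L + 1) * g + c) * L * density k F (Y \ B) +
        2 * ((L + 1) * g + c) * density k F B) +
      (4 * L * (density k F (Y \ B) * (1 - density k F (Y \ B))) +
       (((L + 1) * g + c) ^ 2 - 2 * ((L + 1) * g + c) * ((L + 1) * g))) := by
    intro B _
    nlinarith [sq_nonneg ((L : ℝ) * (density k F (Y \ B) - g) - (density k F B - g))]
  refine (expect_le_expect hpt).trans ?_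
  simp only [expect_add_distrib, ← mul_expect, expect_const hne]
  rw [hδ0, hβ0, hβ]
  have hM0 : (0 : ℝ) < M := by exact_mod_cast hM
  have hLK : (L : ℝ) ^ 2 * (K * k / (M : ℝ) ^ 2) ≤ 1 := by
    rw [mul_div_assoc', div_le_one (by positivity)]
    have h1 : (L : ℝ) * K ≤ M := by exact_mod_cast hLM
    have h2 : (k : ℝ) ≤ K := by exact_mod_cast hkK
    calc (L : ℝ) ^ 2 * (K * k) ≤ (L : ℝ) ^ 2 * ((K : ℝ) * K) := by gcongr
      _ = ((L : ℝ) * K) ^ 2 := by ring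
      _ ≤ (M : ℝ) ^ 2 := by gcongr
  have hgg : 0 ≤ g * (1 - g) := density_mul_one_sub_nonneg k F Y
  have h3 : (L : ℝ) ^ 2 * 𝔼 B ∈ Y.powersetCard K, (density k F (Y \ B) - g) ^ 2 ≤ g * (1 - g) := by
    refine (mul_le_mul_of_nonneg_left hδ (sq_nonneg _)).trans ?_
    rw [← mul_assoc]
    exact mul_le_of_le_one_left hgg hLK
  have h4 := mul_le_mul_of_nonneg_left hv (show (0 : ℝ) ≤ 4 * L by positivity)
  rw [← hg]
  nlinarith

/-- Disjoint `K`-blocks over which the densities of all families concentrate on average. -/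
theorem exists_blocks_sum_sq_le {ι : Type*} (S : Finset ι) (k : ι → ℕ)
    (F : ι → Finset (Finset α)) {K M : ℕ} (hk : ∀ i ∈ S, 1 ≤ k i) (hkK : ∀ i ∈ S, k i ≤ K)
    (hM : 0 < M) (L : ℕ) (hLM : L * K ≤ M) (Y : Finset α) (hY : M + (L + 1) * K ≤ #Y)
    (c : ι → ℝ) :
    ∃ B : Fin L → Finset α, (∀ l, B l ⊆ Y) ∧ (Pairwise fun l l' => Disjoint (B l) (B l')) ∧
      ∑ i ∈ S, (∑ l, density (k i) (F i) (B l) + c i) ^ 2 ≤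
      ∑ i ∈ S, ((L * density (k i) (F i) Y + c i) ^ 2 +
        4 * L * (density (k i) (F i) Y * (1 - density (k i) (F i) Y))) := by
  induction L generalizing Y c with
  | zero => exact ⟨fun _ => ∅, fun _ => empty_subset _, fun l => l.elim0, by simp⟩
  | succ L ih =>
    have hKY : M + 2 * K ≤ #Y := by nlinarith
    have hLM' : L * K ≤ M := by nlinarith
    have hne : (Y.powersetCard K).Nonempty := powersetCard_nonempty.2 (by omega)
    obtain ⟨B₀, hB₀, hle⟩ := exists_le_of_expect_le hne (a :=
        ∑ i ∈ S, (((L + 1) * density (k i) (F i) Y + c i) ^ 2 +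
          4 * (L + 1) * (density (k i) (F i) Y * (1 - density (k i) (F i) Y))))
      (f := fun B => ∑ i ∈ S,
        ((L * density (k i) (F i) (Y \ B) + (c i + density (k i) (F i) B)) ^ 2 +
        4 * L * (density (k i) (F i) (Y \ B) * (1 - density (k i) (F i) (Y \ B))))) (by
        rw [expect_sum_comm]
        exact sum_le_sum fun i hi =>
          expect_block_sq_le Y (hk i hi) (hkK i hi) (F i) hM hLM' hKY (c i))
    rw [mem_powersetCard] at hB₀
    obtain ⟨B, hBY, hdis, hB⟩ := ih hLM' (Y \ B₀)
      (by rw [card_sdiff_of_subset hB₀.1, hB₀.2]; have : (L + 1 + 1) * K = (L + 1) * K + K := by ring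
          omega)
      (fun i => c i + density (k i) (F i) B₀)
    refine ⟨Fin.cons B₀ B, ?_, ?_, ?_⟩
    · intro l
      refine Fin.cases ?_ (fun l => ?_) l
      · simpa using hB₀.1
      · simpa using (hBY l).trans sdiff_subset
    · have h0 : ∀ l, Disjoint B₀ (B l) := fun l =>
        disjoint_of_subset_right (hBY l) disjoint_sdiff
      intro l
      refine Fin.cases ?_ (fun l => ?_) l
      · intro l'
        refine Fin.cases (fun h => absurd rfl h) (fun l' _ => ?_) l'
        simpa using h0 l'
      · intro l'
        refine Fin.cases (fun _ => ?_) (fun l' h => ?_) l'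
        · simpa using (h0 l).symm
        · simpa using hdis (fun h' => h (by rw [h']))
    · simp only [Fin.sum_univ_succ, Fin.cons_zero, Fin.cons_succ]
      push_cast
      refine le_trans (le_of_eq ?_) (hB.trans hle)
      refine sum_congr rfl fun i _ => ?_
      ring

end Density

section CrossIntersecting

open scoped FinsetFamily

theorem exists_isInitSeg_card_eq {n r m : ℕ} (hm : m ≤ n.choose r) :
    ∃ 𝒞 : Finset (Finset (Fin n)), Colex.IsInitSeg 𝒞 r ∧ #𝒞 = m := by
  induction m with
  | zero => exact ⟨∅, by simp, rfl⟩
  | succ m ih =>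
    obtain ⟨𝒞, h𝒞, hcard⟩ := ih (by omega)
    have hne : (powersetCard r (univ : Finset (Fin n)) \ 𝒞).Nonempty := by
      rw [← card_pos]
      have h1 := le_card_sdiff 𝒞 (powersetCard r (univ : Finset (Fin n)))
      rw [card_powersetCard, card_univ, Fintype.card_fin] at h1
      omega
    obtain ⟨s, hs, hmin⟩ := exists_min_image _ (fun s => toColex s) hne
    simp only [mem_sdiff, mem_powersetCard, subset_univ, true_and] at hs hmin
    refine ⟨insert s 𝒞, ⟨?_, ?_⟩, ?_⟩
    · intro t ht
      rcases mem_insert.1 (mem_coe.1 ht) with rfl | ht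
      · exact hs.1
      · exact h𝒞.1 ht
    · rintro t u ht ⟨hut, hu⟩
      by_contra hcon
      have hu𝒞 : u ∉ 𝒞 := fun h => hcon (mem_insert_of_mem h)
      rcases mem_insert.1 ht with rfl | ht
      · exact absurd (hmin u ⟨hu, hu𝒞⟩) (not_le.2 hut)
      · exact hu𝒞 (h𝒞.2 ht ⟨hut, hu⟩)
    · rw [card_insert_of_notMem hs.2, hcard]

/-- Kruskal–Katona compression of a cross-intersecting pair: the first family can be taken to be
closed under moving up in the colexicographic order. -/
theorem exists_colex_upper_cross_intersecting {n a b : ℕ} (hab : a + b ≤ n)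
    {F G : Finset (Finset (Fin n))} (hF : ∀ e ∈ F, #e = a) (hG : ∀ e ∈ G, #e = b)
    (hcross : ∀ e ∈ F, ∀ e' ∈ G, ¬ Disjoint e e') :
    ∃ F' G' : Finset (Finset (Fin n)), #F' = #F ∧ #G ≤ #G' ∧ (∀ e ∈ F', #e = a) ∧
      (∀ e ∈ G', #e = b) ∧ (∀ e ∈ F', ∀ e' ∈ G', ¬ Disjoint e e') ∧
      ∀ A ∈ F', ∀ A' : Finset (Fin n), #A' = a →
        (∃ y ∈ A', y ∉ A ∧ ∀ x ∈ A, x ∉ A' → x < y) → A' ∈ F' := by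
  have hFs : (F : Set (Finset (Fin n))).Sized a := fun e he => hF e (mem_coe.1 he)
  have hFc : (Fᶜˢ : Set (Finset (Fin n))).Sized (n - a) := by simpa using hFs.compls
  have hle : #F ≤ n.choose (n - a) := by
    have : F ⊆ powersetCard a univ := fun e he => mem_powersetCard.2 ⟨subset_univ _, hF e he⟩
    have h := card_le_card this
    rwa [card_powersetCard, card_univ, Fintype.card_fin, ← Nat.choose_symm (by omega)] at h
  obtain ⟨𝒞, h𝒞, hcard⟩ := exists_isInitSeg_card_eq hle
  have hkk : #(∂^[n - a - b] 𝒞) ≤ #(∂^[n - a - b] Fᶜˢ) :=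
    iterated_kk hFc (by rw [card_compls, hcard]) h𝒞
  have hsh𝒞 : ∂^[n - a - b] 𝒞 ⊆ powersetCard b univ := by
    intro e he
    have := h𝒞.1.shadow_iterate (k := n - a - b) (mem_coe.2 he)
    exact mem_powersetCard.2 ⟨subset_univ _, by omega⟩
  have hshF : ∂^[n - a - b] Fᶜˢ ⊆ powersetCard b univ \ G := by
    intro e he
    have h1 := hFc.shadow_iterate (k := n - a - b) (mem_coe.2 he)
    refine mem_sdiff.2 ⟨mem_powersetCard.2 ⟨subset_univ _, by omega⟩, fun heG => ?_⟩
    obtain ⟨s, hs, hes, -⟩ := mem_shadow_iterate_iff_exists_sdiff.1 he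
    exact hcross sᶜ (mem_compls.1 hs) e heG
      (disjoint_of_subset_right hes disjoint_compl_left)
  refine ⟨𝒞ᶜˢ, powersetCard b univ \ ∂^[n - a - b] 𝒞, by rw [card_compls, hcard], ?_, ?_, ?_, ?_, ?_⟩
  · have h1 := card_le_card hshF
    have hG' : G ⊆ powersetCard b univ := fun e he => mem_powersetCard.2 ⟨subset_univ _, hG e he⟩
    have h2 := card_le_card hG'
    rw [card_sdiff_of_subset hG'] at h1
    rw [card_sdiff_of_subset hsh𝒞]
    omega
  · intro e he
    have := h𝒞.1 (mem_coe.2 (mem_compls.1 he))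
    rw [card_compl, Fintype.card_fin] at this
    have : #e ≤ n := by simpa using card_le_univ e
    omega
  · intro e he
    exact (mem_powersetCard.1 (mem_sdiff.1 he).1).2
  · intro e he e' he' hdis
    rw [mem_sdiff, mem_powersetCard] at he'
    refine he'.2 (mem_shadow_iterate_iff_exists_mem_card_add.2
      ⟨eᶜ, mem_compls.1 he, fun x hx => mem_compl.2 fun hxe => ?_, ?_⟩)
    · exact (disjoint_left.1 hdis hxe) hx
    · rw [h𝒞.1 (mem_coe.2 (mem_compls.1 he)), he'.1.2]
      omega
  · rintro A hA A' hA' ⟨y, hy, hyA, hmax⟩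
    refine mem_compls.2 (h𝒞.2 (mem_compls.1 hA) ⟨?_, ?_⟩)
    · rw [Colex.toColex_lt_toColex_iff_exists_forall_lt]
      refine ⟨y, mem_compl.2 hyA, by simpa using hy, fun x hx hxA => ?_⟩
      rw [mem_compl] at hx hxA
      exact hmax x (not_not.1 hxA) hx
    · rw [card_compl, Fintype.card_fin, hA']

theorem card_le_choose_of_forall_subset {n a : ℕ} {F : Finset (Finset (Fin n))}
    (hF : ∀ e ∈ F, #e = a) (S : Finset (Fin n)) (hS : ∀ e ∈ F, S ⊆ e) (hSa : #S ≤ a) :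
    #F ≤ (n - #S).choose (a - #S) := by
  have := card_filter_powersetCard_subset S univ a (subset_univ _) hSa
  rw [card_univ, Fintype.card_fin] at this
  rw [← this]
  refine card_le_card fun e he => ?_
  rw [mem_filter, mem_powersetCard]
  exact ⟨⟨subset_univ _, hF e he⟩, hS e he⟩

theorem card_le_mul_choose_of_forall_not_disjoint {n a : ℕ} (ha : 1 ≤ a)
    {F : Finset (Finset (Fin n))} (hF : ∀ e ∈ F, #e = a) (T : Finset (Fin n))
    (hT : ∀ e ∈ F, ¬ Disjoint e T) : #F ≤ #T * (n - 1).choose (a - 1) := by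
  have hsub : F ⊆ T.biUnion fun y => {e ∈ F | y ∈ e} := by
    intro e he
    obtain ⟨y, hye, hyT⟩ := not_disjoint_iff.1 (hT e he)
    exact mem_biUnion.2 ⟨y, hyT, mem_filter.2 ⟨he, hye⟩⟩
  refine (card_le_card hsub).trans (card_biUnion_le_card_mul _ _ _ fun y _ => ?_)
  have := card_le_choose_of_forall_subset (F := {e ∈ F | y ∈ e})
    (fun e he => hF e (mem_filter.1 he).1) {y}
    (fun e he => singleton_subset_iff.2 (mem_filter.1 he).2) (by simpa using ha)
  simpa using this

theorem exists_card_eq_subset_disjoint {n a : ℕ} (S B : Finset (Fin n)) (hSB : Disjoint S B)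
    (hS : #S ≤ a) (haB : a + #B ≤ n) :
    ∃ A : Finset (Fin n), S ⊆ A ∧ #A = a ∧ Disjoint A B := by
  obtain ⟨A, hSA, hAB, hA⟩ := exists_subsuperset_card_eq (s := S) (t := Bᶜ) (n := a)
    (fun x hx => mem_compl.2 (disjoint_left.1 hSB hx)) hS
    (by rw [card_compl, Fintype.card_fin]; omega)
  exact ⟨A, hSA, hA, disjoint_left.2 fun x hx => mem_compl.1 (hAB hx)⟩

theorem eight_mul_choose_le {m b : ℕ} (hm : 8 * (b + 1) ≤ m + 1) :
    8 * m.choose b ≤ (m + 1).choose (b + 1) := by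
  have := Nat.add_one_mul_choose_eq m b
  have h2 : 8 * (b + 1) * m.choose b ≤ (m + 1).choose (b + 1) * (b + 1) := by
    rw [← this]; gcongr
  refine le_of_mul_le_mul_right ?_ (Nat.succ_pos b)
  linarith

theorem eight_pow_mul_choose_le {n b p : ℕ} (hb8 : 8 * b ≤ n) (hp : p + 1 ≤ b) :
    8 ^ p * (n - (p + 1)).choose (b - (p + 1)) ≤ (n - 1).choose (b - 1) := by
  induction p with
  | zero => simp
  | succ p ih =>
    have h := eight_mul_choose_le (m := n - (p + 2)) (b := b - (p + 2)) (by omega)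
    rw [show n - (p + 2) + 1 = n - (p + 1) by omega,
      show b - (p + 2) + 1 = b - (p + 1) by omega] at h
    calc 8 ^ (p + 1) * (n - (p + 1 + 1)).choose (b - (p + 1 + 1))
        = 8 ^ p * (8 * (n - (p + 2)).choose (b - (p + 2))) := by ring_nf
      _ ≤ 8 ^ p * (n - (p + 1)).choose (b - (p + 1)) := by gcongr
      _ ≤ _ := ih (by omega)

theorem succ_succ_le_eight_pow {p : ℕ} (hp : 1 ≤ p) : p + 2 ≤ 8 ^ p := by
  induction p, hp using Nat.le_induction with
  | base => norm_num
  | succ p _ ih => rw [pow_succ]; omega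

theorem choose_mul_choose_le_of_double_count {n a b : ℕ} (hb : 1 ≤ b) (ha8 : 8 * a ≤ n)
    (hb8 : 8 * b ≤ n) (ha : 2 ≤ a) :
    (n - 1).choose (b - 1) * (n - 2 - b).choose (a - 2) ≤
      (n - 1).choose (a - 1) * (n - 1 - a).choose (b - 1) := by
  obtain ⟨a, rfl⟩ := Nat.exists_eq_add_of_le' ha
  obtain ⟨b, rfl⟩ := Nat.exists_eq_add_of_le' hb
  obtain ⟨z, rfl⟩ := Nat.exists_eq_add_of_le (show a + b + 3 ≤ n by omega)
  rw [show a + b + 3 + z - 1 = a + b + 2 + z by omega, show b + 1 - 1 = b by omega,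
    show a + b + 3 + z - 2 - (b + 1) = a + z by omega, show a + 2 - 2 = a by omega,
    show a + 2 - 1 = a + 1 by omega, show a + b + 2 + z - (a + 2) = b + z by omega]
  set P := (a + b + 2 + z).choose (a + 1)
  set Q := (a + b + 2 + z).choose b
  have h1 : P * (b + z + 1).choose b = Q * (a + z + 2).choose (a + 1) := by
    have e1 := Nat.choose_mul (n := a + b + 2 + z) (k := a + 1 + b) (s := a + 1) (by omega)
    have e2 := Nat.choose_mul (n := a + b + 2 + z) (k := a + 1 + b) (s := b) (by omega)
    rw [show a + b + 2 + z - (a + 1) = b + z + 1 by omega, show a + 1 + b - (a + 1) = b by omega]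
      at e1
    rw [show a + b + 2 + z - b = a + z + 2 by omega, show a + 1 + b - b = a + 1 by omega] at e2
    rw [← e1, ← e2]
    congr 1
    rw [← Nat.choose_symm (show a + 1 ≤ a + 1 + b by omega)]
    congr 1; omega
  have h2 : (b + z).choose b * (b + z + 1) = (b + z + 1).choose b * (z + 1) := by
    have := Nat.choose_mul_succ_eq (b + z) b
    rwa [show b + z + 1 - b = z + 1 by omega] at this
  have h3 : (a + z + 2) * (a + z + 1).choose a = (a + z + 2).choose (a + 1) * (a + 1) :=
    Nat.add_one_mul_choose_eq (a + z + 1) a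
  have h4 : (a + z).choose a * (a + z + 1) = (a + z + 1).choose a * (z + 1) := by
    have := Nat.choose_mul_succ_eq (a + z) a
    rwa [show a + z + 1 - a = z + 1 by omega] at this
  have hle : (a + 1) * (b + z + 1) ≤ (a + z + 2) * (a + z + 1) := by nlinarith
  refine le_of_mul_le_mul_right ?_ (show 0 < (b + z + 1) * ((a + z + 2) * (a + z + 1)) by positivity)
  calc Q * (a + z).choose a * ((b + z + 1) * ((a + z + 2) * (a + z + 1)))
      = Q * (b + z + 1) * (a + z + 2) * ((a + z).choose a * (a + z + 1)) := by ring
    _ = Q * (b + z + 1) * (z + 1) * ((a + z + 2) * (a + z + 1).choose a) := by rw [h4]; ring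
    _ = (Q * (a + z + 2).choose (a + 1)) * (z + 1) * ((a + 1) * (b + z + 1)) := by rw [h3]; ring
    _ ≤ (Q * (a + z + 2).choose (a + 1)) * (z + 1) * ((a + z + 2) * (a + z + 1)) := by gcongr
    _ = P * ((b + z + 1).choose b * (z + 1)) * ((a + z + 2) * (a + z + 1)) := by rw [← h1]; ring
    _ = P * (b + z).choose b * ((b + z + 1) * ((a + z + 2) * (a + z + 1))) := by rw [← h2]; ring

theorem card_filter_le_val_add {n p : ℕ} (hp : p ≤ n) :
    #{x : Fin n | n ≤ x.val + p} = p := by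
  rcases Nat.eq_zero_or_pos p with rfl | hp0
  · simp only [add_zero, card_eq_zero, filter_eq_empty_iff]
    intro x _
    have := x.isLt
    omega
  · have : ({x : Fin n | n ≤ x.val + p} : Finset (Fin n)) = Ici ⟨n - p, by omega⟩ := by
      ext x
      simp only [mem_filter, mem_univ, true_and, mem_Ici, Fin.le_def]
      omega
    rw [this, Fin.card_Ici]
    simp only
    omega

theorem card_mul_card_le_of_sub_double_count {f g h P Q d₁ d₂ N : ℕ} (hf : f ≤ P + h)
    (hg : g + N ≤ Q) (hdc : h * d₁ ≤ N * d₂) (hd : Q * d₂ ≤ P * d₁) (hd₂ : 0 < d₂) :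
    f * g ≤ P * Q := by
  refine le_of_mul_le_mul_right ?_ hd₂
  have h1 : f * g * d₂ ≤ (P + h) * (g * d₂) := by
    rw [mul_assoc]; gcongr
  have h2 : g * d₂ + h * d₁ ≤ Q * d₂ := by nlinarith
  have h3 : g ≤ Q := by omega
  have h4 : h * (g * d₂) ≤ h * (P * d₁) := by
    exact Nat.mul_le_mul_left h ((Nat.mul_le_mul_right _ h3).trans hd)
  have h5 : P * (g * d₂ + h * d₁) ≤ P * (Q * d₂) := by gcongr
  nlinarith

theorem card_mul_card_le_of_colex_upper {n a b : ℕ} (ha : 1 ≤ a) (hb : 1 ≤ b) (ha8 : 8 * a ≤ n)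
    (hb8 : 8 * b ≤ n) {F G : Finset (Finset (Fin n))} (hF : ∀ e ∈ F, #e = a)
    (hG : ∀ e ∈ G, #e = b) (hcross : ∀ e ∈ F, ∀ e' ∈ G, ¬ Disjoint e e')
    (hup : ∀ A ∈ F, ∀ A' : Finset (Fin n), #A' = a →
        (∃ y ∈ A', y ∉ A ∧ ∀ x ∈ A, x ∉ A' → x < y) → A' ∈ F)
    (hbig : (n - 1).choose (a - 1) < #F) :
    #F * #G ≤ (n - 1).choose (a - 1) * (n - 1).choose (b - 1) := by
  classical
  set T : ℕ → Finset (Fin n) := fun p => {x : Fin n | n ≤ x.val + p} with hT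
  have hmemT : ∀ p x, x ∈ T p ↔ n ≤ x.val + p := fun p x => by simp [hT]
  have hT1 : ∃ A ∈ F, Disjoint A (T 1) := by
    by_contra! hcon
    have := card_le_mul_choose_of_forall_not_disjoint ha hF (T 1) hcon
    rw [card_filter_le_val_add (by omega)] at this
    omega
  set P : ℕ → Prop := fun p => ∃ A ∈ F, Disjoint A (T p) with hP
  set p := Nat.findGreatest P n with hp
  have hp1 : 1 ≤ p := Nat.le_findGreatest (P := P) (by omega) hT1
  obtain ⟨A₀, hA₀, hdis₀⟩ : P p := Nat.findGreatest_spec (P := P) (show 1 ≤ n by omega) hT1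
  have hpn : p < n := by
    refine lt_of_le_of_ne (Nat.findGreatest_le n) fun h => ?_
    obtain ⟨x, hx⟩ := card_pos.1 (show 0 < #A₀ by rw [hF A₀ hA₀]; omega)
    exact disjoint_left.1 hdis₀ hx ((hmemT p x).2 (by omega))
  have hTcard : ∀ q, q ≤ n → #(T q) = q := fun q hq => card_filter_le_val_add hq
  have hnext : ∀ A ∈ F, ¬ Disjoint A (T (p + 1)) := fun A hA hdis =>
    absurd (Nat.le_findGreatest (P := P) (show p + 1 ≤ n by omega) ⟨A, hA, hdis⟩) (by omega)
  have hFle : #F ≤ (p + 1) * (n - 1).choose (a - 1) := by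
    have := card_le_mul_choose_of_forall_not_disjoint ha hF (T (p + 1)) hnext
    rwa [hTcard (p + 1) (by omega)] at this
  have hhit : ∀ y ∈ T p, ∀ A : Finset (Fin n), #A = a → y ∈ A → A ∈ F := by
    intro y hy A hA hyA
    refine hup A₀ hA₀ A hA ⟨y, hyA, fun h => disjoint_left.1 hdis₀ h hy, fun x hx _ => ?_⟩
    have h1 : ¬ x ∈ T p := disjoint_left.1 hdis₀ hx
    rw [hmemT] at h1 hy
    rw [Fin.lt_def]; omega
  have hGT : ∀ B ∈ G, T p ⊆ B := by
    intro B hB y hy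
    by_contra hyB
    obtain ⟨A, hyA, hA, hdis⟩ := exists_card_eq_subset_disjoint (a := a) {y} B (by simpa using hyB)
      (by simpa using ha) (by rw [hG B hB]; omega)
    exact hcross A (hhit y hy A hA (hyA (mem_singleton_self y))) B hB hdis
  rcases G.eq_empty_or_nonempty with rfl | ⟨B₀, hB₀⟩
  · simp
  have hpb : p ≤ b := by
    have := card_le_card (hGT B₀ hB₀)
    rwa [hTcard p hpn.le, hG B₀ hB₀] at this
  have hGle : #G ≤ (n - p).choose (b - p) := by
    have := card_le_choose_of_forall_subset hG (T p) hGT (by rw [hTcard p hpn.le]; exact hpb)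
    rwa [hTcard p hpn.le] at this
  rcases Nat.lt_or_ge 1 p with hp2 | hp2
  · obtain ⟨q, hq⟩ := Nat.exists_eq_add_of_le' hp1
    have h1 := eight_pow_mul_choose_le (p := q) hb8 (by omega)
    have h2 := succ_succ_le_eight_pow (p := q) (by omega)
    rw [hq] at hFle hGle
    calc #F * #G ≤ ((q + 1 + 1) * (n - 1).choose (a - 1)) * (n - (q + 1)).choose (b - (q + 1)) := by
          gcongr
      _ = (n - 1).choose (a - 1) * ((q + 2) * (n - (q + 1)).choose (b - (q + 1))) := by ring
      _ ≤ (n - 1).choose (a - 1) * (8 ^ q * (n - (q + 1)).choose (b - (q + 1))) := by gcongr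
      _ ≤ _ := by gcongr
  have hpeq : p = 1 := le_antisymm hp2 hp1
  set x₁ : Fin n := ⟨n - 1, by omega⟩ with hx₁
  set x₂ : Fin n := ⟨n - 2, by omega⟩ with hx₂
  set x₃ : Fin n := ⟨n - 3, by omega⟩ with hx₃
  have h12 : x₁ ≠ x₂ := by simp [hx₁, hx₂, Fin.ext_iff]; omega
  have h13 : x₁ ≠ x₃ := by simp [hx₁, hx₃, Fin.ext_iff]; omega
  have h23 : x₂ ≠ x₃ := by simp [hx₂, hx₃, Fin.ext_iff]; omega
  have hG1 : ∀ B ∈ G, x₁ ∈ B := fun B hB => hGT B hB ((hmemT p x₁).2 (by simp [hx₁]; omega))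
  have hF12 : ∀ A ∈ F, x₁ ∉ A → x₂ ∈ A := by
    intro A hA h1
    obtain ⟨x, hx, hxT⟩ := not_disjoint_iff.1 (hnext A hA)
    rw [hmemT, hpeq] at hxT
    by_contra h2
    have e1 : x ≠ x₁ := fun h => h1 (h ▸ hx)
    have e2 : x ≠ x₂ := fun h => h2 (h ▸ hx)
    have := x.isLt
    simp only [hx₁, hx₂, ne_eq, Fin.ext_iff] at e1 e2
    omega
  by_cases hc : ∃ A ∈ F, x₁ ∉ A ∧ x₃ ∉ A
  · obtain ⟨A, hA, hA1, hA3⟩ := hc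
    have hA2 := hF12 A hA hA1
    have hG23 : ∀ B ∈ G, x₂ ∈ B ∨ x₃ ∈ B := by
      intro B hB
      by_contra! hcon
      rcases ha.eq_or_lt with ha1 | ha2
      · have hA' : A = {x₂} := by
          refine (eq_of_subset_of_card_le (singleton_subset_iff.2 hA2) ?_).symm
          rw [hF A hA, card_singleton, ← ha1]
        exact hcross A hA B hB (by rw [hA']; simpa using hcon.1)
      · obtain ⟨A', h1, h2, h3⟩ := exists_card_eq_subset_disjoint (a := a) {x₂, x₃} B
          (by simpa using hcon) (by rw [card_pair h23]; omega) (by rw [hG B hB]; omega)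
        simp only [insert_subset_iff, singleton_subset_iff] at h1
        refine hcross A' (hup A hA A' h2 ⟨x₃, h1.2, hA3, fun x hx hx' => ?_⟩) B hB h3
        have e1 : x ≠ x₁ := fun h => hA1 (h ▸ hx)
        have e2 : x ≠ x₂ := fun h => hx' (h ▸ h1.1)
        have e3 : x ≠ x₃ := fun h => hx' (h ▸ h1.2)
        have := x.isLt
        simp only [hx₁, hx₂, hx₃, ne_eq, Fin.ext_iff] at e1 e2 e3
        rw [hx₃, Fin.lt_def]
        simp only
        omega
    have hb2 : 2 ≤ b := by
      rw [← hG B₀ hB₀]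
      have h1 := hG1 B₀ hB₀
      rcases hG23 B₀ hB₀ with h | h
      · exact one_lt_card.2 ⟨_, h1, _, h, h12⟩
      · exact one_lt_card.2 ⟨_, h1, _, h, h13⟩
    have hpair : ∀ y, x₁ ≠ y → #{B ∈ G | y ∈ B} ≤ (n - 2).choose (b - 2) := by
      intro y hy
      have := card_le_choose_of_forall_subset (F := {B ∈ G | y ∈ B})
        (fun e he => hG e (mem_filter.1 he).1) {x₁, y} (fun e he => by
          rw [insert_subset_iff, singleton_subset_iff]
          exact ⟨hG1 e (mem_filter.1 he).1, (mem_filter.1 he).2⟩) (by rw [card_pair hy]; exact hb2)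
      rwa [card_pair hy] at this
    have hG2 : #G ≤ 2 * (n - 2).choose (b - 2) := by
      have hsub : G ⊆ {B ∈ G | x₂ ∈ B} ∪ {B ∈ G | x₃ ∈ B} := by
        intro B hB
        rw [mem_union, mem_filter, mem_filter]
        exact (hG23 B hB).imp (fun h => ⟨hB, h⟩) fun h => ⟨hB, h⟩
      have := (card_le_card hsub).trans (card_union_le _ _)
      have := hpair x₂ h12
      have := hpair x₃ h13
      omega
    have h8 := eight_pow_mul_choose_le (p := 1) hb8 (by omega)
    rw [hpeq] at hFle
    norm_num at h8
    calc #F * #G ≤ ((1 + 1) * (n - 1).choose (a - 1)) * (2 * (n - 2).choose (b - 2)) := by gcongr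
      _ ≤ (n - 1).choose (a - 1) * (8 * (n - 2).choose (b - 2)) := by nlinarith
      _ ≤ _ := by gcongr
  · push Not at hc
    set H := {A ∈ F | x₁ ∉ A} with hH
    have hHmem : ∀ A ∈ H, A ∈ F ∧ x₁ ∉ A ∧ x₂ ∈ A ∧ x₃ ∈ A := by
      intro A hA
      obtain ⟨h1, h2⟩ := mem_filter.1 hA
      exact ⟨h1, h2, hF12 A h1 h2, hc A h1 h2⟩
    have hFH : #F ≤ (n - 1).choose (a - 1) + #H := by
      have h1 : #{A ∈ F | x₁ ∈ A} + #H = #F := card_filter_add_card_filter_not _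
      have h2 := card_le_choose_of_forall_subset (F := {A ∈ F | x₁ ∈ A})
        (fun e he => hF e (mem_filter.1 he).1) {x₁}
        (fun e he => singleton_subset_iff.2 (mem_filter.1 he).2) (by simpa using ha)
      rw [card_singleton] at h2
      omega
    have ha2 : 2 ≤ a := by
      obtain ⟨A, hA⟩ := card_pos.1 (show 0 < #H by omega)
      obtain ⟨h1, -, h2, h3⟩ := hHmem A hA
      rw [← hF A h1]
      exact one_lt_card.2 ⟨_, h2, _, h3, h23⟩
    set U := {B ∈ powersetCard b (univ : Finset (Fin n)) | x₁ ∈ B} with hU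
    have hUcard : #U = (n - 1).choose (b - 1) := by
      rw [hU, card_filter_mem_powersetCard _ hb (mem_univ _), card_univ, Fintype.card_fin]
    set N := {B ∈ U | B ∉ G ∧ x₂ ∉ B ∧ x₃ ∉ B} with hN
    have hGN : #G + #N ≤ (n - 1).choose (b - 1) := by
      rw [← hUcard, ← card_union_of_disjoint]
      · refine card_le_card (union_subset (fun B hB => ?_) (filter_subset _ _))
        exact mem_filter.2 ⟨mem_powersetCard.2 ⟨subset_univ _, hG B hB⟩, hG1 B hB⟩
      · exact disjoint_left.2 fun B hB hB' => (mem_filter.1 hB').2.1 hB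
    have hdc : #H * (n - 1 - a).choose (b - 1) ≤ #N * (n - 2 - b).choose (a - 2) := by
      refine card_mul_le_card_mul (fun A B : Finset (Fin n) => Disjoint A B) ?_ ?_
      · intro A hA
        obtain ⟨hAF, hA1, hA2, hA3⟩ := hHmem A hA
        have hcard := card_filter_powersetCard_subset {x₁} Aᶜ b (by simpa using hA1)
          (by simpa using hb)
        rw [card_compl, Fintype.card_fin, hF A hAF, card_singleton,
          show n - a - 1 = n - 1 - a by omega] at hcard
        rw [← hcard]
        refine card_le_card fun B hB => ?_
        rw [mem_filter, mem_powersetCard, singleton_subset_iff] at hB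
        obtain ⟨⟨hBA, hBb⟩, hB1⟩ := hB
        have hdis : Disjoint A B := disjoint_left.2 fun x hx hxB => mem_compl.1 (hBA hxB) hx
        rw [mem_bipartiteAbove, hN, mem_filter, hU, mem_filter, mem_powersetCard]
        exact ⟨⟨⟨⟨subset_univ _, hBb⟩, hB1⟩, fun hBG => hcross A hAF B hBG hdis,
          disjoint_left.1 hdis hA2, disjoint_left.1 hdis hA3⟩, hdis⟩
      · intro B hB
        rw [hN, mem_filter, hU, mem_filter, mem_powersetCard] at hB
        obtain ⟨⟨⟨-, hBb⟩, hB1⟩, -, hB2, hB3⟩ := hB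
        have hcard := card_filter_powersetCard_subset {x₂, x₃} Bᶜ a
          (by simp [insert_subset_iff, hB2, hB3]) (by rw [card_pair h23]; exact ha2)
        rw [card_compl, Fintype.card_fin, hBb, card_pair h23,
          show n - b - 2 = n - 2 - b by omega] at hcard
        rw [← hcard]
        refine card_le_card fun A hA => ?_
        rw [mem_bipartiteBelow] at hA
        obtain ⟨hAF, hA1, hA2, hA3⟩ := hHmem A hA.1
        rw [mem_filter, mem_powersetCard, insert_subset_iff, singleton_subset_iff]
        exact ⟨⟨fun x hx => mem_compl.2 (disjoint_left.1 hA.2 hx), hF A hAF⟩, hA2, hA3⟩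
    exact card_mul_card_le_of_sub_double_count hFH hGN hdc
      (choose_mul_choose_le_of_double_count hb ha8 hb8 ha2) (Nat.choose_pos (by omega))

theorem exists_disjoint_of_choose_lt_card {n a b : ℕ} (ha : 1 ≤ a) (hb : 1 ≤ b)
    (ha8 : 8 * a ≤ n) (hb8 : 8 * b ≤ n) {F G : Finset (Finset (Fin n))} (hF : ∀ e ∈ F, #e = a)
    (hG : ∀ e ∈ G, #e = b) (hbig : (n - 1).choose (a - 1) < #F)
    (h : (n - 1).choose (a - 1) * (n - 1).choose (b - 1) < #F * #G) :
    ∃ e ∈ F, ∃ e' ∈ G, Disjoint e e' := by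
  by_contra! hcross
  obtain ⟨F', G', hF', hG', hFa, hGb, hc, hup⟩ :=
    exists_colex_upper_cross_intersecting (by omega) hF hG hcross
  have := card_mul_card_le_of_colex_upper ha hb ha8 hb8 hFa hGb hc hup (by rwa [hF'])
  rw [hF'] at this
  have h2 : #F * #G ≤ #F * #G' := by gcongr
  omega

/-- The product version of the Erdős–Ko–Rado theorem for two cross-intersecting uniform families of
small uniformities. -/
theorem exists_disjoint_of_choose_mul_choose_lt {n a b : ℕ} (ha : 1 ≤ a) (hb : 1 ≤ b)
    (ha8 : 8 * a ≤ n) (hb8 : 8 * b ≤ n) {F G : Finset (Finset (Fin n))} (hF : ∀ e ∈ F, #e = a)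
    (hG : ∀ e ∈ G, #e = b)
    (h : (n - 1).choose (a - 1) * (n - 1).choose (b - 1) < #F * #G) :
    ∃ e ∈ F, ∃ e' ∈ G, Disjoint e e' := by
  by_cases hbig : (n - 1).choose (a - 1) < #F
  · exact exists_disjoint_of_choose_lt_card ha hb ha8 hb8 hF hG hbig h
  · have hbig' : (n - 1).choose (b - 1) < #G := by
      by_contra hcon
      exact absurd (Nat.mul_le_mul (not_lt.1 hbig) (not_lt.1 hcon)) (not_le.2 h)
    obtain ⟨e, he, e', he', hd⟩ := exists_disjoint_of_choose_lt_card hb ha hb8 ha8 hG hF hbig'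
      (by rwa [mul_comm, mul_comm (#G)])
    exact ⟨e', he', e, he, hd.symm⟩

end CrossIntersecting

section SumSq

variable {ι : Type*}

theorem sum_add_sq_le_add_sq (S : Finset ι) (x y : ι → ℝ) {A B : ℝ} (hA : 0 ≤ A) (hB : 0 ≤ B)
    (hx : ∑ i ∈ S, x i ^ 2 ≤ A ^ 2) (hy : ∑ i ∈ S, y i ^ 2 ≤ B ^ 2) :
    ∑ i ∈ S, (x i + y i) ^ 2 ≤ (A + B) ^ 2 := by
  have h1 : ∑ i ∈ S, x i * y i ≤ A * B := by
    refine (sum_mul_le_sqrt_mul_sqrt S x y).trans ?_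
    have h1 : √(∑ i ∈ S, x i ^ 2) ≤ A := Real.sqrt_le_iff.2 ⟨hA, hx⟩
    have h2 : √(∑ i ∈ S, y i ^ 2) ≤ B := Real.sqrt_le_iff.2 ⟨hB, hy⟩
    gcongr
  have h2 : ∑ i ∈ S, (x i + y i) ^ 2 =
      ∑ i ∈ S, x i ^ 2 + 2 * ∑ i ∈ S, x i * y i + ∑ i ∈ S, y i ^ 2 := by
    rw [mul_sum, ← sum_add_distrib, ← sum_add_distrib]
    exact sum_congr rfl fun i _ => by ring
  rw [h2]
  nlinarith

theorem sum_abs_le_sqrt_card (S : Finset ι) (x : ι → ℝ) (hx : ∑ i ∈ S, x i ^ 2 ≤ 1) :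
    ∑ i ∈ S, |x i| ≤ √(#S) := by
  have := sum_mul_le_sqrt_mul_sqrt S (fun _ => (1 : ℝ)) (fun i => |x i|)
  simp only [one_mul, one_pow, sum_const, nsmul_eq_mul, mul_one, sq_abs] at this
  refine this.trans (mul_le_of_le_one_right (Real.sqrt_nonneg _) ?_)
  exact Real.sqrt_le_iff.2 ⟨zero_le_one, by simpa using hx⟩

theorem sum_mul_one_sub_div_sq_le (S : Finset ι) (f g : ι → ℝ) (hf : ∀ i ∈ S, 0 < f i)
    (hf1 : ∀ i ∈ S, f i ≤ 1) (hdev : ∑ i ∈ S, ((g i - f i) / f i) ^ 2 ≤ 1) :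
    ∑ i ∈ S, 1 / f i ^ 2 * (g i * (1 - g i)) ≤ 2 * (∑ i ∈ S, (1 - f i) / f i + √(#S)) := by
  have h1 := sum_abs_le_sqrt_card S _ hdev
  calc ∑ i ∈ S, 1 / f i ^ 2 * (g i * (1 - g i))
      ≤ ∑ i ∈ S, 2 * ((1 - f i) / f i + |(g i - f i) / f i|) := by
        refine sum_le_sum fun i hi => ?_
        have hfi := hf i hi
        have hsingle : ((g i - f i) / f i) ^ 2 ≤ 1 :=
          (single_le_sum (f := fun i => ((g i - f i) / f i) ^ 2) (fun i _ => sq_nonneg _)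
            hi).trans hdev
        have habs : |(g i - f i) / f i| ≤ 1 := abs_le_one_iff_mul_self_le_one.2 (by
          rwa [← sq])
        set ξ := (g i - f i) / f i with hξ
        have hg : g i = f i * (1 + ξ) := by rw [hξ]; field_simp; ring
        have h2 : 1 / f i ^ 2 * (g i * (1 - g i)) = (1 + ξ) * ((1 - f i) / f i - ξ) := by
          rw [hg]; field_simp; ring
        rw [h2]
        have h3 : 0 ≤ (1 - f i) / f i := div_nonneg (by linarith [hf1 i hi]) hfi.le
        have h4 := neg_abs_le ξ
        have h5 := le_abs_self ξ
        calc (1 + ξ) * ((1 - f i) / f i - ξ) ≤ (1 + ξ) * ((1 - f i) / f i + |ξ|) := by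
              refine mul_le_mul_of_nonneg_left ?_ ?_ <;> linarith
          _ ≤ 2 * ((1 - f i) / f i + |ξ|) := by
              refine mul_le_mul_of_nonneg_right ?_ ?_
              · linarith
              · positivity
    _ = 2 * (∑ i ∈ S, (1 - f i) / f i + ∑ i ∈ S, |(g i - f i) / f i|) := by
        rw [← mul_sum, sum_add_distrib]
    _ ≤ _ := by gcongr

end SumSq

section Rainbow

variable {ι α : Type*}

/-- The families `F i`, `i ∈ I`, have pairwise disjoint representatives inside `Y`. -/
def HasRainbow (F : ι → Finset (Finset α)) (I : Finset ι) (Y : Finset α) : Prop :=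
  ∃ e : ι → Finset α, (∀ i ∈ I, e i ∈ F i ∧ e i ⊆ Y) ∧
    ∀ i ∈ I, ∀ j ∈ I, i ≠ j → Disjoint (e i) (e j)

variable [DecidableEq α]

/-- Picking a member of one family moves the densities of the others, relatively to reference
values `f`, by a controlled `ℓ²` amount. -/
theorem exists_mem_sum_relative_change_sq_le {F : ι → Finset (Finset α)} {k : ι → ℕ}
    (S : Finset ι) (f : ι → ℝ) (hf : ∀ i ∈ S, 0 < f i) (hf1 : ∀ i ∈ S, f i ≤ 1)
    (hk : ∀ i ∈ S, 1 ≤ k i) {j : ι} {M : ℕ} (hM : 0 < M) {q γ : ℝ} (hq : 0 ≤ q)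
    (hkq : ∀ i ∈ S, (k j * k i : ℝ) / (M : ℝ) ^ 2 ≤ q) {Y : Finset α}
    (hY : ∀ i ∈ S, M + k j + k i ≤ #Y)
    (hdev : ∑ i ∈ S, ((density (k i) (F i) Y - f i) / f i) ^ 2 ≤ 1) (hγ : 0 < γ)
    (hj : γ ≤ density (k j) (F j) Y) :
    ∃ e ∈ F j, e ⊆ Y ∧ #e = k j ∧
      γ * ∑ i ∈ S, ((density (k i) (F i) (Y \ e) - density (k i) (F i) Y) / f i) ^ 2 ≤
        2 * q * (∑ i ∈ S, (1 - f i) / f i + √(#S)) := by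
  obtain ⟨e, he, heY, hek, hle⟩ := exists_mem_sum_density_sdiff_sub_sq_le S k F
    (fun i => 1 / f i ^ 2) (fun i _ => by positivity) hk hM hY (hγ.trans_le hj)
  refine ⟨e, he, heY, hek, ?_⟩
  have h1 : ∑ i ∈ S, ((density (k i) (F i) (Y \ e) - density (k i) (F i) Y) / f i) ^ 2 =
      ∑ i ∈ S, 1 / f i ^ 2 * (density (k i) (F i) (Y \ e) - density (k i) (F i) Y) ^ 2 :=
    sum_congr rfl fun i _ => by rw [div_pow]; ring
  have h2 := sum_mul_one_sub_div_sq_le S f (fun i => density (k i) (F i) Y) hf hf1 hdev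
  calc γ * ∑ i ∈ S, ((density (k i) (F i) (Y \ e) - density (k i) (F i) Y) / f i) ^ 2
      ≤ density (k j) (F j) Y *
        ∑ i ∈ S, ((density (k i) (F i) (Y \ e) - density (k i) (F i) Y) / f i) ^ 2 :=
        mul_le_mul_of_nonneg_right hj (sum_nonneg fun i _ => sq_nonneg _)
    _ ≤ ∑ i ∈ S, 1 / f i ^ 2 * (k j * k i / (M : ℝ) ^ 2 *
        (density (k i) (F i) Y * (1 - density (k i) (F i) Y))) := by rw [h1]; exact hle
    _ ≤ ∑ i ∈ S, q * (1 / f i ^ 2 * (density (k i) (F i) Y * (1 - density (k i) (F i) Y))) := by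
        refine sum_le_sum fun i hi => ?_
        rw [mul_left_comm]
        exact mul_le_mul_of_nonneg_right (hkq i hi)
          (mul_nonneg (by positivity) (density_mul_one_sub_nonneg _ _ _))
    _ ≤ q * (2 * (∑ i ∈ S, (1 - f i) / f i + √(#S))) := by
        rw [← mul_sum]
        exact mul_le_mul_of_nonneg_left h2 hq
    _ = _ := by ring

variable [DecidableEq ι]

theorem HasRainbow.insert {F : ι → Finset (Finset α)} {I : Finset ι} {Y e : Finset α} {j : ι}
    (h : HasRainbow F I (Y \ e)) (hj : j ∉ I) (he : e ∈ F j) (heY : e ⊆ Y) :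
    HasRainbow F (insert j I) Y := by
  obtain ⟨e', he', hd⟩ := h
  have hne : ∀ i ∈ I, i ≠ j := fun i hi hij => hj (hij ▸ hi)
  have hdis : ∀ i ∈ I, Disjoint (e' i) e := fun i hi =>
    disjoint_of_subset_left (he' i hi).2 sdiff_disjoint
  refine ⟨Function.update e' j e, ?_, ?_⟩
  · intro i hi
    rcases mem_insert.1 hi with rfl | hi
    · simpa using ⟨he, heY⟩
    · rw [Function.update_of_ne (hne i hi)]
      exact ⟨(he' i hi).1, (he' i hi).2.trans sdiff_subset⟩
  · intro i hi l hl hil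
    rcases mem_insert.1 hi with hij | hiI <;> rcases mem_insert.1 hl with hlj | hlI
    · exact absurd (hij.trans hlj.symm) hil
    · rw [hij, Function.update_self, Function.update_of_ne (hne l hlI)]
      exact (hdis l hlI).symm
    · rw [hlj, Function.update_self, Function.update_of_ne (hne i hiI)]
      exact hdis i hiI
    · rw [Function.update_of_ne (hne i hiI), Function.update_of_ne (hne l hlI)]
      exact hd i hiI l hlI hil

theorem hasRainbow_of_blocks {F : ι → Finset (Finset α)} {I : Finset ι} {Y : Finset α}
    {k : ι → ℕ} {L : ℕ} (B : Fin L → Finset α) (hBY : ∀ l, B l ⊆ Y)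
    (hB : Pairwise fun l l' => Disjoint (B l) (B l'))
    (hI : ∀ i ∈ I, #I ≤ #{l | 0 < density (k i) (F i) (B l)}) : HasRainbow F I Y := by
  obtain ⟨σ, hσ, hmem⟩ := (all_card_le_biUnion_card_iff_exists_injective
      (fun i : I => ({l | 0 < density (k i) (F i) (B l)} : Finset (Fin L)))).1 (by
    intro s
    rcases s.eq_empty_or_nonempty with rfl | ⟨i, hi⟩
    · simp
    · calc #s ≤ #I := by simpa using card_le_univ s
        _ ≤ _ := hI i i.2
        _ ≤ _ := card_le_card (subset_biUnion_of_mem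
          (fun i : I => ({l | 0 < density (k i) (F i) (B l)} : Finset (Fin L))) hi))
  have hex : ∀ i : I, ∃ e ∈ F i, e ⊆ B (σ i) := fun i => by
    obtain ⟨e, h1, h2, -⟩ := exists_mem_of_density_pos (mem_filter.1 (hmem i)).2
    exact ⟨e, h1, h2⟩
  choose e he heB using hex
  refine ⟨fun i => if h : i ∈ I then e ⟨i, h⟩ else ∅, ?_, ?_⟩
  · intro i hi
    simp only [hi, dif_pos]
    exact ⟨he _, (heB _).trans (hBY _)⟩
  · intro i hi j hj hij
    simp only [hi, hj, dif_pos]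
    refine disjoint_of_subset_left (heB _) (disjoint_of_subset_right (heB _) (hB fun h => hij ?_))
    simpa using hσ h

theorem hasRainbow_of_density_gt {F : ι → Finset (Finset α)} {I : Finset ι} {Y : Finset α}
    {k : ι → ℕ} {K L : ℕ} (hk : ∀ i ∈ I, 1 ≤ k i) (hkK : ∀ i ∈ I, k i ≤ K) (hL : 0 < L)
    (hK : 0 < K) (hY : (2 * L + 1) * K ≤ #Y) {Δ : ℝ} (hΔ : 0 ≤ Δ)
    (hvar : 4 * L * ∑ i ∈ I, density (k i) (F i) Y * (1 - density (k i) (F i) Y) ≤ Δ ^ 2)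
    (hI : ∀ i ∈ I, (#I : ℝ) - 1 < L * density (k i) (F i) Y - Δ) : HasRainbow F I Y := by
  obtain ⟨B, hBY, hB, hsum⟩ := exists_blocks_sum_sq_le I k F hk hkK (Nat.mul_pos hL hK) L le_rfl Y
    (by linarith) (fun i => -(L * density (k i) (F i) Y))
  refine hasRainbow_of_blocks B hBY hB (k := k) fun i hi => ?_
  have h1 : (∑ l, density (k i) (F i) (B l) + -(L * density (k i) (F i) Y)) ^ 2 ≤ Δ ^ 2 := by
    refine (single_le_sum (f := fun i =>
      (∑ l, density (k i) (F i) (B l) + -(L * density (k i) (F i) Y)) ^ 2)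
      (fun i _ => sq_nonneg _) hi).trans (hsum.trans (le_trans (le_of_eq ?_) hvar))
    rw [mul_sum]
    refine sum_congr rfl fun i _ => ?_
    ring
  have h2 := (abs_le_of_sq_le_sq' h1 hΔ).1
  have h3 : ∑ l, density (k i) (F i) (B l) ≤ #{l | 0 < density (k i) (F i) (B l)} := by
    rw [← sum_boole]
    refine sum_le_sum fun l _ => ?_
    split_ifs with h
    · exact density_le_one _ _ _
    · exact not_lt.1 h
  have h4 : (#I : ℝ) < #{l | 0 < density (k i) (F i) (B l)} + 1 := by linarith [hI i hi]
  have h5 : #I < #{l | 0 < density (k i) (F i) (B l)} + 1 := by exact_mod_cast h4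
  omega

/-- Picking members of all the families indexed by `H` one after the other while keeping the
densities of the families indexed by `T` under control. -/
theorem exists_hasRainbow_extension {F : ι → Finset (Finset α)} {k : ι → ℕ} {K M : ℕ}
    (f b : ι → ℝ) {A τ q γ W s : ℝ} (hA : 0 ≤ A) (hτ : 0 ≤ τ) (hq : 0 ≤ q) (hγ : 0 < γ)
    (hM : 0 < M) (hτW : 2 * q * (W + √s) ≤ γ * τ ^ 2) (T : Finset ι) (H : Finset ι)
    (hHT : Disjoint H T) (hf : ∀ i ∈ H ∪ T, 0 < f i) (hf1 : ∀ i ∈ H ∪ T, f i ≤ 1)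
    (hk : ∀ i ∈ H ∪ T, 1 ≤ k i) (hkK : ∀ i ∈ H ∪ T, k i ≤ K)
    (hkq : ∀ j ∈ H, ∀ i ∈ H ∪ T, i ≠ j → (k j * k i : ℝ) / (M : ℝ) ^ 2 ≤ q)
    (hW : ∑ i ∈ H ∪ T, (1 - f i) / f i ≤ W) (hs : (#(H ∪ T) : ℝ) ≤ s)
    (hγf : ∀ j ∈ H, γ ≤ 0.08 * f j)
    (hb : ∑ i ∈ H ∪ T, ((b i - f i) / f i) ^ 2 ≤ A ^ 2) (Y : Finset α) {B : ℝ} (hB : 0 ≤ B)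
    (hY : M + 2 * K + #H * K ≤ #Y)
    (hdev : ∑ i ∈ H ∪ T, ((density (k i) (F i) Y - b i) / f i) ^ 2 ≤ B ^ 2)
    (hAB : A + B + #H * τ ≤ 0.92) :
    ∃ Y' ⊆ Y, #Y ≤ #Y' + #H * K ∧ (HasRainbow F T Y' → HasRainbow F (H ∪ T) Y) ∧
      ∑ i ∈ T, ((density (k i) (F i) Y' - b i) / f i) ^ 2 ≤ (B + #H * τ) ^ 2 := by
  induction H using Finset.induction_on generalizing Y B with
  | empty => exact ⟨Y, Subset.rfl, by simp, by simp, by simpa using hdev⟩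
  | insert j H hjH ih =>
    rw [card_insert_of_notMem hjH] at hY hAB
    push_cast at hAB
    have hjT : j ∉ T := disjoint_left.1 hHT (mem_insert_self j H)
    have hjHT : j ∉ H ∪ T := by simp [hjH, hjT]
    have hins : insert j H ∪ T = insert j (H ∪ T) := insert_union j H T
    have hsub : H ∪ T ⊆ insert j H ∪ T := by rw [hins]; exact subset_insert _ _
    have hjmem : j ∈ insert j H ∪ T := mem_union_left _ (mem_insert_self j H)
    have hne : ∀ i ∈ H ∪ T, i ≠ j := fun i hi h => hjHT (h ▸ hi)
    have hHτ : 0 ≤ #H * τ := by positivity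
    have hdevf : ∑ i ∈ insert j H ∪ T, ((density (k i) (F i) Y - f i) / f i) ^ 2 ≤
        (B + A) ^ 2 := by
      refine le_trans (le_of_eq ?_) (sum_add_sq_le_add_sq _ _ _ hB hA hdev hb)
      exact sum_congr rfl fun i _ => by ring
    have hjdens : γ ≤ density (k j) (F j) Y := by
      have h1 : ((density (k j) (F j) Y - f j) / f j) ^ 2 ≤ (B + A) ^ 2 :=
        (single_le_sum (f := fun i => ((density (k i) (F i) Y - f i) / f i) ^ 2)
          (fun i _ => sq_nonneg _) hjmem).trans hdevf
      have h2 := (abs_le_of_sq_le_sq' h1 (by linarith)).1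
      have hfj := hf j hjmem
      rw [le_div_iff₀ hfj] at h2
      have h3 := hγf j (mem_insert_self j H)
      have h4 : (B + A) * f j ≤ 0.92 * f j := by
        refine mul_le_mul_of_nonneg_right ?_ hfj.le
        linarith
      linarith
    have hWnn : ∀ i ∈ insert j H ∪ T, 0 ≤ (1 - f i) / f i := fun i hi =>
      div_nonneg (by linarith [hf1 i hi]) (hf i hi).le
    have hW' : ∑ i ∈ H ∪ T, (1 - f i) / f i ≤ W :=
      (sum_le_sum_of_subset_of_nonneg hsub fun i hi _ => hWnn i hi).trans hW
    have hs' : (#(H ∪ T) : ℝ) ≤ s := le_trans (by exact_mod_cast card_le_card hsub) hs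
    obtain ⟨e, he, heY, hek, hle⟩ := exists_mem_sum_relative_change_sq_le (F := F) (k := k) (j := j)
      (Y := Y) (H ∪ T) f
      (fun i hi => hf i (hsub hi)) (fun i hi => hf1 i (hsub hi)) (fun i hi => hk i (hsub hi)) hM
      hq (fun i hi => hkq j (mem_insert_self j H) i (hsub hi) (hne i hi))
      (fun i hi => by
        have := hkK i (hsub hi)
        have := hkK j hjmem
        nlinarith)
      (by
        refine (sum_le_sum_of_subset_of_nonneg hsub fun i _ _ => sq_nonneg _).trans
          (hdevf.trans ?_)
        exact pow_le_one₀ (by linarith) (by linarith)) hγ hjdens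
    have hstep : ∑ i ∈ H ∪ T, ((density (k i) (F i) (Y \ e) - density (k i) (F i) Y) / f i) ^ 2 ≤
        τ ^ 2 := by
      refine le_of_mul_le_mul_left (hle.trans (le_trans ?_ hτW)) hγ
      gcongr
    have hdev' : ∑ i ∈ H ∪ T, ((density (k i) (F i) (Y \ e) - b i) / f i) ^ 2 ≤ (B + τ) ^ 2 := by
      refine le_trans (le_of_eq ?_) (sum_add_sq_le_add_sq _ _ _ hB hτ
        ((sum_le_sum_of_subset_of_nonneg hsub fun i _ _ => sq_nonneg _).trans hdev) hstep)
      exact sum_congr rfl fun i _ => by ring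
    have hcard : #(Y \ e) = #Y - k j := by rw [card_sdiff_of_subset heY, hek]
    have hkj := hkK j hjmem
    have hmul : (#H + 1) * K = #H * K + K := by ring
    obtain ⟨Y', hY', hc, hR, hd⟩ := ih
      (disjoint_of_subset_left (subset_insert _ _) hHT) (fun i hi => hf i (hsub hi))
      (fun i hi => hf1 i (hsub hi)) (fun i hi => hk i (hsub hi)) (fun i hi => hkK i (hsub hi))
      (fun j' hj' i hi => hkq j' (mem_insert_of_mem hj') i (hsub hi)) hW' hs'
      (fun j' hj' => hγf j' (mem_insert_of_mem hj'))
      ((sum_le_sum_of_subset_of_nonneg hsub fun i _ _ => sq_nonneg _).trans hb)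
      (Y \ e) (add_nonneg hB hτ) (by omega) hdev' (by linarith)
    refine ⟨Y', hY'.trans sdiff_subset, ?_, ?_, ?_⟩
    · rw [card_insert_of_notMem hjH]
      omega
    · intro h
      rw [hins]
      exact (hR h).insert hjHT he heY
    · rw [card_insert_of_notMem hjH]
      push_cast
      convert hd using 2
      ring

end Rainbow

section Greedy

theorem pow_mul_choose_le_choose {x : ℝ} (hx : 0 ≤ x) {m n k : ℕ} (hmn : m ≤ n)
    (h : n * x + k ≤ m) : x ^ k * n.choose k ≤ m.choose k := by
  suffices ∀ j ≤ k, x ^ j * n.choose j ≤ m.choose j from this k le_rfl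
  intro j hj
  induction j with
  | zero => simp
  | succ j ih =>
    have hkm : k ≤ m := by
      have : (k : ℝ) ≤ m := by nlinarith [mul_nonneg (Nat.cast_nonneg (α := ℝ) n) hx]
      exact_mod_cast this
    have h1 : (n.choose (j + 1) : ℝ) * (j + 1) = n.choose j * (n - j) := by
      have := Nat.choose_succ_right_eq n j
      rw [← Nat.cast_sub (by omega)]
      exact_mod_cast this
    have h2 : (m.choose (j + 1) : ℝ) * (j + 1) = m.choose j * (m - j) := by
      have := Nat.choose_succ_right_eq m j
      rw [← Nat.cast_sub (by omega)]
      exact_mod_cast this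
    have hjk : (j : ℝ) + 1 ≤ k := by exact_mod_cast hj
    have hjn : (j : ℝ) ≤ n := by
      have : j ≤ n := by omega
      exact_mod_cast this
    have h3 : x * (n - j) ≤ m - j := by nlinarith [mul_nonneg hx (Nat.cast_nonneg (α := ℝ) j)]
    refine le_of_mul_le_mul_right ?_ (by positivity : (0 : ℝ) < j + 1)
    calc x ^ (j + 1) * n.choose (j + 1) * (j + 1) = (x ^ j * n.choose j) * (x * (n - j)) := by
          rw [mul_assoc, h1]; ring
      _ ≤ m.choose j * (m - j) := by
          refine mul_le_mul (ih (by omega)) h3 ?_ (by positivity)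
          exact mul_nonneg hx (by linarith)
      _ = _ := h2.symm

theorem exists_mem_subset_of_one_sub_density_lt {n k : ℕ} {F : Finset (Finset (Fin n))} {x : ℝ}
    (hx : 0 ≤ x) {Y : Finset (Fin n)} (hY : n * x + k ≤ #Y)
    (hF : 1 - density k F univ < x ^ k) : ∃ e ∈ F, e ⊆ Y := by
  by_contra! hne
  have h1 := choose_mul_density_eq_card k F univ
  have h2 : #(Y.powersetCard k) + #{e ∈ (univ : Finset (Fin n)).powersetCard k | e ∈ F} ≤
      #((univ : Finset (Fin n)).powersetCard k) := by
    rw [← card_union_of_disjoint]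
    · exact card_le_card (union_subset (powersetCard_mono (subset_univ _)) (filter_subset _ _))
    · rw [disjoint_left]
      intro e he he'
      exact hne e (mem_filter.1 he').2 (mem_powersetCard.1 he).1
  have hYn : #Y ≤ n := by simpa using card_le_univ Y
  have hkn : k ≤ n := by
    have : (k : ℝ) ≤ n := by
      have : (#Y : ℝ) ≤ n := by exact_mod_cast hYn
      nlinarith [mul_nonneg (Nat.cast_nonneg (α := ℝ) n) hx]
    exact_mod_cast this
  rw [card_powersetCard, card_powersetCard, card_univ, Fintype.card_fin] at h2
  rw [card_univ, Fintype.card_fin] at h1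
  have h3 : (((#Y).choose k : ℕ) : ℝ) + n.choose k * density k F univ ≤ n.choose k := by
    rw [h1]
    exact_mod_cast h2
  have h4 := pow_mul_choose_le_choose hx hYn hY
  have h5 : (0 : ℝ) < n.choose k := by exact_mod_cast Nat.choose_pos hkn
  nlinarith

theorem HasRainbow.union_of_one_sub_density_lt {ι : Type*} [DecidableEq ι] {n K : ℕ} {k : ι → ℕ}
    {F : ι → Finset (Finset (Fin n))} (hF : ∀ i, ∀ e ∈ F i, #e = k i) (hkK : ∀ i, k i ≤ K) {x : ℝ}
    (hx : 0 ≤ x) (hx1 : x ≤ 1) {I : Finset ι} (h : HasRainbow F I univ) (J : Finset ι)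
    (hJ : ∀ i ∈ J, 1 - density (k i) (F i) univ < x ^ K)
    (hsum : ∑ i ∈ I ∪ J, (k i : ℝ) ≤ n * (1 - x)) : HasRainbow F (I ∪ J) univ := by
  induction J using Finset.induction_on with
  | empty => simpa using h
  | insert j J hjJ ih =>
    rw [union_insert] at hsum ⊢
    by_cases hj : j ∈ I ∪ J
    · rw [insert_eq_of_mem hj] at hsum ⊢
      exact ih (fun i hi => hJ i (mem_insert_of_mem hi)) hsum
    rw [sum_insert hj] at hsum
    obtain ⟨e, he, hd⟩ := ih (fun i hi => hJ i (mem_insert_of_mem hi))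
      (by linarith [Nat.cast_nonneg (α := ℝ) (k j)])
    have hU : (#((I ∪ J).biUnion e) : ℝ) ≤ ∑ i ∈ I ∪ J, (k i : ℝ) := by
      have : #((I ∪ J).biUnion e) ≤ ∑ i ∈ I ∪ J, k i :=
        card_biUnion_le.trans (sum_le_sum fun i hi => (hF i _ (he i hi).1).le)
      exact_mod_cast this
    obtain ⟨e', he', he'Y⟩ := exists_mem_subset_of_one_sub_density_lt hx
      (Y := ((I ∪ J).biUnion e)ᶜ) (F := F j) (k := k j) (by
        have := card_add_card_compl ((I ∪ J).biUnion e)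
        rw [Fintype.card_fin] at this
        have : (#((I ∪ J).biUnion e) : ℝ) + #((I ∪ J).biUnion e)ᶜ = n := by exact_mod_cast this
        linarith)
      ((hJ j (mem_insert_self j J)).trans_le (pow_le_pow_of_le_one hx hx1 (hkK j)))
    refine HasRainbow.insert ⟨e, fun i hi => ⟨(he i hi).1, ?_⟩, hd⟩ hj he' (subset_univ _)
    rw [← compl_eq_univ_sdiff]
    refine subset_compl_comm.1 (he'Y.trans ?_)
    exact compl_subset_compl.2 (subset_biUnion_of_mem e hi)

theorem choose_mul_density_univ {n k : ℕ} {F : Finset (Finset (Fin n))} (hF : ∀ e ∈ F, #e = k) :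
    (n.choose k : ℝ) * density k F univ = #F := by
  have h := choose_mul_density_eq_card k F univ
  rw [card_univ, Fintype.card_fin] at h
  rw [h]
  congr 2
  ext e
  simp only [mem_filter, mem_powersetCard_univ]
  exact ⟨fun h => h.2, fun h => ⟨hF e h, h⟩⟩

theorem cast_choose_sub_one {n k : ℕ} (hk : 1 ≤ k) (hn : 1 ≤ n) :
    ((n - 1).choose (k - 1) : ℝ) = k / n * n.choose k := by
  obtain ⟨k, rfl⟩ := Nat.exists_eq_add_of_le' hk
  obtain ⟨n, rfl⟩ := Nat.exists_eq_add_of_le' hn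
  have := Nat.add_one_mul_choose_eq n k
  have h : ((n : ℝ) + 1) * n.choose k = (n + 1).choose (k + 1) * (k + 1) := by exact_mod_cast this
  rw [Nat.add_sub_cancel, Nat.add_sub_cancel, div_mul_eq_mul_div, eq_div_iff (by positivity)]
  push_cast
  linarith

theorem exists_disjoint_of_lt_density_mul_density {n a b : ℕ} (ha : 1 ≤ a) (hb : 1 ≤ b)
    (ha8 : 8 * a ≤ n) (hb8 : 8 * b ≤ n) {F G : Finset (Finset (Fin n))} (hF : ∀ e ∈ F, #e = a)
    (hG : ∀ e ∈ G, #e = b)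
    (h : (a * b : ℝ) / n ^ 2 < density a F univ * density b G univ) :
    ∃ e ∈ F, ∃ e' ∈ G, Disjoint e e' := by
  refine exists_disjoint_of_choose_mul_choose_lt ha hb ha8 hb8 hF hG ?_
  have hpos : (0 : ℝ) < n.choose a * n.choose b := by
    exact_mod_cast Nat.mul_pos (Nat.choose_pos (by omega)) (Nat.choose_pos (by omega))
  have : ((n - 1).choose (a - 1) : ℝ) * (n - 1).choose (b - 1) < #F * #G := by
    rw [← choose_mul_density_univ hF, ← choose_mul_density_univ hG,
      cast_choose_sub_one ha (by omega), cast_choose_sub_one hb (by omega)]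
    calc (a / n * n.choose a : ℝ) * (b / n * n.choose b)
        = (a * b : ℝ) / n ^ 2 * (n.choose a * n.choose b) := by ring
      _ < density a F univ * density b G univ * (n.choose a * n.choose b) :=
        mul_lt_mul_of_pos_right h hpos
      _ = _ := by ring
  exact_mod_cast this

end Greedy

section Numerics

theorem one_add_sum_add_le_prod_one_add {ι : Type*} (S : Finset ι) (o : ι → ℝ)
    (ho : ∀ i ∈ S, 0 ≤ o i) :
    1 + ∑ i ∈ S, o i + ((∑ i ∈ S, o i) ^ 2 - ∑ i ∈ S, o i ^ 2) / 2 ≤ ∏ i ∈ S, (1 + o i) := by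
  classical
  induction S using Finset.induction_on with
  | empty => simp
  | insert j S hj ih =>
    have ih := ih fun i hi => ho i (mem_insert_of_mem hi)
    have hoj := ho j (mem_insert_self j S)
    have hS : ∀ i ∈ S, 0 ≤ o i := fun i hi => ho i (mem_insert_of_mem hi)
    have h1 : ∑ i ∈ S, o i ^ 2 ≤ (∑ i ∈ S, o i) ^ 2 := sum_sq_le_sq_sum_of_nonneg hS
    rw [sum_insert hj, sum_insert hj, prod_insert hj]
    have h2 : 1 + ∑ i ∈ S, o i ≤ ∏ i ∈ S, (1 + o i) := by linarith
    nlinarith [mul_le_mul_of_nonneg_left h2 hoj]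

theorem first_pick_bounds {θ f o O P X Y ζ : ℝ} (hθ : 0 < θ) (ho : 0 ≤ o) (hO : 0 ≤ O)
    (hζO : ζ ≤ O / 10) (hζ1 : ζ ≤ 1 / 100) (hY : 0 ≤ Y) (hP1 : 1 + O ≤ P)
    (hP2 : 1 + O + O * (O - o) / 2 ≤ P) (hf : θ ^ 2 * ((1 + o) * P) < f)
    (hXY : f * (X ^ 2 + 5 / 4 * Y) ≤ (1 + ζ) * θ ^ 2 * (o + 5 / 4 * O)) :
    Y ≤ 0.8 ∧ (1 + o * O) / (16 * (1 + o) ^ 2 * (1 + O)) ≤ (1 + X) / (1 + o) := by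
  set S := X ^ 2 + 5 / 4 * Y with hS
  have hS0 : 0 ≤ S := by positivity
  have h1 : (1 + o) * P * S ≤ (1 + ζ) * (o + 5 / 4 * O) := by
    refine le_of_mul_le_mul_left ?_ (pow_pos hθ 2)
    nlinarith [mul_le_mul_of_nonneg_right hf.le hS0]
  have hoO : 0 ≤ o * O := mul_nonneg ho hO
  have h2 : (1 + ζ) * (o + 5 / 4 * O) + (1 + o * O) / 4 ≤ (1 + o) * P := by
    have h3 : (1 + o) * (1 + O) ≤ (1 + o) * P := by gcongr
    have h4 : o * (1 + O) ≤ o * P := by gcongr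
    have h5 : ζ * o ≤ O / 10 * o := by gcongr
    have h6 : ζ * O ≤ 1 / 100 * O := by gcongr
    nlinarith [sq_nonneg (O - 1 / 4)]
  have h3 : (1 + ζ) * (o + 5 / 4 * O) + (1 + o * O) / 4 ≤ 2 * (1 + o) * (1 + O) := by
    have h5 : ζ * o ≤ 1 / 100 * o := by gcongr
    have h6 : ζ * O ≤ 1 / 100 * O := by gcongr
    nlinarith
  set Q := (1 + ζ) * (o + 5 / 4 * O) + (1 + o * O) / 4 with hQ
  have hA : (1 + ζ) * (o + 5 / 4 * O) = Q - (1 + o * O) / 4 := by rw [hQ]; ring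
  have hA0 : 0 ≤ (1 + ζ) * (o + 5 / 4 * O) := le_trans (mul_nonneg (by
    have : 0 ≤ P := by linarith
    positivity) hS0) h1
  have hQ0 : 0 < Q := by rw [hQ]; linarith
  have h4 : Q * S ≤ Q - (1 + o * O) / 4 := by
    rw [← hA]
    exact (mul_le_mul_of_nonneg_right h2 hS0).trans h1
  set c := (1 + o * O) / (8 * (1 + o) * (1 + O)) with hc
  have hc0 : 0 ≤ c := by positivity
  have h5 : c * Q ≤ (1 + o * O) / 4 := by
    calc c * Q ≤ c * (2 * (1 + o) * (1 + O)) := by gcongr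
      _ = _ := by rw [hc]; field_simp; norm_num
  have h6 : S ≤ 1 - c := by
    refine le_of_mul_le_mul_left ?_ hQ0
    linarith
  have hX1 : X ^ 2 ≤ 1 - c := by linarith
  have h7 := abs_le_of_sq_le_sq' (a := X) (b := 1) (by linarith) zero_le_one
  refine ⟨by norm_num; linarith [sq_nonneg X], ?_⟩
  have h8 : c / 2 ≤ 1 + X := by nlinarith
  calc (1 + o * O) / (16 * (1 + o) ^ 2 * (1 + O)) = c / 2 / (1 + o) := by
        rw [hc]; field_simp; norm_num
    _ ≤ _ := by gcongr

theorem second_pick_bound {θ u o O r D ℓ φ : ℝ} (hu : 0 < u) (huθ : u ^ 3 = θ) (ho : 0 ≤ o)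
    (hO : 0 ≤ O) (hθo : θ * (1 + o) ≤ 1) (hℓ : 10 ^ 6 ≤ ℓ)
    (huℓ : 2 * 10 ^ 6 * (ℓ + 10) ^ 2 * u ≤ 1) (hrD : r * θ ≤ D / (8 * ℓ)) (hDO : D ≤ O)
    (hsr : √r ≤ r) (hOr : (O + √r) * u ^ 2 ≤ 2 * ℓ + 1) (hoO : o < 1 → O ≤ 4 * ℓ)
    (hφ : (1 + o * O) / (16 * (1 + o) ^ 2 * (1 + O)) ≤ φ) :
    2 * (4 * θ ^ 2) * (O + √r) ≤ φ * 0.01 ^ 2 := by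
  have hθ : 0 < θ := huθ ▸ pow_pos hu 3
  have huℓ' : u * ℓ ≤ 10 ^ (-12 : ℤ) := by
    norm_num
    nlinarith [mul_nonneg hu.le (by linarith : (0 : ℝ) ≤ ℓ - 10 ^ 6)]
  norm_num at huℓ'
  have hu1 : u ≤ 10 ^ (-12 : ℤ) := by
    norm_num
    nlinarith
  norm_num at hu1
  have hθu : θ ≤ u := by
    rw [← huθ]
    nlinarith [mul_pos hu hu]
  have hoO0 : 0 ≤ o * O := mul_nonneg ho hO
  rcases le_or_gt O 1 with h1 | h1
  · have h2 : O * θ / 32 ≤ φ := by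
      refine le_trans ?_ hφ
      rw [div_le_div_iff₀ (by norm_num) (by positivity)]
      calc O * θ * (16 * (1 + o) ^ 2 * (1 + O)) = 16 * (θ * (1 + o)) * (O * (1 + o)) * (1 + O) := by
            ring
        _ ≤ 16 * 1 * (1 + o * O) * 2 := by
            gcongr
            · nlinarith
            · linarith
        _ = _ := by ring
    have h3 : r * θ ≤ O / (8 * 10 ^ 6) := by
      refine hrD.trans ?_
      gcongr
    have h4 : 2 * (4 * θ ^ 2) * (O + √r) ≤ 8 * θ * (θ * O + r * θ) := by
      nlinarith [mul_le_mul_of_nonneg_left hsr (sq_nonneg θ)]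
    refine h4.trans (le_trans ?_ (mul_le_mul_of_nonneg_right h2 (by norm_num)))
    have h5 : θ * O ≤ O / 10 ^ 12 := by
      have := mul_le_mul_of_nonneg_right (hθu.trans hu1) hO
      linarith
    calc 8 * θ * (θ * O + r * θ) ≤ 8 * θ * (O / 10 ^ 12 + O / (8 * 10 ^ 6)) := by gcongr
      _ ≤ _ := by
        norm_num
        nlinarith [mul_nonneg hθ.le hO]
  · have h2 : θ / 64 ≤ φ := by
      refine le_trans ?_ hφ
      rw [div_le_div_iff₀ (by norm_num) (by positivity)]
      rcases lt_or_ge o 1 with h | h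
      · have h3 := hoO h
        have h4 : (1 + o) ^ 2 * (1 + O) ≤ 4 * (8 * ℓ) := by
          have h5 : (1 + o) ^ 2 ≤ 4 := by nlinarith
          have h6 : 1 + O ≤ 8 * ℓ := by linarith
          gcongr
        have h7 : θ * ℓ ≤ 1 / 10 := by nlinarith
        nlinarith
      · calc θ * (16 * (1 + o) ^ 2 * (1 + O)) = 16 * (θ * (1 + o)) * ((1 + o) * (1 + O)) := by ring
          _ ≤ 16 * 1 * ((2 * o) * (2 * O)) := by gcongr <;> linarith
          _ ≤ _ := by linarith
    refine le_trans ?_ (mul_le_mul_of_nonneg_right h2 (by norm_num))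
    have h3 : 2 * (4 * θ ^ 2) * (O + √r) = 8 * θ * u * ((O + √r) * u ^ 2) := by
      rw [← huθ]; ring
    rw [h3]
    calc 8 * θ * u * ((O + √r) * u ^ 2) ≤ 8 * θ * u * (2 * ℓ + 1) := by gcongr
      _ = 8 * θ * (2 * (u * ℓ) + u) := by ring
      _ ≤ 8 * θ * (10 ^ (-11 : ℤ)) := by
        gcongr
        norm_num
        linarith
      _ ≤ _ := by
        norm_num
        linarith

end Numerics

section Dense

variable {ι α : Type*} [DecidableEq ι] [DecidableEq α]

theorem hasRainbow_of_dense {F : ι → Finset (Finset α)} {k : ι → ℕ} {K n : ℕ} {T : Finset ι}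
    {Y : Finset α} (hk : ∀ i ∈ T, 1 ≤ k i) (hkK : ∀ i ∈ T, k i ≤ K) (hK : 0 < K)
    (hn : 100 * K ≤ n) (hY : (0.98 * n + K : ℝ) ≤ #Y) (hT : (#T : ℝ) ≤ n / K / 4)
    (hg : ∀ i ∈ T, 0.88 ≤ density (k i) (F i) Y) {Z : ℝ}
    (hZ : ∑ i ∈ T, (1 - density (k i) (F i) Y) ≤ Z) (hZn : 196 * Z ≤ n / K) :
    HasRainbow F T Y := by
  have hK' : (0 : ℝ) < K := by exact_mod_cast hK
  set N : ℝ := n / K with hN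
  have hN100 : 100 ≤ N := by
    rw [hN, le_div_iff₀ hK']
    exact_mod_cast hn
  set L := ⌊0.49 * N⌋₊ with hL
  have hL1 : (L : ℝ) ≤ 0.49 * N := Nat.floor_le (by positivity)
  have hL2 : 0.49 * N < L + 1 := Nat.lt_floor_add_one _
  have hL0 : 0 < L := Nat.floor_pos.2 (by linarith)
  have hNK : N * K = n := by rw [hN]; field_simp
  refine hasRainbow_of_density_gt (L := L) (Δ := 0.1 * N) hk hkK hL0 hK ?_ (by positivity) ?_ ?_
  · have : ((2 * L + 1) * K : ℝ) ≤ #Y := by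
      refine le_trans ?_ hY
      rw [← hNK]
      nlinarith
    exact_mod_cast this
  · have h1 : ∑ i ∈ T, density (k i) (F i) Y * (1 - density (k i) (F i) Y) ≤ Z := by
      refine (sum_le_sum fun i hi => ?_).trans hZ
      have := density_le_one (k i) (F i) Y
      nlinarith
    calc 4 * L * ∑ i ∈ T, density (k i) (F i) Y * (1 - density (k i) (F i) Y)
        ≤ 4 * (0.49 * N) * (N / 196) := by
          refine mul_le_mul (by gcongr) (by linarith) ?_ (by positivity)
          exact sum_nonneg fun i _ => density_mul_one_sub_nonneg _ _ _
      _ = _ := by ring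
  · intro i hi
    have := mul_le_mul_of_nonneg_left (hg i hi) (Nat.cast_nonneg (α := ℝ) L)
    norm_num at *
    linarith

end Dense

section Core

theorem card_filter_le_of_sum_sq_le {ι : Type*} {S : Finset ι} {f b : ι → ℝ} (hf : ∀ i ∈ S, 0 < f i)
    (hf1 : ∀ i ∈ S, f i ≤ 1) {D : ℝ} (hD : ∑ i ∈ S, (1 - f i) ≤ D)
    (hb : ∑ i ∈ S, ((b i - f i) / f i) ^ 2 ≤ 0.8) :
    (#{i ∈ S | b i ≤ 0.9} : ℝ) ≤ 20 * D + 320 := by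
  have h1 : ∀ i ∈ S, (if b i ≤ 0.9 then (1 : ℝ) else 0) ≤
      20 * (1 - f i) + 400 * ((b i - f i) / f i) ^ 2 := fun i hi => by
    have hfi := hf i hi
    have hfi1 := hf1 i hi
    split_ifs with h
    · set ξ := (b i - f i) / f i with hξ
      have hg : b i = f i * (1 + ξ) := by rw [hξ]; field_simp; ring
      rw [hg] at h
      norm_num at h
      nlinarith [sq_nonneg (ξ + 1 / 20), sq_nonneg (ξ + 1 / 40),
        mul_nonneg (sub_nonneg.2 hfi1) (sq_nonneg (ξ + 1))]
    · nlinarith [sq_nonneg ((b i - f i) / f i)]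
  have h2 := sum_le_sum h1
  rw [sum_boole, sum_add_distrib, ← mul_sum, ← mul_sum] at h2
  norm_num at *
  linarith

variable {ι α : Type*} [DecidableEq ι] [DecidableEq α]

set_option maxHeartbeats 400000 in
theorem hasRainbow_of_relative_change {F : ι → Finset (Finset α)} {k : ι → ℕ} {K n : ℕ}
    {R : Finset ι} {f b : ι → ℝ} {u ℓ : ℝ} {Y : Finset α} (hk : ∀ i ∈ R, 1 ≤ k i)
    (hkK : ∀ i ∈ R, k i ≤ K) (hK : 0 < K) (hu : 0 < u) (hf : ∀ i ∈ R, u ^ 2 ≤ f i)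
    (hf1 : ∀ i ∈ R, f i ≤ 1) (hℓ : 10 ^ 6 ≤ ℓ) (huℓ : 2 * 10 ^ 6 * (ℓ + 10) ^ 2 * u ≤ 1)
    (hkq : ∀ i ∈ R, ∀ j ∈ R, i ≠ j → (k i * k j : ℝ) ≤ (u ^ 3) ^ 2 * n ^ 2)
    (hKn : K * (10 ^ 6 * (ℓ + 10)) ≤ n) (hr : (#R : ℝ) ≤ n / K / 4)
    (hO : (∑ i ∈ R, (1 - f i) / f i + √(#R)) * u ^ 2 ≤ 2 * ℓ + 1)
    (hD : ∑ i ∈ R, (1 - f i) ≤ 2 * ℓ) (hb : ∑ i ∈ R, ((b i - f i) / f i) ^ 2 ≤ 0.8)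
    (hY : n ≤ #Y + 2 * K)
    (hdev : ∑ i ∈ R, ((density (k i) (F i) Y - b i) / f i) ^ 2 ≤ 0.01 ^ 2) :
    HasRainbow F R Y := by
  have hf0 : ∀ i ∈ R, 0 < f i := fun i hi => (pow_pos hu 2).trans_le (hf i hi)
  have hK' : (1 : ℝ) ≤ K := by exact_mod_cast hK
  set H := {i ∈ R | b i ≤ 0.9} with hH
  set T := R \ H with hT
  have hHT : H ∪ T = R := union_sdiff_of_subset (filter_subset _ _)
  have hdis : Disjoint H T := disjoint_sdiff
  have hTR : T ⊆ R := sdiff_subset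
  have hHc : (#H : ℝ) ≤ 40 * ℓ + 320 := by
    refine (card_filter_le_of_sum_sq_le hf0 hf1 hD hb).trans (le_of_eq ?_)
    ring
  have hHK : (#H : ℝ) * K ≤ 40 * (K * ℓ) + 320 * K := by
    refine (mul_le_mul_of_nonneg_right hHc (by positivity)).trans (le_of_eq ?_)
    ring
  have hKℓ : 10 ^ 6 * (K * ℓ) + 10 ^ 7 * K ≤ (n : ℝ) := by linarith
  have hKℓ0 : (0 : ℝ) ≤ K * ℓ := by positivity
  have hM4 : (4 + #H) * K ≤ n := by
    have : ((4 + #H) * K : ℝ) ≤ n := by linarith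
    exact_mod_cast this
  set M := n - (4 + #H) * K with hM
  have hMn : (M : ℝ) = n - (4 + #H) * K := by
    rw [hM, Nat.cast_sub hM4]
    push_cast
    ring
  have hn0 : (0 : ℝ) < n := by linarith
  have hM2 : (n : ℝ) / 2 ≤ M := by rw [hMn]; linarith
  have hM0 : (0 : ℝ) < M := by linarith
  have hτ : (#H : ℝ) * (10 * u * (2 * ℓ + 1)) ≤ 0.01 := by
    have h1 : (#H : ℝ) * (10 * u * (2 * ℓ + 1)) ≤ (40 * ℓ + 320) * (10 * u * (2 * ℓ + 1)) := by
      gcongr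
    norm_num
    nlinarith [mul_nonneg hu.le (sq_nonneg ℓ), mul_nonneg hu.le (by linarith : 0 ≤ ℓ)]
  rw [← hHT] at hb hdev
  obtain ⟨Y', hY'Y, hY'c, hext, hdev'⟩ := exists_hasRainbow_extension (F := F) (k := k) (K := K)
    (M := M) f b (A := 0.895) (τ := 10 * u * (2 * ℓ + 1)) (q := 4 * (u ^ 3) ^ 2)
    (γ := 0.08 * u ^ 2) (W := ∑ i ∈ R, (1 - f i) / f i) (s := #R) (by norm_num) (by positivity)
    (by positivity) (by positivity) (by exact_mod_cast hM0)
    (by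
      calc 2 * (4 * (u ^ 3) ^ 2) * (∑ i ∈ R, (1 - f i) / f i + √(#R))
          = 8 * u ^ 4 * ((∑ i ∈ R, (1 - f i) / f i + √(#R)) * u ^ 2) := by ring
        _ ≤ 8 * u ^ 4 * (2 * ℓ + 1) := by gcongr
        _ ≤ 8 * u ^ 4 * (2 * ℓ + 1) ^ 2 := by
          gcongr
          nlinarith
        _ = _ := by ring)
    T H hdis (by rwa [hHT]) (by rwa [hHT]) (by rwa [hHT]) (by rwa [hHT])
    (fun j hj i hi hij => by
      rw [hHT] at hi
      rw [div_le_iff₀ (by positivity)]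
      calc (k j * k i : ℝ) ≤ (u ^ 3) ^ 2 * n ^ 2 :=
            hkq j (mem_of_mem_filter j hj) i hi hij.symm
        _ ≤ (u ^ 3) ^ 2 * (2 * M) ^ 2 := by gcongr; linarith
        _ = _ := by ring)
    (by rw [hHT]) (by rw [hHT])
    (fun j hj => mul_le_mul_of_nonneg_left (hf j (mem_of_mem_filter j hj)) (by norm_num))
    (hb.trans (by norm_num)) Y (B := 0.01) (by norm_num)
    (by
      have h1 : (4 + #H) * K = 4 * K + #H * K := by ring
      omega)
    hdev (by norm_num at *; linarith)
  rw [hHT] at hext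
  refine hext ?_
  rw [hHT] at hb hdev
  have hdev2 : ∑ i ∈ T, ((density (k i) (F i) Y' - b i) / f i) ^ 2 ≤ 0.02 ^ 2 := by
    refine hdev'.trans ?_
    gcongr
    norm_num at *
    linarith
  have hdevf : ∑ i ∈ T, ((density (k i) (F i) Y' - f i) / f i) ^ 2 ≤ 1 := by
    have h1 : ∑ i ∈ T, ((b i - f i) / f i) ^ 2 ≤ 0.9 ^ 2 :=
      (sum_le_sum_of_subset_of_nonneg hTR fun i _ _ => sq_nonneg _).trans
        (hb.trans (by norm_num))
    refine le_trans (le_of_eq ?_) ((sum_add_sq_le_add_sq _ _ _ (by norm_num) (by norm_num)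
      hdev2 h1).trans (by norm_num))
    exact sum_congr rfl fun i _ => by ring
  have hNℓ : 10 ^ 6 * (ℓ + 10) ≤ (n : ℝ) / K := by
    rw [le_div_iff₀ (by positivity)]
    linarith
  have hsr : √(#R : ℝ) ≤ n / K / 1000 := by
    refine Real.sqrt_le_iff.2 ⟨by positivity, hr.trans ?_⟩
    nlinarith
  refine hasRainbow_of_dense (K := K) (n := n) (Z := 2 * ℓ + √(#R : ℝ)) (fun i hi => hk i (hTR hi))
    (fun i hi => hkK i (hTR hi)) hK ?_ ?_ ?_ ?_ ?_ ?_
  · have : (100 * K : ℝ) ≤ n := by linarith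
    exact_mod_cast this
  · have h1 : n ≤ #Y' + #H * K + 2 * K := by omega
    have h2 : (n : ℝ) ≤ #Y' + #H * K + 2 * K := by exact_mod_cast h1
    norm_num
    linarith
  · exact le_trans (by exact_mod_cast card_le_card hTR) hr
  · intro i hi
    have hiR := hTR hi
    have hbi : 0.9 < b i := by
      by_contra! h
      exact (mem_sdiff.1 hi).2 (mem_filter.2 ⟨hiR, h⟩)
    have h1 : ((density (k i) (F i) Y' - b i) / f i) ^ 2 ≤ 0.02 ^ 2 :=
      (single_le_sum (f := fun i => ((density (k i) (F i) Y' - b i) / f i) ^ 2)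
        (fun i _ => sq_nonneg _) hi).trans hdev2
    have h2 := (abs_le_of_sq_le_sq' h1 (by norm_num)).1
    rw [le_div_iff₀ (hf0 i hiR)] at h2
    have := hf1 i hiR
    norm_num at *
    linarith
  · have h1 : ∑ i ∈ T, (1 - f i) ≤ 2 * ℓ :=
      (sum_le_sum_of_subset_of_nonneg hTR fun i hi _ => by linarith [hf1 i hi]).trans hD
    have h2 := sum_abs_le_sqrt_card T _ hdevf
    have h3 : √(#T : ℝ) ≤ √(#R : ℝ) := Real.sqrt_le_sqrt (by exact_mod_cast card_le_card hTR)
    calc ∑ i ∈ T, (1 - density (k i) (F i) Y')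
        ≤ ∑ i ∈ T, ((1 - f i) + |(density (k i) (F i) Y' - f i) / f i|) := by
          refine sum_le_sum fun i hi => ?_
          have hfi := hf0 i (hTR hi)
          have h4 := neg_abs_le ((density (k i) (F i) Y' - f i) / f i)
          rw [le_div_iff₀ hfi] at h4
          have h5 : |(density (k i) (F i) Y' - f i) / f i| * f i ≤
              |(density (k i) (F i) Y' - f i) / f i| :=
            mul_le_of_le_one_right (abs_nonneg _) (hf1 i (hTR hi))
          linarith
      _ ≤ _ := by
          rw [sum_add_distrib]
          linarith
  · linarith

end Core

section Core

variable {ι : Type*} [DecidableEq ι]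

/-- The family of smallest density has a member whose removal neither destroys the family of second
smallest density nor changes the remaining densities too much. -/
theorem exists_mem_relative_change_le_and_le_density {n K : ℕ} {F : ι → Finset (Finset (Fin n))}
    {k : ι → ℕ} {f : ι → ℝ} (hfd : ∀ i, f i = density (k i) (F i) univ) {p₁ p₂ : ι}
    {R : Finset ι} {θ : ℝ} (hp : p₁ ≠ p₂) (hp₁ : p₁ ∉ R) (hp₂ : p₂ ∉ R) (hk : ∀ i, 1 ≤ k i)
    (hkK : ∀ i, k i ≤ K) (hK : 0 < K) (hθ : 0 < θ)
    (hkk : ∀ i j, i ≠ j → (k i * k j : ℝ) ≤ θ ^ 2 * n ^ 2) (hf0 : ∀ i, 0 < f i)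
    (h2 : ∀ i ∈ R, f p₂ ≤ f i) (hprod : θ ^ 2 < f p₁ * (f p₂ * ∏ i ∈ R, f i))
    (hn : 500 * K ≤ n) (hKO : (50 * K / n : ℝ) ≤ ∑ i ∈ R, (1 - f i) / f i) :
    ∃ e ∈ F p₁, #e = k p₁ ∧
      ∑ i ∈ R, ((density (k i) (F i) (univ \ e) - f i) / f i) ^ 2 ≤ 0.8 ∧
      (1 + (1 - f p₂) / f p₂ * ∑ i ∈ R, (1 - f i) / f i) /
        (16 * (1 + (1 - f p₂) / f p₂) ^ 2 * (1 + ∑ i ∈ R, (1 - f i) / f i)) ≤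
          density (k p₂) (F p₂) (univ \ e) := by
  have hf1 : ∀ i, f i ≤ 1 := fun i => (hfd i).trans_le (density_le_one _ _ _)
  set o : ι → ℝ := fun i => (1 - f i) / f i with ho
  have ho0 : ∀ i, 0 ≤ o i := fun i => div_nonneg (sub_nonneg.2 (hf1 i)) (hf0 i).le
  have hof : ∀ i, 1 + o i = (f i)⁻¹ := fun i => by
    have := hf0 i
    simp only [ho]
    field_simp
    ring
  have ho2 : ∀ i ∈ R, o i ≤ o p₂ := fun i hi => by
    have h1 : (f i)⁻¹ ≤ (f p₂)⁻¹ := inv_anti₀ (hf0 _) (h2 i hi)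
    rw [← hof, ← hof] at h1
    linarith
  set O := ∑ i ∈ R, o i with hO
  have hO0 : 0 ≤ O := sum_nonneg fun i _ => ho0 i
  have hK' : (1 : ℝ) ≤ K := by exact_mod_cast hK
  have hn' : (500 * K : ℝ) ≤ n := by exact_mod_cast hn
  have hn0 : (0 : ℝ) < n := by linarith
  have hM : ((n - 2 * K : ℕ) : ℝ) = n - 2 * K := by
    rw [Nat.cast_sub (by omega)]
    push_cast
    rfl
  have hM0 : (0 : ℝ) < n - 2 * K := by linarith
  have hf₁ : 0 < f p₁ := hf0 p₁
  rw [hfd p₁] at hf₁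
  set w : ι → ℝ := fun i => (if i = p₂ then 1 else 5 / 4) / f i ^ 2 with hw
  have hins : ∀ i ∈ insert p₂ R, p₁ ≠ i := by
    intro i hi h
    rcases mem_insert.1 hi with h' | h'
    · exact hp (h.trans h')
    · exact hp₁ (h ▸ h')
  have hne2 : ∀ i ∈ R, i ≠ p₂ := fun i hi h => hp₂ (h ▸ hi)
  obtain ⟨e, he, -, hek, hle⟩ := exists_mem_sum_density_sdiff_sub_sq_le (insert p₂ R) k F w
    (s := k p₁) (M := n - 2 * K) (G := F p₁) (Y := univ)
    (fun i _ => by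
      have : (0 : ℝ) ≤ if i = p₂ then 1 else 5 / 4 := by split_ifs <;> norm_num
      positivity)
    (fun i _ => hk i) (by omega)
    (fun i _ => by
      rw [card_univ, Fintype.card_fin]
      have := hkK i
      have := hkK p₁
      omega) hf₁
  set X := (density (k p₂) (F p₂) (univ \ e) - f p₂) / f p₂ with hX
  set S := ∑ i ∈ R, ((density (k i) (F i) (univ \ e) - f i) / f i) ^ 2 with hS
  set ζ : ℝ := 5 * K / n with hζ
  have hζn : ζ * n = 5 * K := by rw [hζ]; field_simp
  have hζM : (n : ℝ) ^ 2 ≤ (1 + ζ) * (n - 2 * K) ^ 2 := by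
    refine le_of_mul_le_mul_right ?_ hn0
    calc (n : ℝ) ^ 2 * n ≤ (n + 5 * K) * (n - 2 * K) ^ 2 := by
          have : 0 ≤ (n : ℝ) * K * (n - 16 * K) := by
            have : (0 : ℝ) ≤ n - 16 * K := by linarith
            positivity
          nlinarith [pow_pos (by linarith : (0 : ℝ) < K) 3]
      _ = (n + ζ * n) * (n - 2 * K) ^ 2 := by rw [hζn]
      _ = _ := by ring
  have hkey : f p₁ * (X ^ 2 + 5 / 4 * S) ≤ (1 + ζ) * θ ^ 2 * (o p₂ + 5 / 4 * O) := by
    calc f p₁ * (X ^ 2 + 5 / 4 * S)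
        = density (k p₁) (F p₁) univ * ∑ i ∈ insert p₂ R, w i *
          (density (k i) (F i) (univ \ e) - density (k i) (F i) univ) ^ 2 := by
          rw [← hfd p₁, sum_insert hp₂, hS, mul_sum, hX]
          congr 2
          · simp only [hw, if_true, ← hfd]
            ring
          · refine sum_congr rfl fun i hi => ?_
            simp only [hw, if_neg (hne2 i hi), ← hfd]
            ring
      _ ≤ ∑ i ∈ insert p₂ R, (if i = p₂ then 1 else 5 / 4) * ((1 + ζ) * θ ^ 2 * o i) := by
          refine hle.trans (sum_le_sum fun i hi => ?_)
          have h3 : (k p₁ * k i : ℝ) / ((n - 2 * K : ℕ) : ℝ) ^ 2 ≤ (1 + ζ) * θ ^ 2 := by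
            rw [hM, div_le_iff₀ (by positivity)]
            calc (k p₁ * k i : ℝ) ≤ θ ^ 2 * n ^ 2 := hkk _ _ (hins i hi)
              _ ≤ θ ^ 2 * ((1 + ζ) * (n - 2 * K) ^ 2) := by gcongr
              _ = _ := by ring
          have h4 : w i * (f i * (1 - f i)) = (if i = p₂ then 1 else 5 / 4) * o i := by
            have := hf0 i
            simp only [hw, ho]
            field_simp
          have h5 : 0 ≤ (if i = p₂ then 1 else 5 / 4) * o i := by
            have := ho0 i
            split_ifs <;> positivity
          rw [← hfd i]
          calc w i * ((k p₁ * k i : ℝ) / ((n - 2 * K : ℕ) : ℝ) ^ 2 * (f i * (1 - f i)))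
              = (k p₁ * k i : ℝ) / ((n - 2 * K : ℕ) : ℝ) ^ 2 * (w i * (f i * (1 - f i))) := by ring
            _ ≤ (1 + ζ) * θ ^ 2 * (w i * (f i * (1 - f i))) := by
                rw [h4]
                gcongr
            _ = _ := by rw [h4]; ring
      _ = _ := by
          rw [sum_insert hp₂, if_pos rfl, hO, mul_sum, mul_add, one_mul, mul_sum]
          congr 1
          refine sum_congr rfl fun i hi => ?_
          rw [if_neg (hne2 i hi)]
          ring
  have hP := one_add_sum_add_le_prod_one_add R o fun i _ => ho0 i
  have hsq : ∑ i ∈ R, o i ^ 2 ≤ O ^ 2 := sum_sq_le_sq_sum_of_nonneg fun i _ => ho0 i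
  have hsq2 : ∑ i ∈ R, o i ^ 2 ≤ o p₂ * O := by
    rw [hO, mul_sum]
    refine sum_le_sum fun i hi => ?_
    rw [sq]
    exact mul_le_mul_of_nonneg_right (ho2 i hi) (ho0 i)
  have hPf : (∏ i ∈ R, (1 + o i)) * ∏ i ∈ R, f i = 1 := by
    rw [← prod_mul_distrib]
    refine prod_eq_one fun i _ => ?_
    rw [hof, inv_mul_cancel₀ (hf0 i).ne']
  have hP0 : 0 < ∏ i ∈ R, (1 + o i) := prod_pos fun i _ => by linarith [ho0 i]
  have hPlt : θ ^ 2 * ((1 + o p₂) * ∏ i ∈ R, (1 + o i)) < f p₁ := by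
    have h3 := mul_lt_mul_of_pos_right hprod
      (mul_pos (by linarith [ho0 p₂] : 0 < 1 + o p₂) hP0)
    refine h3.trans_eq ?_
    calc f p₁ * (f p₂ * ∏ i ∈ R, f i) * ((1 + o p₂) * ∏ i ∈ R, (1 + o i))
        = f p₁ * (f p₂ * (1 + o p₂)) * ((∏ i ∈ R, (1 + o i)) * ∏ i ∈ R, f i) := by ring
      _ = f p₁ := by rw [hPf, hof, mul_inv_cancel₀ (hf0 _).ne', mul_one, mul_one]
  have hζO : ζ = (50 * K / n : ℝ) / 10 := by rw [hζ]; ring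
  obtain ⟨h3, h4⟩ := first_pick_bounds hθ (ho0 p₂) hO0 (by rw [hζO]; gcongr)
    (by rw [hζ, div_le_div_iff₀ hn0 (by norm_num)]; linarith) (sum_nonneg fun i _ => sq_nonneg _)
    (by linarith) (by linarith) hPlt hkey
  refine ⟨e, he, hek, h3, h4.trans (le_of_eq ?_)⟩
  have := hf0 p₂
  rw [hof, hX]
  field_simp
  ring

set_option maxHeartbeats 400000 in
theorem hasRainbow_insert_insert {n K : ℕ} {F : ι → Finset (Finset (Fin n))}
    {k : ι → ℕ} {f : ι → ℝ} (hfd : ∀ i, f i = density (k i) (F i) univ) {p₁ p₂ : ι}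
    {R : Finset ι} {θ ℓ : ℝ} (hp : p₁ ≠ p₂) (hp₁ : p₁ ∉ R) (hp₂ : p₂ ∉ R) (hR : R.Nonempty)
    (hk : ∀ i, 1 ≤ k i) (hkK : ∀ i, k i ≤ K) (hK : 0 < K) (hθ : 0 < θ) (hθK : θ * n ≤ K)
    (hkk : ∀ i j, i ≠ j → (k i * k j : ℝ) ≤ θ ^ 2 * n ^ 2) (hf0 : ∀ i, 0 < f i)
    (h1 : f p₁ ≤ f p₂) (h2 : ∀ i ∈ R, f p₂ ≤ f i)
    (hprod : θ ^ 2 < f p₁ * (f p₂ * ∏ i ∈ R, f i)) (hℓ : 10 ^ 6 ≤ ℓ)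
    (hKn : K * (2 * 10 ^ 6 * (ℓ + 10) ^ 2) ^ 3 ≤ n)
    (hd : ∀ i ∈ R, 8 * K * ℓ / n ≤ 1 - f i) (hD : ∑ i ∈ R, (1 - f i) ≤ 2 * ℓ) :
    HasRainbow F (insert p₁ (insert p₂ R)) univ := by
  have hf1 : ∀ i, f i ≤ 1 := fun i => (hfd i).trans_le (density_le_one _ _ _)
  have hK' : (1 : ℝ) ≤ K := by exact_mod_cast hK
  set P : ℝ := 2 * 10 ^ 6 * (ℓ + 10) ^ 2 with hP
  have hP1 : 10 ^ 6 * (ℓ + 10) ≤ P := by rw [hP]; nlinarith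
  have hP0 : 1 ≤ P := by linarith
  have hP3 : P ≤ P ^ 3 := le_self_pow₀ hP0 (by norm_num)
  have hKP : K * (10 ^ 6 * (ℓ + 10)) ≤ (n : ℝ) := by
    refine le_trans ?_ hKn
    gcongr
    linarith
  have hKℓ : 10 ^ 6 * (K * ℓ) + 10 ^ 7 * K ≤ (n : ℝ) := by linarith
  have hKℓ0 : (0 : ℝ) ≤ K * ℓ := by positivity
  have hn0 : (0 : ℝ) < n := by linarith
  obtain ⟨u, hu, huθ⟩ : ∃ u : ℝ, 0 < u ∧ u ^ 3 = θ := by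
    refine ⟨θ ^ ((1 : ℝ) / 3), by positivity, ?_⟩
    rw [← Real.rpow_natCast, ← Real.rpow_mul hθ.le]
    norm_num
  have huP : P * u ≤ 1 := by
    refine le_of_pow_le_pow_left₀ (n := 3) (by norm_num) zero_le_one ?_
    rw [mul_pow, huθ, one_pow]
    refine le_of_mul_le_mul_right ?_ hn0
    calc P ^ 3 * θ * n = P ^ 3 * (θ * n) := by ring
      _ ≤ P ^ 3 * K := by gcongr
      _ ≤ 1 * n := by linarith
  have hu1 : u ≤ 1 := by nlinarith
  have hRprod : ∏ i ∈ R, f i ≤ 1 := prod_le_one (fun i _ => (hf0 i).le) fun i _ => hf1 i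
  have hRprod0 : 0 ≤ ∏ i ∈ R, f i := prod_nonneg fun i _ => (hf0 i).le
  have hθ2 : θ ≤ f p₂ := by
    refine le_of_pow_le_pow_left₀ (n := 2) (by norm_num) (hf0 _).le (hprod.le.trans ?_)
    calc f p₁ * (f p₂ * ∏ i ∈ R, f i) ≤ f p₂ * (f p₂ * 1) := by
          have := hf0 p₂
          have hmul : 0 ≤ f p₂ * ∏ i ∈ R, f i := by positivity
          gcongr
      _ = _ := by ring
  have hu2 : ∀ i ∈ R, u ^ 2 ≤ f i := fun i hi => by
    refine le_of_pow_le_pow_left₀ (n := 3) (by norm_num) (hf0 _).le ?_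
    have h3 : ∏ i ∈ R, f i ≤ f i := by
      rw [← mul_prod_erase R f hi]
      exact mul_le_of_le_one_right (hf0 i).le
        (prod_le_one (fun i _ => (hf0 i).le) fun i _ => hf1 i)
    calc (u ^ 2) ^ 3 = θ ^ 2 := by rw [← huθ]; ring
      _ ≤ f p₁ * (f p₂ * ∏ i ∈ R, f i) := hprod.le
      _ ≤ f i * (f i * f i) := by
          have := hf0 i
          have := hf0 p₂
          gcongr
          · exact h1.trans (h2 i hi)
          · exact h2 i hi
      _ = _ := by ring
  set D := ∑ i ∈ R, (1 - f i) with hDdef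
  set O := ∑ i ∈ R, (1 - f i) / f i with hO
  have hDO : D ≤ O := sum_le_sum fun i _ => by
    rw [le_div_iff₀ (hf0 i)]
    exact mul_le_of_le_one_right (sub_nonneg.2 (hf1 i)) (hf1 i)
  have hOu : O * u ^ 2 ≤ D := by
    rw [hO, sum_mul]
    refine sum_le_sum fun i hi => ?_
    rw [div_mul_eq_mul_div, div_le_iff₀ (hf0 i)]
    exact mul_le_mul_of_nonneg_left (hu2 i hi) (sub_nonneg.2 (hf1 i))
  have hrD : #R * (8 * K * ℓ / n) ≤ D := by
    rw [← nsmul_eq_mul]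
    exact card_nsmul_le_sum R _ _ hd
  have hr1 : (1 : ℝ) ≤ #R := by exact_mod_cast hR.card_pos
  have hε0 : 0 ≤ 8 * K * ℓ / n := by positivity
  have hO0 : 0 ≤ O := by
    refine le_trans ?_ (hrD.trans hDO)
    positivity
  have hKO : (50 * K / n : ℝ) ≤ O := by
    refine le_trans ?_ (hrD.trans hDO)
    refine le_trans ?_ (le_mul_of_one_le_left hε0 hr1)
    gcongr ?_ / _
    linarith [mul_le_mul_of_nonneg_left hℓ (by linarith : (0 : ℝ) ≤ K)]
  have hrn : (#R : ℝ) ≤ n / K / 4 := by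
    rw [div_div, le_div_iff₀ (by positivity)]
    have h3 := hrD.trans hD
    rw [mul_div_assoc', div_le_iff₀ hn0] at h3
    have h4 : ℓ * (#R * (K * 4)) ≤ ℓ * n := by linarith
    exact le_of_mul_le_mul_left h4 (by linarith)
  have hrθ : (#R : ℝ) * θ ≤ D / (8 * ℓ) := by
    rw [le_div_iff₀ (by positivity)]
    refine le_trans ?_ hrD
    rw [mul_div_assoc', le_div_iff₀ hn0]
    calc (#R : ℝ) * θ * (8 * ℓ) * n = #R * (8 * ℓ) * (θ * n) := by ring
      _ ≤ #R * (8 * ℓ) * K := by gcongr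
      _ = _ := by ring
  have hsr : √(#R : ℝ) ≤ #R := Real.sqrt_le_iff.2 ⟨by positivity, by nlinarith⟩
  have hsru : √(#R : ℝ) * u ^ 2 ≤ 1 := by
    have h3 : (#R : ℝ) * θ ≤ 1 := by
      refine hrθ.trans ?_
      rw [div_le_one (by positivity)]
      linarith
    refine le_of_pow_le_pow_left₀ (n := 2) (by norm_num) zero_le_one ?_
    rw [mul_pow, Real.sq_sqrt (by positivity)]
    calc (#R : ℝ) * (u ^ 2) ^ 2 = #R * θ * u := by rw [← huθ]; ring
      _ ≤ 1 * 1 := by gcongr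
      _ = _ := by norm_num
  have hOr : (O + √(#R)) * u ^ 2 ≤ 2 * ℓ + 1 := by linarith
  have hn500 : 500 * K ≤ n := by
    have : (500 * K : ℝ) ≤ n := by linarith
    exact_mod_cast this
  obtain ⟨e₁, he₁, hk₁, hS, hφ⟩ := exists_mem_relative_change_le_and_le_density hfd hp hp₁ hp₂ hk
    hkK hK hθ hkk hf0 h2 hprod hn500 hKO
  set o := (1 - f p₂) / f p₂ with ho
  have ho0 : 0 ≤ o := div_nonneg (sub_nonneg.2 (hf1 _)) (hf0 _).le
  have hof : (1 + o) * f p₂ = 1 := by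
    have := hf0 p₂
    rw [ho]
    field_simp
    ring
  set φ := density (k p₂) (F p₂) (univ \ e₁) with hφdef
  have hφ0 : 0 < φ := lt_of_lt_of_le (by positivity) hφ
  have hbound := second_pick_bound (D := D) hu huθ ho0 hO0
    (by linarith [mul_le_mul_of_nonneg_left hθ2 (by linarith : 0 ≤ 1 + o)]) hℓ huP hrθ hDO hsr hOr
    (fun ho1 => by
      refine le_trans ?_ (by linarith : 2 * D ≤ 4 * ℓ)
      rw [hO, hDdef, mul_sum]
      refine sum_le_sum fun i hi => ?_
      have h3 : 1 ≤ 2 * f i := by nlinarith [h2 i hi, hf0 p₂]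
      rw [div_le_iff₀ (hf0 i)]
      nlinarith [hf1 i])
    hφ
  have hc₁ : #(univ \ e₁) = n - k p₁ := by
    rw [card_sdiff_of_subset (subset_univ _), hk₁, card_univ, Fintype.card_fin]
  have hM : ((n - 3 * K : ℕ) : ℝ) = n - 3 * K := by
    rw [Nat.cast_sub (by omega)]
    push_cast
    rfl
  have hk1K := hkK p₁
  have hk2K := hkK p₂
  obtain ⟨e₂, he₂, he₂Y, hk₂, hle⟩ := exists_mem_sum_relative_change_sq_le (F := F) (k := k)
    (j := p₂) (M := n - 3 * K) (q := 4 * θ ^ 2) (Y := univ \ e₁) (γ := φ) R f (fun i _ => hf0 i)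
    (fun i _ => hf1 i) (fun i _ => hk i) (by omega) (by positivity)
    (fun i hi => by
      rw [hM, div_le_iff₀ (by
        have : (0 : ℝ) < n - 3 * K := by linarith
        positivity)]
      calc (k p₂ * k i : ℝ) ≤ θ ^ 2 * n ^ 2 := hkk _ _ fun h => hp₂ (h ▸ hi)
        _ ≤ θ ^ 2 * (2 * (n - 3 * K)) ^ 2 := by gcongr; linarith
        _ = _ := by ring)
    (fun i hi => by
      have := hkK i
      omega)
    (hS.trans (by norm_num)) hφ0 le_rfl
  have hdev : ∑ i ∈ R, ((density (k i) (F i) ((univ \ e₁) \ e₂) -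
      density (k i) (F i) (univ \ e₁)) / f i) ^ 2 ≤ 0.01 ^ 2 :=
    le_of_mul_le_mul_left (hle.trans hbound) hφ0
  have hc₂ : #((univ \ e₁) \ e₂) = n - k p₁ - k p₂ := by
    rw [card_sdiff_of_subset he₂Y, hk₂, hc₁]
  have hRR : HasRainbow F R ((univ \ e₁) \ e₂) :=
    hasRainbow_of_relative_change (K := K) (n := n) (f := f) (u := u) (ℓ := ℓ)
      (fun i _ => hk i) (fun i _ => hkK i) hK hu hu2 (fun i _ => hf1 i) hℓ huP
      (fun i _ j _ hij => by rw [huθ]; exact hkk i j hij) hKP hrn hOr hD hS (by omega) hdev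
  exact (hRR.insert hp₂ he₂ he₂Y).insert (by simp [hp, hp₁]) he₁ (subset_univ _)

end Core

section Assembly

theorem exists_forall_log_mul_pow_le :
    ∃ N : ℕ, ∀ n ≥ N, 10 ^ 6 ≤ Real.log n ∧
      Real.log n * ((2 * 10 ^ 6 * (Real.log n + 10) ^ 2) ^ 3) ^ 2 ≤ n := by
  have h1 : ∀ᶠ n : ℕ in Filter.atTop, (10 : ℝ) ^ 6 ≤ Real.log n :=
    (Real.tendsto_log_atTop.comp tendsto_natCast_atTop_atTop).eventually_ge_atTop _
  have h2 : ∀ᶠ n : ℕ in Filter.atTop,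
      ‖Real.log n ^ 13‖ ≤ ((8 * 10 ^ 6 : ℝ) ^ 6)⁻¹ * ‖id (n : ℝ)‖ :=
    tendsto_natCast_atTop_atTop.eventually
      ((isLittleO_pow_log_id_atTop (n := 13)).def (by positivity))
  obtain ⟨N, hN⟩ := Filter.eventually_atTop.1 (h1.and h2)
  refine ⟨N, fun n hn => ⟨(hN n hn).1, ?_⟩⟩
  obtain ⟨h3, h4⟩ := hN n hn
  have h0 : 0 ≤ Real.log n := by linarith
  rw [Real.norm_of_nonneg (by positivity), id, Real.norm_of_nonneg (by positivity),
    inv_mul_eq_div, le_div_iff₀ (by positivity)] at h4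
  calc Real.log n * ((2 * 10 ^ 6 * (Real.log n + 10) ^ 2) ^ 3) ^ 2
      ≤ Real.log n * ((2 * 10 ^ 6 * (2 * Real.log n) ^ 2) ^ 3) ^ 2 := by
        gcongr
        linarith
    _ = Real.log n ^ 13 * (8 * 10 ^ 6) ^ 6 := by ring
    _ ≤ n := h4

theorem sq_le_mul_log_of_le_mul_one_sub_rpow {n K : ℕ} (hK : 0 < K) (hn : 1 ≤ Real.log n)
    (h : (K : ℝ) ≤ n * (1 - (8 * K * Real.log n / n) ^ ((1 : ℝ) / K))) :
    (K : ℝ) ^ 2 ≤ n * Real.log n := by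
  have hK' : (1 : ℝ) ≤ K := by exact_mod_cast hK
  have hn0 : (0 : ℝ) < n := by
    rcases Nat.eq_zero_or_pos n with rfl | h0
    · norm_num at hn
    · exact_mod_cast h0
  set x := (8 * K * Real.log n / n) ^ ((1 : ℝ) / K) with hx
  have hb0 : 0 ≤ 8 * K * Real.log n / n := by positivity
  have hx0 : 0 ≤ x := Real.rpow_nonneg hb0 _
  have hxK : x ^ K = 8 * K * Real.log n / n := by
    rw [hx, one_div, Real.rpow_inv_natCast_pow hb0 hK.ne']
  by_contra! hlt
  have h1 : x ≤ Real.exp (-(K / n)) := by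
    refine le_trans ?_ (Real.one_sub_le_exp_neg _)
    rw [le_sub_comm, div_le_iff₀ hn0]
    linarith
  have h2 : x ^ K ≤ Real.exp (-Real.log n) := by
    calc x ^ K ≤ Real.exp (-(K / n)) ^ K := by gcongr
      _ = Real.exp (-(K ^ 2 / n)) := by
          rw [← Real.exp_nat_mul]
          congr 1
          ring
      _ ≤ _ := by
          gcongr
          rw [le_div_iff₀ hn0]
          linarith
  rw [hxK, Real.exp_neg, Real.exp_log hn0, inv_eq_one_div, div_le_div_iff_of_pos_right hn0] at h2
  nlinarith

theorem sum_one_sub_le_neg_log_prod {ι : Type*} {f : ι → ℝ} (hf0 : ∀ i, 0 < f i) (S : Finset ι) :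
    ∑ i ∈ S, (1 - f i) ≤ -Real.log (∏ i ∈ S, f i) := by
  rw [Real.log_prod fun i _ => (hf0 i).ne', ← sum_neg_distrib]
  refine sum_le_sum fun i _ => ?_
  linarith [Real.log_le_sub_one_of_pos (hf0 i)]

variable {ι : Type*} [DecidableEq ι]

theorem hasRainbow_pair {n : ℕ} {F : ι → Finset (Finset (Fin n))} {k : ι → ℕ} {a b : ι}
    (hab : a ≠ b) (hF : ∀ i, ∀ e ∈ F i, #e = k i) (hk : ∀ i, 1 ≤ k i) (hk8 : ∀ i, 8 * k i ≤ n)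
    (h : (k a * k b : ℝ) / n ^ 2 <
      density (k a) (F a) univ * density (k b) (F b) univ) : HasRainbow F {a, b} univ := by
  obtain ⟨e, he, e', he', hd⟩ := exists_disjoint_of_lt_density_mul_density (hk a) (hk b) (hk8 a)
    (hk8 b) (hF a) (hF b) h
  have h1 : HasRainbow F ∅ ((univ \ e) \ e') := ⟨fun _ => ∅, by simp, by simp⟩
  have h2 := (h1.insert (notMem_empty b) he'
    (subset_sdiff.2 ⟨subset_univ _, hd.symm⟩)).insert (j := a) (by simpa using hab) he
    (subset_univ _)
  simpa using h2

theorem prod_univ_le_prod [Fintype ι] {f : ι → ℝ} (hf0 : ∀ i, 0 ≤ f i) (hf1 : ∀ i, f i ≤ 1)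
    (S : Finset ι) : ∏ i, f i ≤ ∏ i ∈ S, f i := by
  rw [← prod_sdiff (subset_univ S)]
  exact mul_le_of_le_one_left (prod_nonneg fun i _ => hf0 i)
    (prod_le_one (fun i _ => hf0 i) fun i _ => hf1 i)

theorem hasRainbow_univ_of_lt_prod_density [Fintype ι] {n K : ℕ} {k : ι → ℕ}
    {F : ι → Finset (Finset (Fin n))} (hF : ∀ i, ∀ e ∈ F i, #e = k i) (hk : ∀ i, 1 ≤ k i)
    (hkK : ∀ i, k i ≤ K) (hK : 0 < K) (hι : 2 ≤ Fintype.card ι) {θ x : ℝ} (hθn : 1 ≤ θ * n)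
    (hθK : θ * n ≤ K) (hkk : ∀ i j, i ≠ j → (k i * k j : ℝ) ≤ θ ^ 2 * n ^ 2)
    (hprod : θ ^ 2 < ∏ i, density (k i) (F i) univ) (hn : 10 ^ 6 ≤ Real.log n)
    (hKn : K * (2 * 10 ^ 6 * (Real.log n + 10) ^ 2) ^ 3 ≤ n) (hx0 : 0 ≤ x) (hx1 : x ≤ 1)
    (hxK : x ^ K = 8 * K * Real.log n / n) (hsum : ∑ i, (k i : ℝ) ≤ n * (1 - x)) :
    HasRainbow F univ univ := by
  obtain ⟨f, hf⟩ : ∃ f : ι → ℝ, ∀ i, f i = density (k i) (F i) univ := ⟨_, fun _ => rfl⟩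
  simp only [← hf] at hprod
  have hn0 : (0 : ℝ) < n := by
    rcases Nat.eq_zero_or_pos n with rfl | h0
    · norm_num at hn
    · exact_mod_cast h0
  have hθ : 0 < θ := pos_of_mul_pos_left (by linarith) hn0.le
  have hf0' : ∀ i, 0 ≤ f i := fun i => (hf i).symm ▸ density_nonneg _ _ _
  have hf1 : ∀ i, f i ≤ 1 := fun i => (hf i).symm ▸ density_le_one _ _ _
  have hf0 : ∀ i, 0 < f i := fun i => (hf0' i).lt_of_ne'
    (prod_ne_zero_iff.1 ((pow_pos hθ 2).trans hprod).ne' i (mem_univ i))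
  have hlt : ∀ S : Finset ι, θ ^ 2 < ∏ i ∈ S, f i := fun S =>
    hprod.trans_le (prod_univ_le_prod hf0' hf1 S)
  set I : Finset ι := {i | x ^ K ≤ 1 - f i} with hI
  suffices ∃ I', I ⊆ I' ∧ HasRainbow F I' univ by
    obtain ⟨I', hII', hR⟩ := this
    have h1 : I' ∪ I'ᶜ = univ := union_compl I'
    have h2 := hR.union_of_one_sub_density_lt hF hkK hx0 hx1 I'ᶜ (fun i hi => by
      by_contra! h
      rw [← hf] at h
      exact mem_compl.1 hi (hII' (mem_filter.2 ⟨mem_univ _, h⟩))) (by rwa [h1])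
    rwa [h1] at h2
  rcases le_or_gt #I 2 with hc | hc
  · obtain ⟨I', hII', hI'⟩ := exists_superset_card_eq hc hι
    refine ⟨I', hII', ?_⟩
    obtain ⟨a, b, hab, rfl⟩ := card_eq_two.1 hI'
    have hk8 : ∀ i, 8 * k i ≤ n := fun i => by
      have h1 : (k i : ℝ) ≤ K := by exact_mod_cast hkK i
      have h2 : (8 : ℝ) ≤ (2 * 10 ^ 6 * (Real.log n + 10) ^ 2) ^ 3 := by
        have h3 : (8 : ℝ) ≤ 2 * 10 ^ 6 * (Real.log n + 10) ^ 2 := by nlinarith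
        exact h3.trans (le_self_pow₀ (by linarith) (by norm_num))
      have h4 : (8 * k i : ℝ) ≤ n := by nlinarith
      exact_mod_cast h4
    refine hasRainbow_pair hab hF hk hk8 ?_
    rw [div_lt_iff₀ (by positivity), ← hf, ← hf]
    refine (hkk a b hab).trans_lt (mul_lt_mul_of_pos_right ?_ (by positivity))
    simpa [prod_pair hab] using hlt {a, b}
  · refine ⟨I, Subset.rfl, ?_⟩
    obtain ⟨p₁, hp₁, hmin₁⟩ := exists_min_image I f (card_pos.1 (by omega))
    have hc₁ := card_erase_of_mem hp₁
    obtain ⟨p₂, hp₂, hmin₂⟩ := exists_min_image (I.erase p₁) f (card_pos.1 (by omega))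
    have hc₂ := card_erase_of_mem hp₂
    set R := (I.erase p₁).erase p₂ with hR
    have hI₂ : insert p₂ R = I.erase p₁ := insert_erase hp₂
    have hI₁ : insert p₁ (insert p₂ R) = I := by rw [hI₂, insert_erase hp₁]
    have hRI : ∀ i ∈ R, i ∈ I.erase p₁ := fun i hi => mem_of_mem_erase hi
    have hp₂R : p₂ ∉ R := notMem_erase _ _
    rw [← hI₁]
    refine hasRainbow_insert_insert (ℓ := Real.log n) hf (ne_of_mem_erase hp₂).symm
      (fun h => notMem_erase p₁ I (hRI _ h)) hp₂R (card_pos.1 (by omega)) hk hkK hK hθ hθK hkk hf0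
      (hmin₁ _ (mem_of_mem_erase hp₂)) (fun i hi => hmin₂ i (hRI i hi)) ?_ hn hKn (fun i hi => ?_) ?_
    · have h1 := hlt I
      rwa [← mul_prod_erase I f hp₁, ← mul_prod_erase _ f hp₂] at h1
    · rw [← hxK]
      exact (mem_filter.1 (mem_of_mem_erase (hRI i hi))).2
    · refine (sum_one_sub_le_neg_log_prod hf0 R).trans ?_
      have h1 : Real.log (θ ^ 2) ≤ Real.log (∏ i ∈ R, f i) :=
        Real.log_le_log (by positivity) (hlt R).le
      have h2 : 0 ≤ Real.log (θ * n) := Real.log_nonneg hθn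
      rw [Real.log_mul hθ.ne' hn0.ne'] at h2
      rw [Real.log_pow] at h1
      push_cast at h1
      linarith

end Assembly

theorem Fin.prod_univ_eq_mul_mul_prod_filter {M : Type*} [CommMonoid M] {t : ℕ} {a b : Fin t}
    (ha : a.val = 0) (hb : b.val = 1) (g : Fin t → M) :
    ∏ i, g i = g a * g b * ∏ i with 2 ≤ i.val, g i := by
  have h : (univ : Finset (Fin t)) =
      insert a (insert b ({i | 2 ≤ i.val} : Finset (Fin t))) := by
    ext i
    simp only [mem_univ, mem_insert, mem_filter, Fin.ext_iff, true_and, true_iff]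
    omega
  rw [h, prod_insert (by simp [Fin.ext_iff, ha, hb]), prod_insert (by simp [hb]), mul_assoc, ← h]

/-- Theorem 1.4: product-type condition for rainbow matchings, for `n` sufficiently
large with `Σ kᵢ ≤ n (1 - (8 k ln n / n)^(1/k))` where `k = max kᵢ`. -/
theorem rainbow_matching_product
    : ∃ N : ℕ, ∀ n ≥ N, ∀ t : ℕ, ∀ ht : 2 ≤ t, ∀ k : Fin t → ℕ, ∀ K : ℕ,
      (∀ i, 1 ≤ k i) →
      (∀ i, k i ≤ K) → (∃ i, k i = K) →
      (∀ i : Fin t, 2 ≤ i.val → k i ≤ k ⟨0, by omega⟩ ∧ k i ≤ k ⟨1, by omega⟩) →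
      ((∑ i : Fin t, (k i : ℝ)) ≤
        (n : ℝ) * (1 - (8 * K * Real.log n / n) ^ ((1 : ℝ) / K))) →
      ∀ F : Fin t → Finset (Finset (Fin n)),
      (∀ i, ∀ e ∈ F i, e.card = k i) →
      (t = 2 →
        (F ⟨0, by omega⟩).card * (F ⟨1, by omega⟩).card >
          (n - 1).choose (k ⟨0, by omega⟩ - 1) * (n - 1).choose (k ⟨1, by omega⟩ - 1)) →
      (3 ≤ t →
        ∏ i : Fin t, (F i).card >
          (n - 1).choose (k ⟨0, by omega⟩ - 1) * (n - 1).choose (k ⟨1, by omega⟩ - 1) *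
            ∏ i ∈ Finset.univ.filter (fun i : Fin t => 2 ≤ i.val), n.choose (k i)) →
      ∃ e : Fin t → Finset (Fin n), (∀ i, e i ∈ F i) ∧
        ∀ i j, i ≠ j → Disjoint (e i) (e j) := by
  obtain ⟨N, hN⟩ := exists_forall_log_mul_pow_le
  refine ⟨N, fun n hn t ht k K hk hkK hKex hk01 hsum F hF h2 h3 => ?_⟩
  obtain ⟨hlog, hpow⟩ := hN n hn
  obtain ⟨i₀, hi₀⟩ := hKex
  have hK : 0 < K := hi₀ ▸ hk i₀
  have hK' : (1 : ℝ) ≤ K := by exact_mod_cast hK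
  have hn0 : (0 : ℝ) < n := by
    rcases Nat.eq_zero_or_pos n with rfl | h0
    · norm_num at hlog
    · exact_mod_cast h0
  have hn1 : 1 ≤ n := by exact_mod_cast hn0
  set P := (2 * 10 ^ 6 * (Real.log n + 10) ^ 2) ^ 3 with hP
  have hP1 : 1 ≤ P := one_le_pow₀ (by nlinarith)
  have hKsum : (K : ℝ) ≤ ∑ i, (k i : ℝ) := by
    rw [← hi₀]
    exact single_le_sum (f := fun i => (k i : ℝ)) (fun i _ => Nat.cast_nonneg _) (mem_univ i₀)
  have hKsq := sq_le_mul_log_of_le_mul_one_sub_rpow hK (by linarith) (hKsum.trans hsum)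
  have hKP : K * P ≤ n := by
    refine le_of_pow_le_pow_left₀ (n := 2) (by norm_num) hn0.le ?_
    calc (K * P) ^ 2 = K ^ 2 * P ^ 2 := by ring
      _ ≤ n * Real.log n * P ^ 2 := by gcongr
      _ = n * (Real.log n * P ^ 2) := by ring
      _ ≤ n * n := by gcongr
      _ = _ := by ring
  have hkn : ∀ i, k i ≤ n := fun i => by
    have h4 : (K : ℝ) ≤ n := (le_mul_of_one_le_right (by positivity) hP1).trans hKP
    exact (hkK i).trans (by exact_mod_cast h4)
  set a : Fin t := ⟨0, by omega⟩ with ha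
  set b : Fin t := ⟨1, by omega⟩ with hb
  have hkkab : ∀ i j, i ≠ j → k i * k j ≤ k a * k b := by
    have hcases : ∀ i : Fin t, i = a ∨ i = b ∨ 2 ≤ i.val := fun i => by
      simp only [ha, hb, Fin.ext_iff]
      omega
    intro i j hij
    rcases hcases i with rfl | rfl | hi <;> rcases hcases j with rfl | rfl | hj
    · exact absurd rfl hij
    · rfl
    · exact Nat.mul_le_mul_left _ (hk01 j hj).2
    · rw [mul_comm]
    · exact absurd rfl hij
    · rw [mul_comm]
      exact Nat.mul_le_mul_right _ (hk01 j hj).1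
    · rw [mul_comm]
      exact Nat.mul_le_mul_left _ (hk01 i hi).2
    · exact Nat.mul_le_mul_right _ (hk01 i hi).1
    · exact Nat.mul_le_mul (hk01 i hi).1 (hk01 j hj).2
  have hcard : (n - 1).choose (k a - 1) * (n - 1).choose (k b - 1) *
      ∏ i ∈ Finset.univ.filter (fun i : Fin t => 2 ≤ i.val), n.choose (k i) < ∏ i, #(F i) := by
    rcases ht.eq_or_lt with rfl | ht3
    · have hemp : ({i | 2 ≤ i.val} : Finset (Fin 2)) = ∅ :=
        filter_eq_empty_iff.2 fun i _ => by omega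
      rw [hemp, prod_empty, mul_one, Fin.prod_univ_two]
      exact h2 rfl
    · exact h3 ht3
  have hchoose : (0 : ℝ) < ∏ i, (n.choose (k i) : ℝ) :=
    prod_pos fun i _ => by exact_mod_cast Nat.choose_pos (hkn i)
  have hprod : (k a * k b : ℝ) / n ^ 2 < ∏ i, density (k i) (F i) univ := by
    refine lt_of_mul_lt_mul_left ?_ hchoose.le
    rw [← prod_mul_distrib, prod_congr rfl fun i _ => choose_mul_density_univ (hF i)]
    have h4 : ((n - 1).choose (k a - 1) : ℝ) * (n - 1).choose (k b - 1) *
      ∏ i ∈ Finset.univ.filter (fun i : Fin t => 2 ≤ i.val), (n.choose (k i) : ℝ) <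
        ∏ i, (#(F i) : ℝ) := by exact_mod_cast hcard
    refine lt_of_eq_of_lt ?_ h4
    rw [Fin.prod_univ_eq_mul_mul_prod_filter (a := a) (b := b) rfl rfl,
      cast_choose_sub_one (hk a) hn1,
      cast_choose_sub_one (hk b) hn1]
    ring
  have hκ0 : (1 : ℝ) ≤ k a * k b := by exact_mod_cast Nat.mul_pos (hk a) (hk b)
  have hκK : (k a * k b : ℝ) ≤ K ^ 2 := by
    rw [sq]
    exact_mod_cast Nat.mul_le_mul (hkK a) (hkK b)
  set θ : ℝ := √(k a * k b) / n with hθ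
  have hθn : θ * n = √(k a * k b) := by rw [hθ]; field_simp
  have hθsq : θ ^ 2 = k a * k b / n ^ 2 := by rw [hθ, div_pow, Real.sq_sqrt (by linarith)]
  have hb0 : 0 ≤ 8 * K * Real.log n / n := by
    have : 0 ≤ Real.log n := by linarith
    positivity
  obtain ⟨e, he, hd⟩ := hasRainbow_univ_of_lt_prod_density hF hk hkK hK (by simpa using ht)
    (θ := θ) (x := (8 * K * Real.log n / n) ^ ((1 : ℝ) / K))
    (by rw [hθn]; exact Real.one_le_sqrt.2 hκ0)
    (by rw [hθn]; exact Real.sqrt_le_iff.2 ⟨by positivity, hκK⟩)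
    (fun i j hij => by
      rw [hθsq, div_mul_cancel₀ _ (by positivity)]
      exact_mod_cast hkkab i j hij)
    (by rwa [hθsq]) hlog hKP (Real.rpow_nonneg hb0 _)
    (by
      have h4 := pos_of_mul_pos_right ((by linarith : (0 : ℝ) < K).trans_le (hKsum.trans hsum))
        hn0.le
      linarith)
    (by rw [one_div, Real.rpow_inv_natCast_pow hb0 hK.ne']) hsum
  exact ⟨e, fun i => (he i (mem_univ i)).1, fun i j hij => hd i (mem_univ i) j (mem_univ j) hij⟩
end
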